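/- Let X be an infinite-dimensional complex Banach space and let φ : B(X) → B(X) be a map whose range contains every nonzero idempotent and every anti-idempotent operator. Suppose that for all A, B ∈ B(X), A∘B is idempotent if and only if φ(A)∘φ(B) is idempotent. Then either there exist a bounded invertible linear or conjugate-linear operator T : X → X and λ ∈ {−1, 1} such that φ(A) = λ·T A T⁻¹ for every A ∈ B(X), or X is reflexive and there exist a bounded invertible linear or conjugate-linear operator T : X′ → X and λ ∈ {−1, 1} such that φ(A) = λ·T A′ T⁻¹ for every A ∈ B(X), where A′ denotes the adjoint of A. -/

import Mathlib

namespace JP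

variable {X : Type*} [NormedAddCommGroup X] [NormedSpace ℂ X]

/-- The rank one operator `z ↦ f z • x`. -/
noncomputable def rk (x : X) (f : X →L[ℂ] ℂ) : X →L[ℂ] X := f.smulRight x

@[simp] lemma rk_apply (x : X) (f : X →L[ℂ] ℂ) (z : X) : rk x f z = f z • x := by
  simp [rk]

/-- The relation that the Jordan product is idempotent. -/
def Rel (A C : X →L[ℂ] X) : Prop := IsIdempotentElem ((2⁻¹ : ℂ) • (A * C + C * A))

lemma Rel_iff (A C : X →L[ℂ] X) : Rel A C ↔
    ∀ z, A (C (A (C z) + C (A z))) + C (A (A (C z) + C (A z))) = (2:ℂ) • (A (C z) + C (A z)) := by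
  unfold Rel IsIdempotentElem
  rw [smul_mul_smul_comm]
  constructor
  · intro h z
    have h1 := congrArg (fun T : X →L[ℂ] X => (4:ℂ) • T z) h
    simp only [_root_.smul_apply, _root_.mul_apply_eq_comp, _root_.add_apply, smul_smul] at h1
    norm_num at h1
    simpa only [map_add, smul_add] using h1
  · intro h
    ext z
    have h1 := h z
    simp only [_root_.smul_apply, _root_.mul_apply_eq_comp, _root_.add_apply, smul_smul]
    rw [h1, smul_smul]
    norm_num

lemma Rel_symm (A C : X →L[ℂ] X) : Rel A C ↔ Rel C A := by
  unfold Rel; rw [add_comm]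

lemma Rel_neg_neg (A C : X →L[ℂ] X) : Rel (-A) (-C) ↔ Rel A C := by
  unfold Rel; simp

lemma Rel_neg_left (A C : X →L[ℂ] X) : Rel (-A) C ↔ Rel A (-C) := by
  unfold Rel; simp

lemma Rel_zero (A : X →L[ℂ] X) : Rel A 0 := by
  unfold Rel IsIdempotentElem; simp

lemma Rel_one (A : X →L[ℂ] X) : Rel 1 A ↔ A * A = A := by
  unfold Rel IsIdempotentElem
  have : (2⁻¹ : ℂ) • (1 * A + A * 1) = A := by
    rw [one_mul, mul_one, ← two_smul ℂ A, smul_smul]; norm_num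
  rw [this]

lemma Rel_of_eq {A C S : X →L[ℂ] X} (h : A * C + C * A = (2:ℂ) • S) (hS : S * S = S) : Rel A C := by
  unfold Rel IsIdempotentElem
  rw [h, smul_smul]; norm_num; exact hS

lemma Rel_pm_iff (A C : X →L[ℂ] X) : (Rel A C ∧ Rel A (-C)) ↔ A * C + C * A = 0 := by
  constructor
  · rintro ⟨h1, h2⟩
    unfold Rel IsIdempotentElem at h1 h2
    have e : (2⁻¹ : ℂ) • (A * -C + -C * A) = - ((2⁻¹ : ℂ) • (A * C + C * A)) := by
      rw [mul_neg, neg_mul, ← smul_neg]; congr 1; abel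
    rw [e, neg_mul_neg, h1] at h2
    have h3 : (2⁻¹ : ℂ) • (A * C + C * A) = 0 := by
      have h4 := add_eq_zero_iff_eq_neg.mpr h2
      rw [← two_smul ℂ] at h4
      exact (smul_eq_zero.mp h4).resolve_left two_ne_zero
    exact (smul_eq_zero.mp h3).resolve_left (by norm_num)
  · intro h
    refine ⟨Rel_of_eq (S := 0) (by simp [h]) (by simp), Rel_of_eq (S := 0) ?_ (by simp)⟩
    rw [mul_neg, neg_mul, ← neg_add, h]; simp

lemma exists_dual {x : X} (hx : x ≠ 0) : ∃ f : X →L[ℂ] ℂ, f x = 1 :=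
  SeparatingDual.exists_eq_one hx

lemma HBV (V : Submodule ℂ X) [FiniteDimensional ℂ V] {x : X} (hx : x ∉ V) :
    ∃ f : X →L[ℂ] ℂ, (∀ v ∈ V, f v = 0) ∧ f x = 1 := by
  have hc : IsClosed (V : Set X) := Submodule.closed_of_finiteDimensional V
  haveI : IsClosed (V : Set X) := hc
  have hne : V.mkQL x ≠ 0 := by
    simpa [Submodule.Quotient.mk_eq_zero] using hx
  obtain ⟨g, hg⟩ := SeparatingDual.exists_eq_one (R := ℂ) hne
  refine ⟨g.comp V.mkQL, fun v hv => ?_, hg⟩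
  have : V.mkQL v = 0 := by simpa [Submodule.Quotient.mk_eq_zero] using hv
  simp [this]

lemma ext_dual {x y : X} (h : ∀ f : X →L[ℂ] ℂ, f x = f y) : x = y := by
  by_contra hne
  obtain ⟨f, hf⟩ := exists_dual (sub_ne_zero.mpr hne)
  rw [map_sub, h f] at hf
  simp at hf

/-- rank one lemma -/
lemma RL (A : X →L[ℂ] X) {x : X} {f : X →L[ℂ] ℂ} (hfx : f x = 1) : Rel A (rk x f) ↔
    ((f (A x) = 1 ∧ (A x = x ∨ ∀ z, f (A z) = f z)) ∨ (A x = 0 ∧ ∀ z, f (A z) = 0)) := by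
  rw [Rel_iff]
  simp only [rk_apply, map_add, map_smul, smul_eq_mul, add_smul, smul_add, smul_smul]
  constructor
  · intro h
    have hx := h x
    rw [hfx] at hx
    simp only [one_mul, mul_one, one_smul] at hx
    have hfx2 := congrArg f hx
    simp only [map_add, map_smul, smul_eq_mul, hfx, mul_one] at hfx2
    set a := f (A x) with ha
    have hf2 : f (A (A x)) = 4 * a - 3 * a * a := by linear_combination hfx2
    have h1 : (a - 1) • (A x - a • x) = 0 := by
      rw [hf2] at hx
      have e : (a - 1) • (A x - a • x) = (2⁻¹:ℂ) • ((a • A x + a • A x + ((4 * a - 3 * a * a) • x + (a * a) • x)) - ((2:ℂ) • A x + (2 * a) • x)) := by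
        module
      rw [e, sub_eq_zero.mpr, smul_zero]
      rw [← hx]
    have h2 : ∀ z, (a - 1) * (f (A z) - a * f z) = 0 := by
      intro z
      have := congrArg f (h z)
      simp only [map_add, map_smul, smul_eq_mul, hfx, mul_one, ← ha, hf2] at this
      linear_combination this / 2
    by_cases ha1 : a = 1
    · left
      refine ⟨ha1, ?_⟩
      by_contra hcon
      push Not at hcon
      obtain ⟨hc1, z, hz⟩ := hcon
      have := h z
      rw [hf2, ha1, hfx] at this
      have e : (f (A z) - f z) • (A x - x) = 0 := by
        have e2 : (f (A z) - f z) • (A x - x) =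
          ((f z * 1) • A x + f (A z) • A x + ((f z * (4 * 1 - 3 * 1 * 1)) • x + (f (A z) * 1) • x)) - ((2 * f z) • A x + (2 * f (A z)) • x) := by
          module
        rw [e2, sub_eq_zero, ← this]
        module
      rcases smul_eq_zero.mp e with e | e
      · exact hz (sub_eq_zero.mp e)
      · exact hc1 (sub_eq_zero.mp e)
    · right
      have ha1' : a - 1 ≠ 0 := sub_ne_zero.mpr ha1
      have hA : A x = a • x := sub_eq_zero.mp ((smul_eq_zero.mp h1).resolve_left ha1')
      have hfA : ∀ z, f (A z) = a * f z := fun z =>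
        sub_eq_zero.mp ((mul_eq_zero.mp (h2 z)).resolve_left ha1')
      have h3 : f (A (A x)) = a * a := by rw [hfA (A x)]
      have : a * (a - 1) = 0 := by rw [hf2] at h3; linear_combination -h3/4
      have ha0 : a = 0 := (mul_eq_zero.mp this).resolve_right ha1'
      refine ⟨by rw [hA, ha0, zero_smul], fun z => by rw [hfA, ha0, zero_mul]⟩
  · rintro (⟨h1, h2 | h2⟩ | ⟨h1, h2⟩) z
    · simp only [h2, hfx]; module
    · simp only [h2, hfx]; module
    · simp only [h1, h2, map_zero]; simp

lemma RLm (A : X →L[ℂ] X) {x : X} {f : X →L[ℂ] ℂ} (hfx : f x = 1) :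
    (Rel A (rk x f) ∧ Rel A (-rk x f)) ↔ (A x = 0 ∧ ∀ z, f (A z) = 0) := by
  constructor
  · rintro ⟨h1, h2⟩
    rw [← Rel_neg_left, RL _ hfx] at h2
    rw [RL _ hfx] at h1
    rcases h1 with ⟨h1, -⟩ | h1
    · rcases h2 with ⟨h2, -⟩ | ⟨h2, h3⟩
      · simp [h1] at h2; norm_num at h2
      · have := h3 x
        simp [h1] at this
    · exact h1
  · intro h
    refine ⟨(RL _ hfx).mpr (Or.inr h), ?_⟩
    rw [← Rel_neg_left, RL _ hfx]
    right
    simp [h.1, h.2]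

lemma rk_idem {x : X} {f : X →L[ℂ] ℂ} (hfx : f x = 1) : rk x f * rk x f = rk x f := by
  ext z; simp [hfx]

end JP


namespace JP

variable {X : Type*} [NormedAddCommGroup X] [NormedSpace ℂ X]

/-- Pairs of operators that behave in the same way against rank one idempotents and their
negatives. -/
def Pair (A B : X →L[ℂ] X) : Prop := ∀ (x : X) (f : X →L[ℂ] ℂ), f x = 1 →
  (Rel A (rk x f) ↔ Rel B (rk x f)) ∧ (Rel A (-rk x f) ↔ Rel B (-rk x f))

lemma Pair.symm {A B : X →L[ℂ] X} (h : Pair A B) : Pair B A :=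
  fun x f hf => ⟨(h x f hf).1.symm, (h x f hf).2.symm⟩

lemma Pair.neg {A B : X →L[ℂ] X} (h : Pair A B) : Pair (-A) (-B) := by
  intro x f hf
  refine ⟨?_, ?_⟩
  · rw [Rel_neg_left, Rel_neg_left]; exact (h x f hf).2
  · rw [Rel_neg_neg, Rel_neg_neg]; exact (h x f hf).1

lemma Pair.zero_iff {A B : X →L[ℂ] X} (h : Pair A B) {x : X} {f : X →L[ℂ] ℂ} (hf : f x = 1) :
    (A x = 0 ∧ ∀ z, f (A z) = 0) ↔ (B x = 0 ∧ ∀ z, f (B z) = 0) := by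
  rw [← RLm A hf, ← RLm B hf, (h x f hf).1, (h x f hf).2]

lemma Pair.zero {A B : X →L[ℂ] X} (h : Pair A B) (hA : A = 0) : B = 0 := by
  ext x
  by_cases hx : x = 0
  · simp [hx]
  obtain ⟨f, hf⟩ := exists_dual hx
  exact ((h.zero_iff hf).mp (by simp [hA])).1

lemma Pair.ne_zero {A B : X →L[ℂ] X} (h : Pair A B) (hA : A ≠ 0) : B ≠ 0 :=
  fun hB => hA (h.symm.zero hB)

lemma Pair.corner {A B E : X →L[ℂ] X} (h : Pair A B) (hE : E * E = E) (h1 : E * A = A)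
    (h2 : A * E = A) : E * B = B ∧ B * E = B := by
  have hE' : ∀ z, E (E z) = E z := fun z => congrArg (fun T : X →L[ℂ] X => T z) hE
  have h1' : ∀ z, E (A z) = A z := fun z => congrArg (fun T : X →L[ℂ] X => T z) h1
  have h2' : ∀ z, A (E z) = A z := fun z => congrArg (fun T : X →L[ℂ] X => T z) h2
  have key : ∀ (z : X) (k : X →L[ℂ] ℂ), E z = 0 → (∀ w, k (E w) = 0) → k z = 1 →
      B z = 0 ∧ ∀ w, k (B w) = 0 := by
    intro z k hz hk hkz
    refine (h.zero_iff hkz).mp ⟨?_, fun w => ?_⟩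
    · rw [← h2', hz, map_zero]
    · rw [← h1', hk]
  constructor
  · ext w
    rw [_root_.mul_apply_eq_comp, ← sub_eq_zero]
    by_contra hne
    obtain ⟨k, hk⟩ := exists_dual hne
    have hk0 : ∀ u, (k.comp (E - 1)) (E u) = 0 := by
      intro u; simp [hE']
    have hkw : (k.comp (E - 1)) (B w) = 1 := by simpa using hk
    have hz : (k.comp (E - 1)) ((1 - E) (B w)) = 1 := by
      simp only [_root_.sub_apply, _root_.one_apply_eq_self, map_sub] at hkw ⊢
      rw [hk0, hkw, sub_zero]
    have := (key ((1 - E) (B w)) (k.comp (E - 1)) (by simp [hE']) hk0 hz).2 w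
    rw [this] at hkw; exact zero_ne_one hkw
  · ext w
    rw [_root_.mul_apply_eq_comp, ← sub_eq_zero, ← map_sub]
    by_cases hne : E w - w = 0
    · rw [hne, map_zero]
    obtain ⟨k, hk⟩ := exists_dual hne
    refine (key (E w - w) (k.comp (1 - E)) (by simp [hE']) (by intro u; simp [hE']) ?_).1
    simp only [ContinuousLinearMap.comp_apply, _root_.sub_apply, _root_.one_apply_eq_self, map_sub, hE']
    rw [map_sub] at hk
    simpa using hk

lemma span1 {x u v : X} (hx : x ≠ 0) (h : ∀ f : X →L[ℂ] ℂ, f x = 1 → f u = f v) : u = v := by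
  obtain ⟨f0, hf0⟩ := exists_dual hx
  refine ext_dual fun g => ?_
  have h1 := h f0 hf0
  have h2 := h (f0 + g - g x • f0) (by simp [hf0])
  simp only [_root_.sub_apply, _root_.add_apply, _root_.smul_apply, smul_eq_mul, h1] at h2
  linear_combination h2

lemma span1' {f : X →L[ℂ] ℂ} {x0 : X} (hx0 : f x0 = 1) {U V : X →L[ℂ] X}
    (h : ∀ x, f x = 1 → U x = V x) : U = V := by
  ext z
  have h1 := h x0 hx0
  have h2 := h (x0 + z - f z • x0) (by simp [hx0])
  simp only [map_sub, map_add, map_smul, h1] at h2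
  simpa using h2

lemma EL_pure {G : X →L[ℂ] X} {x : X} (hG : G ≠ 0)
    (h : ∀ f : X →L[ℂ] ℂ, f x = 1 → Rel G (rk x f)) : G x = x := by
  by_cases hx : x = 0
  · simp [hx]
  by_contra hne
  have h' : ∀ f : X →L[ℂ] ℂ, f x = 1 → (∀ z, f (G z) = f z) ∨ (G x = 0 ∧ ∀ z, f (G z) = 0) := by
    intro f hf
    rcases (RL G hf).mp (h f hf) with ⟨-, h1 | h1⟩ | h1
    · exact absurd h1 hne
    · exact Or.inl h1
    · exact Or.inr h1
  by_cases hGx : G x = 0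
  · apply hG
    ext z
    refine span1 hx fun f hf => ?_
    rcases h' f hf with h1 | h1
    · have := h1 x
      rw [hGx, hf] at this; simp at this
    · simpa using h1.2 z
  · apply hne
    refine span1 hx fun f hf => ?_
    rcases h' f hf with h1 | h1
    · exact h1 x
    · exact absurd h1.1 hGx

lemma EL_pure' {G : X →L[ℂ] X} {f : X →L[ℂ] ℂ} (hG : G ≠ 0)
    (h : ∀ x : X, f x = 1 → Rel G (rk x f)) : ∀ z, f (G z) = f z := by
  by_cases hf0 : f = 0
  · simp [hf0]
  obtain ⟨w, hw⟩ : ∃ w, f w ≠ 0 := by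
    by_contra hcon
    push Not at hcon
    exact hf0 (ContinuousLinearMap.ext hcon)
  have hx0 : f ((f w)⁻¹ • w) = 1 := by simp [hw]
  set x0 := (f w)⁻¹ • w
  by_contra hne
  have h' : ∀ x, f x = 1 → (G x = x) ∨ (G x = 0 ∧ ∀ z, f (G z) = 0) := by
    intro x hx
    rcases (RL G hx).mp (h x hx) with ⟨-, h1 | h1⟩ | h1
    · exact Or.inl h1
    · exact absurd h1 hne
    · exact Or.inr h1
  by_cases hGx : ∀ z, f (G z) = 0
  · apply hG
    refine span1' hx0 fun x hx => ?_
    rcases h' x hx with h1 | h1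
    · have := hGx x
      rw [h1, hx] at this; simp at this
    · simpa using h1.1
  · apply hne
    have : G = 1 := by
      refine span1' hx0 fun x hx => ?_
      rcases h' x hx with h1 | h1
      · exact h1
      · exact absurd h1.2 hGx
    simp [this]

lemma Pair.EL {A B : X →L[ℂ] X} (h : Pair A B) {x : X} (hx : A x = x) : B x = x := by
  by_cases hx0 : x = 0
  · simp [hx0]
  have hA : A ≠ 0 := by rintro rfl; exact hx0 (by simpa using hx.symm)
  refine EL_pure (h.ne_zero hA) fun f hf => (h x f hf).1.mp ((RL A hf).mpr ?_)
  left; exact ⟨by rw [hx, hf], Or.inl hx⟩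

lemma Pair.EL' {A B : X →L[ℂ] X} (h : Pair A B) {f : X →L[ℂ] ℂ} (hx : ∀ z, f (A z) = f z) :
    ∀ z, f (B z) = f z := by
  by_cases hf0 : f = 0
  · simp [hf0]
  have hA : A ≠ 0 := by
    rintro rfl; apply hf0; ext z; simpa using (hx z).symm
  refine EL_pure' (h.ne_zero hA) fun x hf => (h x f hf).1.mp ((RL A hf).mpr ?_)
  left; exact ⟨by rw [hx, hf], Or.inr hx⟩

lemma Pair.ELm {A B : X →L[ℂ] X} (h : Pair A B) {x : X} (hx : A x = -x) : B x = -x := by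
  have := h.neg.EL (x := x) (by simp [hx])
  simp only [_root_.neg_apply] at this
  rw [neg_eq_iff_eq_neg] at this
  exact this

lemma Pair.trip {C B : X →L[ℂ] X} (h : Pair C B) (hC : C * C * C = C) : B = C := by
  have hc := (h.corner (E := C * C) (by rw [← mul_assoc, hC]) hC (by rw [← mul_assoc, hC])).2
  have hC' : ∀ z, C (C (C z)) = C z := fun z => congrArg (fun T : X →L[ℂ] X => T z) hC
  ext z
  have h1 : B (C (C z)) = B z := congrArg (fun T : X →L[ℂ] X => T z) hc
  have h2 : B (C (C z) + C z) = C (C z) + C z := h.EL (by simp [hC', add_comm])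
  have h3 : B (C (C z) - C z) = -(C (C z) - C z) := h.ELm (by simp [hC'])
  rw [map_add] at h2
  rw [map_sub] at h3
  rw [← h1]
  have h4 : (2:ℂ) • B (C (C z)) = (2:ℂ) • C z := by
    calc (2:ℂ) • B (C (C z)) = (B (C (C z)) + B (C z)) + (B (C (C z)) - B (C z)) := by module
      _ = _ := by rw [h2, h3]; module
  exact smul_right_injective X (two_ne_zero : (2:ℂ) ≠ 0) h4

/-- hypotheses of the fixing theorem -/
structure FixHyp (φ : (X →L[ℂ] X) → (X →L[ℂ] X)) : Prop where
  inf : ¬ FiniteDimensional ℂ X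
  rel : ∀ A C, Rel A C ↔ Rel (φ A) (φ C)
  fp : ∀ (x : X) (f : X →L[ℂ] ℂ), f x = 1 → φ (rk x f) = rk x f
  fm : ∀ (x : X) (f : X →L[ℂ] ℂ), f x = 1 → φ (-rk x f) = -rk x f

lemma exists_notMem (hinf : ¬ FiniteDimensional ℂ X) (V : Submodule ℂ X) [FiniteDimensional ℂ V] :
    ∃ x, x ∉ V := by
  by_contra h
  push Not at h
  apply hinf
  have : V = ⊤ := by ext; simp [h]
  subst this
  exact Module.Finite.equiv (Submodule.topEquiv (R := ℂ) (M := X))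

variable {φ : (X →L[ℂ] X) → (X →L[ℂ] X)}

lemma FixHyp.pair (H : FixHyp φ) (A : X →L[ℂ] X) : Pair A (φ A) := by
  intro x f hf
  rw [H.rel A (rk x f), H.rel A (-rk x f), H.fp x f hf, H.fm x f hf]
  exact ⟨Iff.rfl, Iff.rfl⟩

lemma FixHyp.trip (H : FixHyp φ) {C : X →L[ℂ] X} (hC : C * C * C = C) : φ C = C :=
  (H.pair C).trip hC

lemma FixHyp.sc1 (H : FixHyp φ) (c : ℂ) (hc : c ≠ 0) {x : X} {f : X →L[ℂ] ℂ} (hf : f x = 1) :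
    ∃ s : ℂ, s ≠ 0 ∧ φ (c • rk x f) = s • rk x f := by
  have h := H.pair (c • rk x f)
  obtain ⟨h1, h2⟩ := h.corner (E := rk x f) (rk_idem hf) (by ext; simp [hf]) (by ext; simp [hf])
  have e : φ (c • rk x f) = f (φ (c • rk x f) x) • rk x f := by
    ext z
    have h1' := congrArg (fun T : X →L[ℂ] X => T x) h1
    have h2' := congrArg (fun T : X →L[ℂ] X => T z) h2
    simp only [_root_.mul_apply_eq_comp, rk_apply, map_smul] at h1' h2'
    rw [← h2']
    conv_lhs => rw [← h1']
    simp only [_root_.smul_apply, rk_apply, smul_smul]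
    rw [mul_comm]
  refine ⟨_, ?_, e⟩
  intro h0
  rw [h0, zero_smul] at e
  have h3 := h.symm.zero e
  have h4 := congrArg (fun T : X →L[ℂ] X => f (T x)) h3
  simp [hf] at h4
  exact hc h4

lemma Rel_smul_smul (a b : ℂ) (A C : X →L[ℂ] X) : Rel (a • A) (b • C) ↔ Rel ((b * a) • A) C := by
  unfold Rel
  have : a • A * b • C + b • C * a • A = (b * a) • A * C + C * (b * a) • A := by
    simp only [smul_mul_assoc, mul_smul_comm, smul_smul, mul_comm a b]
  rw [this]

lemma sc_aux {x y : X} {f g : X →L[ℂ] ℂ} (hf : f x = 1) (hg : g y = 1)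
    (hadj : g x = 1 ∧ f y = 1 ∧ (y = x ∨ g = f)) (r : ℂ) (hr : r ≠ 0) :
    Rel (r • rk x f) (rk y g) ↔ r = 1 := by
  obtain ⟨h3, h4, h5⟩ := hadj
  rw [RL _ hg]
  simp only [_root_.smul_apply, rk_apply, h4, one_smul, map_smul, h3, smul_eq_mul, mul_one]
  constructor
  · rintro (⟨h, -⟩ | ⟨h, -⟩)
    · exact h
    · have := congrArg g h
      simp [h3, hr] at this
  · rintro rfl
    left
    refine ⟨rfl, ?_⟩
    rcases h5 with h5 | h5
    · left; simp [h5]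
    · right; intro z; simp [h5]

lemma FixHyp.sc2 (H : FixHyp φ) {c s t : ℂ} (hc : c ≠ 0) {x y : X} {f g : X →L[ℂ] ℂ}
    (hf : f x = 1) (hg : g y = 1)
    (hadj : g x = 1 ∧ f y = 1 ∧ (y = x ∨ g = f)) (hs0 : s ≠ 0) (ht0 : t ≠ 0)
    (hs : φ (c • rk x f) = s • rk x f)
    (ht : φ (c⁻¹ • rk y g) = t • rk y g) : t * s = 1 := by
  have := H.rel (c • rk x f) (c⁻¹ • rk y g)
  rw [hs, ht, Rel_smul_smul, Rel_smul_smul, sc_aux hf hg hadj _ (by simp [hc]),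
    sc_aux hf hg hadj _ (by simp [hs0, ht0])] at this
  exact this.mp (by field_simp)

lemma FixHyp.sc3 (H : FixHyp φ) {c s t : ℂ} (hc : c ≠ 0) {x y : X} {f g : X →L[ℂ] ℂ}
    (hf : f x = 1) (hg : g y = 1)
    (hadj : g x = 1 ∧ f y = 1 ∧ (y = x ∨ g = f)) (hs0 : s ≠ 0) (ht0 : t ≠ 0)
    (hs : φ (c • rk x f) = s • rk x f)
    (ht : φ (c • rk y g) = t • rk y g) : s = t := by
  obtain ⟨u, hu0, hu⟩ := H.sc1 c⁻¹ (inv_ne_zero hc) hg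
  have h1 := H.sc2 hc hf hg hadj hs0 hu0 hs hu
  have h2 := H.sc2 hc hg hg ⟨hg, hg, Or.inl rfl⟩ ht0 hu0 ht hu
  exact mul_left_cancel₀ hu0 (h1.trans h2.symm)

lemma exists_common {x y : X} (hx : x ≠ 0) (hy : y ≠ 0) : ∃ h : X →L[ℂ] ℂ, h x = 1 ∧ h y ≠ 0 := by
  obtain ⟨h1, hh1⟩ := exists_dual hx
  obtain ⟨h2, hh2⟩ := exists_dual hy
  by_cases h1y : h1 y = 0
  · by_cases h2x : h2 x = 0
    · exact ⟨h1 + h2, by simp [hh1, h2x], by simp [h1y, hh2]⟩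
    · exact ⟨(h2 x)⁻¹ • h2, by simp [h2x], by simp [hh2, h2x]⟩
  · exact ⟨h1, hh1, h1y⟩

lemma rk_smul_smul (c : ℂ) (hc : c ≠ 0) (x : X) (f : X →L[ℂ] ℂ) : rk (c⁻¹ • x) (c • f) = rk x f := by
  ext z; simp [smul_smul]; congr 1; field_simp

lemma FixHyp.sc (H : FixHyp φ) (c : ℂ) (hc : c ≠ 0) : ∃ s : ℂ, s ≠ 0 ∧
    ∀ (x : X) (f : X →L[ℂ] ℂ), f x = 1 → φ (c • rk x f) = s • rk x f := by
  obtain ⟨x, hx⟩ := exists_notMem H.inf (⊥ : Submodule ℂ X)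
  have hx : x ≠ 0 := by simpa using hx
  obtain ⟨f, hf⟩ := exists_dual hx
  obtain ⟨s, hs0, hs⟩ := H.sc1 c hc hf
  refine ⟨s, hs0, fun y g hg => ?_⟩
  have hy : y ≠ 0 := by rintro rfl; simp at hg
  obtain ⟨h, hhx, hhy⟩ := exists_common hx hy
  obtain ⟨s1, hs10, hs1⟩ := H.sc1 c hc hhx
  have e1 : s = s1 := H.sc3 hc hf hhx ⟨hhx, hf, Or.inl rfl⟩ hs0 hs10 hs hs1
  have hhy' : h ((h y)⁻¹ • y) = 1 := by simp [hhy]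
  obtain ⟨s2, hs20, hs2⟩ := H.sc1 c hc hhy'
  have e2 : s1 = s2 := H.sc3 hc hhx hhy' ⟨hhx, hhy', Or.inr rfl⟩ hs10 hs20 hs1 hs2
  have hgy : (h y • g) ((h y)⁻¹ • y) = 1 := by simp [hg, hhy]
  obtain ⟨s3, hs30, hs3⟩ := H.sc1 c hc hgy
  have e3 : s2 = s3 := H.sc3 hc hhy' hgy ⟨hgy, hhy', Or.inl rfl⟩ hs20 hs30 hs2 hs3
  rw [rk_smul_smul _ hhy, ← e3, ← e2, ← e1] at hs3
  exact hs3

/-- a biorthogonal system of length two -/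
lemma exists_biorth (hinf : ¬ FiniteDimensional ℂ X) : ∃ (x y : X) (f g : X →L[ℂ] ℂ),
    f x = 1 ∧ g y = 1 ∧ f y = 0 ∧ g x = 0 := by
  obtain ⟨x, hx⟩ := exists_notMem hinf (⊥ : Submodule ℂ X)
  have hx : x ≠ 0 := by simpa using hx
  obtain ⟨y, hy⟩ := exists_notMem hinf (Submodule.span ℂ {x})
  obtain ⟨g, hg, hgy⟩ := HBV _ hy
  obtain ⟨f, hf⟩ := exists_dual hx
  have hgx : g x = 0 := hg x (Submodule.mem_span_singleton_self x)
  exact ⟨x, y, f - f y • g, g, by simp [hf, hgx], hgy, by simp [hgy], hgx⟩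

lemma FixHyp.scEL (H : FixHyp φ) {c s : ℂ} (hc : c ≠ 0) (hs0 : s ≠ 0)
    (hs : ∀ (x : X) (f : X →L[ℂ] ℂ), f x = 1 → φ (c • rk x f) = s • rk x f)
    {A : X →L[ℂ] X} {x : X} (hA : A x = c • x) : φ A x = s • x := by
  by_cases hx0 : x = 0
  · simp [hx0]
  obtain ⟨t, ht0, ht⟩ := H.sc c⁻¹ (inv_ne_zero hc)
  have hA0 : A ≠ 0 := by
    rintro rfl
    have : c • x = 0 := by rw [← hA]; simp
    exact (smul_ne_zero hc hx0) this
  have hB0 := (H.pair A).ne_zero hA0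
  have hts : t * s = 1 := by
    obtain ⟨f, hf⟩ := exists_dual hx0
    exact H.sc2 hc hf hf ⟨hf, hf, Or.inl rfl⟩ hs0 ht0 (hs x f hf) (ht x f hf)
  have h1 : (t • φ A) x = x := by
    refine EL_pure (smul_ne_zero ht0 hB0) fun f hf => ?_
    have h2 := H.rel A (c⁻¹ • rk x f)
    rw [ht x f hf, ← one_smul ℂ A, ← one_smul ℂ (φ _), Rel_smul_smul, Rel_smul_smul] at h2
    simp only [mul_one, one_smul] at h2
    rw [← h2, RL _ hf]
    left
    simp [hA, hc, hf]
  rw [_root_.smul_apply] at h1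
  calc φ A x = (t * s) • φ A x := by rw [hts, one_smul]
    _ = s • (t • φ A x) := by rw [smul_smul, mul_comm]
    _ = s • x := by rw [h1]

lemma FixHyp.scalar (H : FixHyp φ) (c : ℂ) (hc : c ≠ 0)
    (x : X) (f : X →L[ℂ] ℂ) (hfx : f x = 1) : φ (c • rk x f) = c • rk x f := by
  obtain ⟨s, hs0, hs⟩ := H.sc c hc
  obtain ⟨s', hs0', hs'⟩ := H.sc (-c) (neg_ne_zero.mpr hc)
  rw [hs x f hfx]
  suffices s = c by rw [this]
  clear hfx
  clear x f
  obtain ⟨x, y, f, g, hfx, hgy, hfy, hgx⟩ := exists_biorth H.inf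
  have hK : φ (rk x f - rk y g) = rk x f - rk y g := by
    apply H.trip; ext z; simp [hfx, hgy, hfy, hgx]
  have hK' : φ (-(rk x f - rk y g)) = -(rk x f - rk y g) := by
    apply H.trip; ext z; simp [hfx, hgy, hfy, hgx]
  have hodd : s' = -s := by
    set M := c • (rk x g + rk y f) with hM
    have h1 : φ M (x + y) = s • (x + y) := by
      apply H.scEL hc hs0 hs; simp [hM, hfx, hgy, hfy, hgx, add_comm]
    have h2 : φ M (x - y) = s' • (x - y) := by
      apply H.scEL (neg_ne_zero.mpr hc) hs0' hs'; simp [hM, hfx, hgy, hfy, hgx, smul_sub]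
    have h0 : M * (rk x f - rk y g) + (rk x f - rk y g) * M = 0 := by
      ext z; simp [hM, hfx, hgy, hfy, hgx, smul_sub, smul_smul]
    have h3 : φ M * (rk x f - rk y g) + (rk x f - rk y g) * φ M = 0 := by
      rw [← Rel_pm_iff] at h0 ⊢
      have a1 := (H.rel _ _).mp h0.1
      have a2 := (H.rel _ _).mp h0.2
      rw [hK] at a1
      rw [hK'] at a2
      exact ⟨a1, a2⟩
    have h4 := congrArg (fun T : X →L[ℂ] X => f (T x)) h3
    have h5 := congrArg f h1
    have h6 := congrArg f h2
    simp [hfx, hgy, hfy, hgx] at h4 h5 h6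
    linear_combination -h5 - h6 + 2 * h4
  set M := rk x f + (c^2 - 1) • rk y f + rk x g - rk y g with hM
  have h1 : φ M (x + (c - 1) • y) = s • (x + (c - 1) • y) := by
    apply H.scEL hc hs0 hs; simp [hM, hfx, hgy, hfy, hgx]; module
  have h2 : φ M (x - (c + 1) • y) = s' • (x - (c + 1) • y) := by
    apply H.scEL (neg_ne_zero.mpr hc) hs0' hs'; simp [hM, hfx, hgy, hfy, hgx]; module
  have h0 : Rel M (rk x f - rk y g) := by
    apply Rel_of_eq (S := rk x f + rk y g)
    · ext z; simp [hM, hfx, hgy, hfy, hgx]; module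
    · ext z; simp [hfx, hgy, hfy, hgx]
  rw [H.rel, hK, Rel_iff] at h0
  have hx : φ M x = (s / c) • (x + (c ^ 2 - 1) • y) := by
    have : x = (2 * c)⁻¹ • ((c + 1) • (x + (c - 1) • y) + (c - 1) • (x - (c + 1) • y)) := by
      match_scalars
      · field_simp; ring
      · field_simp; ring
    conv_lhs => rw [this]
    rw [map_smul, map_add, map_smul, map_smul, h1, h2, hodd]
    match_scalars
    · field_simp; ring
    · field_simp; ring
  have h3 := h0 x
  have h4 : φ M ((rk x f - rk y g) x) + (rk x f - rk y g) (φ M x) = (2 * (s / c)) • x := by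
    simp [hx, hfx, hgy, hfy, hgx]; module
  have h5 : ∀ r : ℂ, φ M ((rk x f - rk y g) (r • x)) + (rk x f - rk y g) (φ M (r • x)) = r • (2 * (s / c)) • x := by
    intro r
    rw [← h4]; simp only [map_smul, smul_add]
  rw [h4, h5] at h3
  have h6 := congrArg f h3
  simp [hfx] at h6
  field_simp at h6
  rcases h6 with h6 | h6 | h6
  · exact h6
  · exact absurd h6 hs0
  · exact absurd h6 hc

lemma mem_span_singleton_of_dual {u x : X} (h : ∀ k : X →L[ℂ] ℂ, k x = 0 → k u = 0) :
    ∃ c : ℂ, u = c • x := by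
  by_contra hcon
  have : u ∉ Submodule.span ℂ {x} := by
    intro hm
    obtain ⟨c, hc⟩ := Submodule.mem_span_singleton.mp hm
    exact hcon ⟨c, hc.symm⟩
  obtain ⟨k, hk, hku⟩ := HBV _ this
  rw [h k (hk x (Submodule.mem_span_singleton_self x))] at hku
  exact zero_ne_one hku

lemma exists_one_of_ne {f : X →L[ℂ] ℂ} (hf : f ≠ 0) : ∃ w, f w = 1 := by
  obtain ⟨w, hw⟩ : ∃ w, f w ≠ 0 := by
    by_contra hcon
    push Not at hcon
    exact hf (ContinuousLinearMap.ext hcon)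
  exact ⟨(f w)⁻¹ • w, by simp [hw]⟩

lemma exists_ker_notMem (hinf : ¬ FiniteDimensional ℂ X) (g : X →L[ℂ] ℂ) (V : Submodule ℂ X)
    [FiniteDimensional ℂ V] : ∃ z, g z = 0 ∧ z ∉ V := by
  by_cases hg : g = 0
  · obtain ⟨z, hz⟩ := exists_notMem hinf V
    exact ⟨z, by simp [hg], hz⟩
  obtain ⟨w, hw⟩ := exists_one_of_ne hg
  obtain ⟨z, hz⟩ := exists_notMem hinf (V ⊔ Submodule.span ℂ {w})
  refine ⟨z - g z • w, by simp [hw], fun hm => hz ?_⟩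
  have : z = (z - g z • w) + g z • w := by abel
  rw [this]
  exact Submodule.add_mem_sup hm (Submodule.smul_mem _ _ (Submodule.mem_span_singleton_self w))

lemma FixHyp.nil (H : FixHyp φ) {x : X} {g : X →L[ℂ] ℂ} (hx : x ≠ 0) (hg : g ≠ 0) (hgx : g x = 0) :
    φ (rk x g) = rk x g := by
  obtain ⟨y, hgy⟩ := exists_one_of_ne hg
  obtain ⟨z0, hgz0, hz0⟩ := exists_ker_notMem H.inf g (Submodule.span ℂ {x})
  obtain ⟨k0, hk0, hk0z⟩ := HBV _ hz0
  have hk0x : k0 x = 0 := hk0 x (Submodule.mem_span_singleton_self x)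
  have hp := H.pair (rk x g)
  set B := φ (rk x g) with hB
  have key : ∀ (z : X) (k : X →L[ℂ] ℂ), g z = 0 → k x = 0 → k z = 1 → B z = 0 ∧ ∀ w, k (B w) = 0 := by
    intro z k hz hk hkz
    exact (hp.zero_iff hkz).mp ⟨by simp [hz], fun w => by simp [hk]⟩
  have h0 := key z0 k0 hgz0 hk0x hk0z
  have h1 : ∀ z, g z = 0 → B z = 0 := by
    intro z hz
    by_cases hk : k0 z = 0
    · have := (key (z + z0) k0 (by simp [hz, hgz0]) hk0x (by simp [hk, hk0z])).1
      simpa [h0.1] using this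
    · have := (key ((k0 z)⁻¹ • z) k0 (by simp [hz]) hk0x (by simp [hk])).1
      simpa [hk] using this
  have h2 : ∀ k : X →L[ℂ] ℂ, k x = 0 → ∀ w, k (B w) = 0 := by
    intro k hkx w
    by_cases hk : k z0 = 0
    · have := (key z0 (k + k0) hgz0 (by simp [hkx, hk0x]) (by simp [hk, hk0z])).2 w
      simpa [h0.2] using this
    · have := (key z0 ((k z0)⁻¹ • k) hgz0 (by simp [hkx]) (by simp [hk])).2 w
      simpa [hk] using this
  obtain ⟨ν, hν⟩ := mem_span_singleton_of_dual (u := B y) (x := x) (fun k hk => h2 k hk y)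
  have hBz : B = ν • rk x g := by
    ext z
    have := h1 (z - g z • y) (by simp [hgy])
    rw [map_sub, map_smul, sub_eq_zero, hν] at this
    rw [this]; simp [smul_smul, mul_comm]
  have hN : rk x g ≠ 0 := by
    intro h
    have := congrArg (fun T : X →L[ℂ] X => T y) h
    simp [hgy, hx] at this
  have hν0 : ν ≠ 0 := by
    rintro rfl
    apply hp.ne_zero hN
    rw [hBz, zero_smul]
  obtain ⟨f1, hf1⟩ := exists_dual hx
  obtain ⟨f, hfx, hfy⟩ : ∃ f : X →L[ℂ] ℂ, f x = 1 ∧ f y = 0 :=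
    ⟨f1 - f1 y • g, by simp [hf1, hgx], by simp [hgy]⟩
  set M := (2⁻¹ : ℂ) • rk x g + (2:ℂ) • rk y f with hM
  have hMf : φ M = M := by
    apply H.trip; ext z; simp [hM, hfx, hgy, hfy, hgx]
  have h3 : Rel (rk x g) M := by
    apply Rel_of_eq (S := rk x f + rk y g)
    · ext z; simp [hM, hfx, hgy, hfy, hgx]; module
    · ext z; simp [hfx, hgy, hfy, hgx]
  rw [H.rel, hMf, ← hB, hBz, Rel_iff] at h3
  have h4 := congrArg f (h3 x)
  simp [hM, hfx, hgy, hfy, hgx] at h4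
  have : ν = 1 := by
    field_simp at h4
    first
      | exact h4
      | linear_combination h4
      | exact mul_left_cancel₀ hν0 (by linear_combination h4)
  rw [hBz, this, one_smul]

lemma FixHyp.rank1 (H : FixHyp φ) (x : X) (g : X →L[ℂ] ℂ) : φ (rk x g) = rk x g := by
  by_cases hx : x = 0
  · have : rk x g = 0 := by ext; simp [hx]
    rw [this]; exact (H.pair 0).zero rfl
  by_cases hg : g = 0
  · have : rk x g = 0 := by ext; simp [hg]
    rw [this]; exact (H.pair 0).zero rfl
  by_cases hgx : g x = 0
  · exact H.nil hx hg hgx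
  have : rk x g = g x • rk ((g x)⁻¹ • x) g := by
    ext z; simp only [rk_apply, _root_.smul_apply, smul_smul]; congr 1; field_simp
  rw [this]
  exact H.scalar _ hgx _ _ (by simp [hgx])

end JP


namespace JP

variable {X : Type*} [NormedAddCommGroup X] [NormedSpace ℂ X]
variable {φ : (X →L[ℂ] X) → (X →L[ℂ] X)}

/-- pairs not distinguished by operators fixed by `φ`. -/
def QP (φ : (X →L[ℂ] X) → (X →L[ℂ] X)) (A B : X →L[ℂ] X) : Prop :=
  ∀ C, φ C = C → (Rel A C ↔ Rel B C)

lemma FixHyp.qp (H : FixHyp φ) (A : X →L[ℂ] X) : QP φ A (φ A) := by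
  intro C hC
  rw [H.rel, hC]

lemma QP.symm {A B : X →L[ℂ] X} (h : QP φ A B) : QP φ B A := fun C hC => (h C hC).symm

lemma neg_rk (x : X) (f : X →L[ℂ] ℂ) : -rk x f = rk (-x) f := by ext; simp

lemma smul_rk (c : ℂ) (x : X) (f : X →L[ℂ] ℂ) : c • rk x f = rk (c • x) f := by
  ext; simp [smul_smul, mul_comm]

lemma Rel_smul_left (c : ℂ) (A C : X →L[ℂ] X) : Rel (c • A) C ↔ Rel A (c • C) := by
  have := Rel_smul_smul 1 c A C
  rw [one_smul, mul_one] at this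
  exact this.symm

lemma QP.pair {A B : X →L[ℂ] X} (h : QP φ A B) (H : FixHyp φ) (c : ℂ) : Pair (c • A) (c • B) := by
  intro x f _
  rw [neg_rk, Rel_smul_left, Rel_smul_left, Rel_smul_left, Rel_smul_left, smul_rk, smul_rk]
  exact ⟨h _ (H.rank1 _ _), h _ (H.rank1 _ _)⟩

lemma QP.EL {A B : X →L[ℂ] X} (h : QP φ A B) (H : FixHyp φ) {c : ℂ} (hc : c ≠ 0) {x : X}
    (hx : A x = c • x) : B x = c • x := by
  have := (h.pair H c⁻¹).EL (x := x) (by simp [hx, hc])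
  rw [_root_.smul_apply, inv_smul_eq_iff₀ hc] at this
  exact this

lemma QP.EL' {A B : X →L[ℂ] X} (h : QP φ A B) (H : FixHyp φ) {c : ℂ} (hc : c ≠ 0)
    {f : X →L[ℂ] ℂ} (hx : ∀ z, f (A z) = c * f z) : ∀ z, f (B z) = c * f z := by
  intro z
  have := (h.pair H c⁻¹).EL' (f := f) (by simp [hx, hc]) z
  simp only [_root_.smul_apply, map_smul, smul_eq_mul] at this
  field_simp at this
  linear_combination this

lemma QP.b {A B : X →L[ℂ] X} (h : QP φ A B) {C : X →L[ℂ] X} (h1 : φ C = C) (h2 : φ (-C) = -C)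
    (h3 : A * C + C * A = 0) : B * C + C * B = 0 := by
  rw [← Rel_pm_iff] at h3 ⊢
  exact ⟨(h _ h1).mp h3.1, (h _ h2).mp h3.2⟩

lemma QP.b1 {A B : X →L[ℂ] X} (h : QP φ A B) (H : FixHyp φ) {x : X} {f : X →L[ℂ] ℂ}
    (h3 : ∀ z, f z • A x + f (A z) • x = 0) : ∀ z, f z • B x + f (B z) • x = 0 := by
  have := h.b (C := rk x f) (H.rank1 _ _) (by rw [neg_rk, H.rank1]) (by
    ext z; simpa using h3 z)
  intro z
  have := congrArg (fun T : X →L[ℂ] X => T z) this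
  simpa using this

lemma QP.c {A B : X →L[ℂ] X} (h : QP φ A B) (H : FixHyp φ) {x : X} {f : X →L[ℂ] ℂ}
    (h0 : f x = 0) (h1 : f (A x) = 2) (h2 : f (A (A x)) = 0) : f (B x) = 2 ∧ f (B (B x)) = 0 := by
  have hR : Rel A (rk x f) := by
    rw [Rel_iff]; intro z
    simp only [rk_apply, map_add, map_smul, smul_eq_mul, smul_smul, h0, h1, h2]
    module
  rw [h _ (H.rank1 _ _), Rel_iff] at hR
  simp only [rk_apply, map_add, map_smul, smul_eq_mul, h0] at hR
  have hx0 : x ≠ 0 := by rintro rfl; simp at h1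
  have hf0 : f ≠ 0 := by rintro rfl; simp at h1
  obtain ⟨w, hw⟩ := exists_one_of_ne hf0
  set b := f (B x) with hb
  have hbb : (b * (b - 2)) • x = 0 := by
    have := hR x
    simp only [h0, zero_smul, zero_add, zero_mul, add_zero, ← hb, mul_zero] at this
    rw [sub_eq_zero.symm] at this
    rw [← this]; module
  have hbb := (smul_eq_zero.mp hbb).resolve_right hx0
  rcases mul_eq_zero.mp hbb with hb0 | hb2
  · exfalso
    have hR' : ∀ z, f z • B x + f (B z) • x = ((2⁻¹ : ℂ) * f (B (B x)) * f z) • x := by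
      intro z
      have := hR z
      rw [hb0] at this
      have e : f z • B x + f (B z) • x = (2⁻¹:ℂ) • ((2:ℂ) • (f z • B x + f (B z) • x)) := by module
      rw [e, ← this]
      module
    set κ := (2⁻¹ : ℂ) * f (B (B x)) with hκ
    have hBx : B x = (κ - f (B w)) • x := by
      have := hR' w
      rw [hw, one_smul, ← eq_sub_iff_add_eq] at this
      rw [this]; module
    by_cases hρ : κ - f (B w) = 0
    · rw [hρ, zero_smul] at hBx
      have hfB : ∀ z, f (B z) = κ * f z := by
        intro z
        have := hR' z
        rw [hBx, smul_zero, zero_add] at this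
        exact smul_left_injective ℂ hx0 this
      by_cases hk0 : κ = 0
      · have := h.symm.b1 H (x := x) (f := f) (by intro z; rw [hBx, hfB, hk0]; simp) x
        rw [h0, h1, zero_smul, zero_add] at this
        exact (smul_ne_zero two_ne_zero hx0) this
      · have := h.symm.EL' H hk0 hfB x
        rw [h1, h0] at this; simp at this
    · have := h.symm.EL H hρ hBx
      rw [this, map_smul, h0] at h1; simp at h1
  · have hb2 : b = 2 := sub_eq_zero.mp hb2
    refine ⟨hb2, ?_⟩
    have := hR w
    rw [hw, hb2] at this
    have e : f (B (B x)) • x = ((1 * 2) • B x + (f (B w) * 0) • B x + ((1 * f (B (B x))) • x + (f (B w) * 2) • x)) - ((2:ℂ) • ((1:ℂ) • B x + f (B w) • x)) := by module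
    have e2 : f (B (B x)) • x = 0 := by
      rw [e, sub_eq_zero, ← this]; module
    exact (smul_eq_zero.mp e2).resolve_right hx0

instance fd_span_pair (u v : X) : FiniteDimensional ℂ (Submodule.span ℂ ({u, v} : Set X)) :=
  FiniteDimensional.span_of_finite ℂ (by simp)

lemma mem_span_pair_of_dual {u x y : X} (h : ∀ k : X →L[ℂ] ℂ, k x = 0 → k y = 0 → k u = 0) :
    ∃ a b : ℂ, u = a • x + b • y := by
  by_contra hcon
  have : u ∉ Submodule.span ℂ {x, y} := by
    intro hm
    obtain ⟨a, b, hc⟩ := Submodule.mem_span_pair.mp hm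
    exact hcon ⟨a, b, hc.symm⟩
  obtain ⟨k, hk, hku⟩ := HBV _ this
  rw [h k (hk x (Submodule.subset_span (by simp))) (hk y (Submodule.subset_span (by simp)))] at hku
  exact zero_ne_one hku

lemma dual_of_notMem_pair {u x y : X} (h : ¬ ∃ a b : ℂ, u = a • x + b • y) :
    ∃ k : X →L[ℂ] ℂ, k x = 0 ∧ k y = 0 ∧ k u = 1 := by
  have : u ∉ Submodule.span ℂ {x, y} := by
    intro hm
    obtain ⟨a, b, hc⟩ := Submodule.mem_span_pair.mp hm
    exact h ⟨a, b, hc.symm⟩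
  obtain ⟨k, hk, hku⟩ := HBV _ this
  exact ⟨k, hk x (Submodule.subset_span (by simp)), hk y (Submodule.subset_span (by simp)), hku⟩

lemma QP.c' {A B : X →L[ℂ] X} (h : QP φ A B) (H : FixHyp φ) {z : X}
    (hz : ¬ ∃ a b : ℂ, A z = a • z + b • A (A z)) :
    (∃ a b : ℂ, A z - B z = a • z + b • A (A z)) ∧ (∃ a b : ℂ, B (B z) = a • z + b • A (A z)) := by
  obtain ⟨f0, h1, h2, h3⟩ := dual_of_notMem_pair hz
  have key : ∀ k : X →L[ℂ] ℂ, k z = 0 → k (A (A z)) = 0 → k (A z) ≠ 0 →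
      k (B z) = k (A z) ∧ k (B (B z)) = 0 := by
    intro k hk1 hk2 hk3
    have := h.c H (x := z) (f := (2 / k (A z)) • k) (by simp [hk1]) (by simp; field_simp)
      (by simp [hk2])
    simp only [_root_.smul_apply, smul_eq_mul, mul_eq_zero, div_eq_zero_iff, two_ne_zero, hk3,
      false_or] at this
    refine ⟨?_, this.2⟩
    have h4 := this.1
    field_simp at h4
    exact h4
  have key2 : ∀ k : X →L[ℂ] ℂ, k z = 0 → k (A (A z)) = 0 →
      k (B z) = k (A z) ∧ k (B (B z)) = 0 := by
    intro k hk1 hk2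
    by_cases hk3 : k (A z) = 0
    · have a1 := key f0 h1 h2 (by simp [h3])
      have a2 := key (k + f0) (by simp [hk1, h1]) (by simp [hk2, h2]) (by simp [hk3, h3])
      simp only [_root_.add_apply, a1.1, a1.2, add_left_inj, add_zero] at a2
      exact a2
    · exact key k hk1 hk2 hk3
  refine ⟨mem_span_pair_of_dual fun k hk1 hk2 => ?_, mem_span_pair_of_dual fun k hk1 hk2 => (key2 k hk1 hk2).2⟩
  rw [map_sub, (key2 k hk1 hk2).1, sub_self]

lemma QP.case1 {A B : X →L[ℂ] X} (h : QP φ A B) (H : FixHyp φ) {x : X}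
    (hx : LinearIndependent ℂ (fun i : Fin 5 => (A ^ (i : ℕ)) x)) : B x = A x := by
  rw [Fintype.linearIndependent_iff] at hx
  have hli : ∀ a b c d e : ℂ, a • x + b • A x + c • A (A x) + d • A (A (A x)) + e • A (A (A (A x))) = 0 →
      a = 0 ∧ b = 0 ∧ c = 0 ∧ d = 0 ∧ e = 0 := by
    intro a b c d e he
    have := hx ![a, b, c, d, e] (by
      simp only [Fin.sum_univ_five]
      simpa [pow_succ] using he)
    exact ⟨this 0, this 1, this 2, this 3, this 4⟩
  clear hx
  set v1 := A x with hv1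
  set v2 := A v1 with hv2
  set v3 := A v2 with hv3
  set v4 := A v3 with hv4
  obtain ⟨⟨α0, β0, e0⟩, ⟨p, q, e0'⟩⟩ := h.c' H (z := x) (by
    rintro ⟨a, b, hab⟩
    have := hli (-a) 1 (-b) 0 0 (by rw [← hv1, ← hv2] at hab; rw [hab]; module)
    exact one_ne_zero this.2.1)
  obtain ⟨⟨α1, β1, e1⟩, -⟩ := h.c' H (z := v1) (by
    rintro ⟨a, b, hab⟩
    have := hli 0 (-a) 1 (-b) 0 (by rw [← hv2, ← hv3] at hab; rw [hab]; module)
    exact one_ne_zero this.2.2.1)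
  obtain ⟨⟨α2, β2, e2⟩, -⟩ := h.c' H (z := v2) (by
    rintro ⟨a, b, hab⟩
    have := hli 0 0 (-a) 1 (-b) (by rw [← hv3, ← hv4] at hab; rw [hab]; module)
    exact one_ne_zero this.2.2.2.1)
  obtain ⟨⟨α, β, e3⟩, -⟩ := h.c' H (z := x + v1) (by
    rintro ⟨a, b, hab⟩
    simp only [map_add, ← hv1, ← hv2, ← hv3] at hab
    have := hli (-a) (1-a) (1-b) (-b) 0 (by
      rw [← sub_eq_zero] at hab; rw [← hab]; module)
    have h1 := this.1
    have h2 := this.2.1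
    exact one_ne_zero (by linear_combination h2 - h1))
  obtain ⟨⟨α', β', e4⟩, -⟩ := h.c' H (z := v1 + v2) (by
    rintro ⟨a, b, hab⟩
    simp only [map_add, ← hv4, ← hv2, ← hv3] at hab
    have := hli 0 (-a) (1-a) (1-b) (-b) (by
      rw [← sub_eq_zero] at hab; rw [← hab]; module)
    have h1 := this.2.1
    have h2 := this.2.2.1
    exact one_ne_zero (by linear_combination h2 - h1))
  simp only [map_add, ← hv1, ← hv2, ← hv3, ← hv4] at e0 e0' e1 e2 e3 e4
  have f3 := hli (α0 - α) (α1 - α) (β0 - β) (β1 - β) 0 (by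
    have : (v1 - B x) + (v2 - B v1) = α • (x + v1) + β • (v2 + v3) := by rw [← e3]; abel
    rw [e0, e1, ← sub_eq_zero] at this
    rw [← this]; module)
  have f4 := hli 0 (α1 - α') (α2 - α') (β1 - β') (β2 - β') (by
    have : (v2 - B v1) + (v3 - B v2) = α' • (v1 + v2) + β' • (v3 + v4) := by rw [← e4]; abel
    rw [e1, e2, ← sub_eq_zero] at this
    rw [← this]; module)
  obtain ⟨g1, g2, g3, g4, -⟩ := f3
  obtain ⟨-, k1, k2, k3, k4⟩ := f4
  have a1 : α1 = α0 := by linear_combination g2 - g1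
  have b1 : β1 = β0 := by linear_combination g4 - g3
  have a2 : α2 = α0 := by linear_combination g2 - g1 + k2 - k1
  have b2 : β2 = β0 := by linear_combination g4 - g3 + k4 - k3
  rw [a1, b1] at e1
  rw [a2, b2] at e2
  have B0 : B x = v1 - α0 • x - β0 • v2 := by
    rw [sub_sub, ← e0]; abel
  have B1 : B v1 = v2 - α0 • v1 - β0 • v3 := by
    rw [sub_sub, ← e1]; abel
  have B2 : B v2 = v3 - α0 • v2 - β0 • v4 := by
    rw [sub_sub, ← e2]; abel
  rw [B0, map_sub, map_sub, map_smul, map_smul, B0, B1, B2] at e0'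
  have := hli (α0 * α0 - p) (-2 * α0) (1 + 2 * α0 * β0 - q) (-2 * β0) (β0 * β0) (by
    rw [← sub_eq_zero] at e0'; rw [← e0']; module)
  have hα : α0 = 0 := by linear_combination this.2.1 / (-2)
  have hβ : β0 = 0 := by linear_combination this.2.2.2.1 / (-2)
  rw [B0, hα, hβ]; module

lemma QP.case1' {A B : X →L[ℂ] X} (h : QP φ A B) (H : FixHyp φ) {x : X}
    (hx : LinearIndependent ℂ (fun i : Fin 5 => (A ^ (i : ℕ)) x)) : B = A := by
  have hopen : IsOpen {y : X | LinearIndependent ℂ (fun i : Fin 5 => (A ^ (i : ℕ)) y)} := by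
    have hc : Continuous (fun y : X => (fun i : Fin 5 => (A ^ (i : ℕ)) y)) :=
      continuous_pi fun i => (A ^ (i : ℕ)).continuous
    exact isOpen_setOfPred_linearIndependent.preimage hc
  ext z
  have hcont : Filter.Tendsto (fun t : ℂ => x + t • z) (nhds 0) (nhds (x + (0:ℂ) • z)) := by
    apply Continuous.tendsto; fun_prop
  rw [zero_smul, add_zero] at hcont
  have h1 := hcont.eventually (hopen.mem_nhds hx)
  have h2 : ∀ᶠ t : ℂ in nhdsWithin 0 {0}ᶜ, LinearIndependent ℂ (fun i : Fin 5 => (A ^ (i : ℕ)) (x + t • z)) :=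
    h1.filter_mono nhdsWithin_le_nhds
  obtain ⟨t, ht, ht0⟩ := (h2.and self_mem_nhdsWithin).exists
  have e1 := h.case1 H ht
  have e2 := h.case1 H hx
  simp only [map_add, map_smul, e2, add_right_inj] at e1
  exact smul_right_injective X ht0 e1

end JP


namespace JP

open Polynomial

variable {X : Type*} [NormedAddCommGroup X] [NormedSpace ℂ X]
variable {φ : (X →L[ℂ] X) → (X →L[ℂ] X)}

lemma aeval_eig {A : X →L[ℂ] X} {μ : ℂ} {y : X} (h : A y = μ • y) (q : ℂ[X]) :
    aeval A q y = q.eval μ • y := by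
  induction q using Polynomial.induction_on' with
  | add p q hp hq => simp [hp, hq, add_smul]
  | monomial n a =>
    have hn : (A ^ n) y = μ ^ n • y := by
      induction n with
      | zero => simp
      | succ n ih => rw [pow_succ, _root_.mul_apply_eq_comp, h, map_smul, ih, smul_smul, pow_succ, mul_comm]
    rw [aeval_monomial, eval_monomial]
    simp [Algebra.algebraMap_eq_smul_one, hn, smul_smul]

lemma aeval_eig' {A : X →L[ℂ] X} {μ : ℂ} {h : X →L[ℂ] ℂ} (hh : ∀ z, h (A z) = μ * h z) (q : ℂ[X]) :
    ∀ z, h (aeval A q z) = q.eval μ * h z := by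
  induction q using Polynomial.induction_on' with
  | add p q hp hq => intro z; simp [hp, hq, add_mul]
  | monomial n a =>
    intro z
    have hn : ∀ z, h ((A ^ n) z) = μ ^ n * h z := by
      induction n with
      | zero => simp
      | succ n ih => intro z; rw [pow_succ, _root_.mul_apply_eq_comp, ih, hh, pow_succ, mul_assoc]
    rw [aeval_monomial, eval_monomial, Algebra.algebraMap_eq_smul_one, smul_mul_assoc, one_mul,
      _root_.smul_apply, map_smul, hn, smul_eq_mul, mul_assoc]

lemma aeval_X_sub (A : X →L[ℂ] X) (r : ℂ) (y : X) : aeval A (Polynomial.X - C r) y = A y - r • y := by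
  simp [Algebra.algebraMap_eq_smul_one]

lemma kap {A : X →L[ℂ] X} (S : Finset ℂ) (hS : ∀ (r : ℂ) (y : X), A y = r • y → y ≠ 0 → r ∈ S) (n : ℕ) :
    ∀ (q : ℂ[X]) (x : X), q ≠ 0 → q.natDegree = n → aeval A q x = 0 →
      aeval A ((∏ s ∈ S, (Polynomial.X - C s)) ^ n) x = 0 := by
  induction n with
  | zero =>
    intro q x hq hn hx
    rw [natDegree_eq_zero] at hn
    obtain ⟨c, rfl⟩ := hn
    have hc : c ≠ 0 := by rintro rfl; simp at hq
    simp [Algebra.algebraMap_eq_smul_one, hc] at hx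
    simp [hx]
  | succ n ih =>
    intro q x hq hn hx
    obtain ⟨r, hr⟩ := IsAlgClosed.exists_root q (by
      rw [degree_eq_natDegree hq, hn]; exact_mod_cast Nat.succ_ne_zero n)
    obtain ⟨q', rfl⟩ := dvd_iff_isRoot.mpr hr
    have hq' : q' ≠ 0 := right_ne_zero_of_mul hq
    have hn' : q'.natDegree = n := by
      rw [natDegree_mul (X_sub_C_ne_zero r) hq', natDegree_X_sub_C] at hn; omega
    by_cases hrS : r ∈ S
    · obtain ⟨T, hT⟩ : (Polynomial.X - C r) ∣ ∏ s ∈ S, (Polynomial.X - C s) := Finset.dvd_prod_of_mem _ hrS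
      have h1 := ih q' (aeval A (Polynomial.X - C r) x) hq' hn' (by
        rw [← _root_.mul_apply_eq_comp, ← map_mul, mul_comm]; exact hx)
      rw [pow_succ]
      nth_rewrite 2 [hT]
      have : (∏ s ∈ S, (Polynomial.X - C s)) ^ n * ((Polynomial.X - C r) * T) =
        T * ((∏ s ∈ S, (Polynomial.X - C s)) ^ n * (Polynomial.X - C r)) := by ring
      rw [this, map_mul, map_mul, _root_.mul_apply_eq_comp, _root_.mul_apply_eq_comp, h1, map_zero]
    · have h1 : aeval A q' x = 0 := by
        by_contra hne
        apply hrS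
        apply hS r _ _ hne
        rw [map_mul, _root_.mul_apply_eq_comp, aeval_X_sub, sub_eq_zero] at hx
        exact hx
      rw [pow_succ, mul_comm, map_mul, _root_.mul_apply_eq_comp, ih q' x hq' hn' h1, map_zero]

lemma kap_poly {A : X →L[ℂ] X} {x : X}
    (h : ¬ LinearIndependent ℂ (fun i : Fin 5 => (A ^ (i : ℕ)) x)) :
    ∃ q : ℂ[X], q ≠ 0 ∧ q.natDegree < 5 ∧ aeval A q x = 0 := by
  rw [Fintype.not_linearIndependent_iff] at h
  obtain ⟨g, hg, i, hi⟩ := h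
  refine ⟨∑ i : Fin 5, monomial (i : ℕ) (g i), ?_, ?_, ?_⟩
  · intro h0
    apply hi
    have := congrArg (fun p => p.coeff (i : ℕ)) h0
    simp only [finset_sum_coeff, coeff_monomial, coeff_zero] at this
    rw [Finset.sum_eq_single i] at this
    · simpa using this
    · intro j _ hj
      rw [if_neg]; exact fun h => hj (Fin.ext h)
    · simp
  · apply lt_of_le_of_lt (b := 4) _ (by norm_num)
    apply natDegree_sum_le_of_forall_le
    intro j _
    exact (natDegree_monomial_le _).trans (by omega)
  · rw [map_sum, ContinuousLinearMap.sum_apply, ← hg]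
    refine Finset.sum_congr rfl fun j _ => ?_
    rw [aeval_monomial]
    simp [Algebra.algebraMap_eq_smul_one]

lemma kaplansky {A : X →L[ℂ] X}
    (h : ∀ x, ¬ LinearIndependent ℂ (fun i : Fin 5 => (A ^ (i : ℕ)) x)) : IsIntegral ℂ A := by
  have hfin : {r : ℂ | ∃ y : X, y ≠ 0 ∧ A y = r • y}.Finite := by
    by_contra hinf
    have hinf : {r : ℂ | ∃ y : X, y ≠ 0 ∧ A y = r • y}.Infinite := hinf
    have := hinf.to_subtype
    let em := Infinite.natEmbedding {r : ℂ | ∃ y : X, y ≠ 0 ∧ A y = r • y}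
    let μ : Fin 5 → ℂ := fun i => (em i).1
    have hμ : Function.Injective μ := by
      intro i j hij
      have := em.injective (Subtype.ext hij)
      exact Fin.ext this
    choose e he0 he using fun i : Fin 5 => (em i).2
    have hli : LinearIndependent ℂ e := by
      apply Module.End.eigenvectors_linearIndependent' (A : X →ₗ[ℂ] X) μ hμ e
      intro i
      rw [Module.End.hasEigenvector_iff, Module.End.mem_eigenspace_iff]
      exact ⟨he i, he0 i⟩
    obtain ⟨q, hq0, hq, hqx⟩ := kap_poly (h (∑ i, e i))
    rw [map_sum] at hqx
    have h2 : ∑ i, (q.eval (μ i)) • e i = 0 := by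
      rw [← hqx]; exact Finset.sum_congr rfl fun i _ => (aeval_eig (he i) q).symm
    have h3 := Fintype.linearIndependent_iff.mp hli _ h2
    exact hq0 (eq_zero_of_natDegree_lt_card_of_eval_eq_zero q hμ h3 (by simpa using hq))
  have hS : ∀ (r : ℂ) (y : X), A y = r • y → y ≠ 0 → r ∈ hfin.toFinset := by
    intro r y h1 h2
    simp only [Set.Finite.mem_toFinset]
    exact ⟨y, h2, h1⟩
  rw [← isAlgebraic_iff_isIntegral]
  refine ⟨(∏ s ∈ hfin.toFinset, (Polynomial.X - C s)) ^ 4, ?_, ?_⟩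
  · apply pow_ne_zero
    rw [Finset.prod_ne_zero_iff]
    intro a _
    exact X_sub_C_ne_zero a
  · ext x
    obtain ⟨q, hq0, hq, hqx⟩ := kap_poly (h x)
    have h1 := kap _ hS _ q x hq0 rfl hqx
    have h2 : 4 = (4 - q.natDegree) + q.natDegree := by omega
    rw [h2, pow_add, map_mul, _root_.mul_apply_eq_comp, h1, map_zero]
    rfl

lemma root_both {A : X →L[ℂ] X} (hA : IsIntegral ℂ A) {μ : ℂ} (hμ : (minpoly ℂ A).eval μ = 0) :
    (∃ y : X, y ≠ 0 ∧ A y = μ • y) ∧ (∃ h : X →L[ℂ] ℂ, h ≠ 0 ∧ ∀ z, h (A z) = μ * h z) := by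
  obtain ⟨q, hq⟩ := dvd_iff_isRoot.mpr (show IsRoot _ _ from hμ)
  have hm0 : minpoly ℂ A ≠ 0 := minpoly.ne_zero hA
  have hq0 : q ≠ 0 := by rintro rfl; rw [mul_zero] at hq; exact hm0 hq
  have hqA : aeval A q ≠ 0 := by
    intro h0
    have := natDegree_le_natDegree (minpoly.degree_le_of_ne_zero ℂ A hq0 h0)
    rw [hq, natDegree_mul (X_sub_C_ne_zero _) hq0, natDegree_X_sub_C] at this
    omega
  obtain ⟨w, hw⟩ : ∃ w, aeval A q w ≠ 0 := by
    by_contra hcon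
    push Not at hcon
    exact hqA (ContinuousLinearMap.ext hcon)
  have hm : ∀ z, aeval A ((Polynomial.X - C μ) * q) z = 0 := by
    intro z; rw [← hq, minpoly.aeval]; rfl
  constructor
  · refine ⟨_, hw, ?_⟩
    have := hm w
    rw [map_mul, _root_.mul_apply_eq_comp, aeval_X_sub, sub_eq_zero] at this
    exact this
  · obtain ⟨ψ, hψ⟩ := exists_dual hw
    refine ⟨ψ.comp (aeval A q), ?_, fun z => ?_⟩
    · intro h0
      have := congrArg (fun T : X →L[ℂ] ℂ => T w) h0
      simp [hψ] at this
    · have := hm z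
      rw [mul_comm, map_mul, _root_.mul_apply_eq_comp, aeval_X_sub, map_sub, sub_eq_zero] at this
      simp [this]

lemma minpoly_root {A : X →L[ℂ] X} {μ : ℂ} {y : X} (hy : y ≠ 0) (h : A y = μ • y) :
    (minpoly ℂ A).eval μ = 0 := by
  have := aeval_eig h (minpoly ℂ A)
  rw [minpoly.aeval] at this
  exact (smul_eq_zero.mp this.symm).resolve_right hy

lemma minpoly_root' {A : X →L[ℂ] X} {μ : ℂ} {f : X →L[ℂ] ℂ} (hf : f ≠ 0)
    (h : ∀ z, f (A z) = μ * f z) : (minpoly ℂ A).eval μ = 0 := by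
  obtain ⟨w, hw⟩ := exists_one_of_ne hf
  have := aeval_eig' h (minpoly ℂ A) w
  rw [minpoly.aeval, hw] at this
  simpa using this.symm

lemma ROOT (A D : X →L[ℂ] X) (hD : D ≠ 0) (n : ℕ) : ∀ p : ℂ[X], p ≠ 0 → p.natDegree = n →
    D * aeval A p = 0 → ∃ (μ : ℂ) (r : ℂ[X]), p.eval μ = 0 ∧ D * aeval A r ≠ 0 ∧
      ∀ x, D (aeval A r (A x)) = μ • D (aeval A r x) := by
  induction n with
  | zero =>
    intro p hp hn hx
    rw [natDegree_eq_zero] at hn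
    obtain ⟨c, rfl⟩ := hn
    have hc : c ≠ 0 := by rintro rfl; simp at hp
    simp [Algebra.algebraMap_eq_smul_one, hc] at hx
    exact absurd hx hD
  | succ n ih =>
    intro q hq hn hx
    obtain ⟨r, hr⟩ := IsAlgClosed.exists_root q (by
      rw [degree_eq_natDegree hq, hn]; exact_mod_cast Nat.succ_ne_zero n)
    obtain ⟨q', rfl⟩ := dvd_iff_isRoot.mpr hr
    have hq' : q' ≠ 0 := right_ne_zero_of_mul hq
    have hn' : q'.natDegree = n := by
      rw [natDegree_mul (X_sub_C_ne_zero r) hq', natDegree_X_sub_C] at hn; omega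
    by_cases h0 : D * aeval A q' = 0
    · obtain ⟨μ, r1, h1, h2⟩ := ih q' hq' hn' h0
      exact ⟨μ, r1, by simp [h1], h2⟩
    · refine ⟨r, q', by simp, h0, fun x => ?_⟩
      have := congrArg (fun T : X →L[ℂ] X => T x) hx
      rw [mul_comm, map_mul] at this
      simp only [_root_.mul_apply_eq_comp, aeval_X_sub, map_sub, map_smul] at this
      rw [← sub_eq_zero]; simpa using this

lemma FixHyp.FJ0 (H : FixHyp φ) {x y : X} {f h : X →L[ℂ] ℂ} {a b : ℂ} (ha : a ≠ 0) (hb : b ≠ 0)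
    (hy : h y = 0) (hx : h x = a) (hf : f y = b) : ∃ q : ℂ,
      φ (rk x h + rk y f) y = b • y ∧ φ (rk x h + rk y f) x = a • x + q • y ∧
      (∀ q', φ (rk x h + rk y f) x = a • x + q' • y → q' = q) ∧
      (q = f x → φ (rk x h + rk y f) = rk x h + rk y f) := by
  set M := rk x h + rk y f with hM
  set h' := a⁻¹ • h with hh'
  set f' := b⁻¹ • (f - (f x / a) • h) with hf'
  have e1 : h' x = 1 := by simp [hh', hx, ha]
  have e2 : h' y = 0 := by simp [hh', hy]
  have e3 : f' x = 0 := by simp [hf', hx, ha]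
  have e4 : f' y = 1 := by simp [hf', hy, hf, hb]
  have ehz : ∀ z, h z = a * h' z := by intro z; simp [hh']; field_simp
  have efz : ∀ z, f z = f x * h' z + b * f' z := by
    intro z; simp [hh', hf']; field_simp; ring
  set E := rk x h' + rk y f' with hE
  have hp := H.qp M
  obtain ⟨c1, c2⟩ := (H.pair M).corner (E := E) (by ext z; simp [hE, e1, e2, e3, e4])
    (by ext z; simp [hE, hM, e1, e2, e3, e4])
    (by ext z; simp [hE, hM, e1, e2, e3, e4, hx, hy, hf, ehz z, efz z]; module)
  have hBy : φ M y = b • y := by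
    apply hp.EL H hb; simp [hM, hy, hf]
  have hhB : h (φ M x) = a * h x := by
    apply hp.EL' H ha; intro z; simp [hM, hy, hx]; ring
  have hBx : φ M x = a • x + f' (φ M x) • y := by
    have := congrArg (fun T : X →L[ℂ] X => T x) c1
    simp only [_root_.mul_apply_eq_comp] at this
    have e5 : h' (φ M x) = a := by
      rw [hh', _root_.smul_apply, hhB, hx, smul_eq_mul]; field_simp
    conv_lhs => rw [← this]
    simp [hE, e5]
  refine ⟨f' (φ M x), hBy, hBx, ?_, ?_⟩
  · intro q' hq'
    rw [hq']; simp [e3, e4]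
  · intro hq
    ext z
    have := congrArg (fun T : X →L[ℂ] X => T z) c2
    simp only [_root_.mul_apply_eq_comp] at this
    rw [← this]
    simp only [hE, hM, _root_.add_apply, rk_apply, map_add, map_smul]
    rw [← hM, hBx, hBy, hq, efz z, ehz z]
    module

lemma FixHyp.FJ1 (H : FixHyp φ) {x y : X} {f h : X →L[ℂ] ℂ} {a b : ℂ} (ha : a ≠ 0) (hb : b ≠ 0)
    (hy : h y = 0) (hx : h x = a) (hf : f y = b) {θ : ℂ} (hθ : θ * (a - b) = f x) :
    φ (rk x h + rk y f) = rk x h + rk y f := by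
  obtain ⟨q, h1, h2, h3, h4⟩ := H.FJ0 ha hb hy hx hf
  apply h4
  symm
  apply h3
  have := (H.qp (rk x h + rk y f)).EL H (c := a) ha (x := x + θ • y) (by
    simp [hx, hy, hf, ← hθ]; module)
  rw [map_add, map_smul, h1] at this
  rw [eq_sub_iff_add_eq.mpr this, ← hθ]
  module

lemma FixHyp.FJ (H : FixHyp φ) {x y : X} {f h : X →L[ℂ] ℂ} (hx : h x ≠ 0) (hf : f y ≠ 0)
    (hy : h y = 0) : φ (rk x h + rk y f) = rk x h + rk y f := by
  by_cases hab : h x = f y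
  swap
  · exact H.FJ1 hx hf hy rfl rfl (θ := f x / (h x - f y)) (by
      have : h x - f y ≠ 0 := sub_ne_zero.mpr hab
      field_simp)
  by_cases hq0 : f x = 0
  · exact H.FJ1 hx hf hy rfl rfl (θ := 0) (by simp [hq0])
  obtain ⟨q, h1, h2, h3, h4⟩ := H.FJ0 hx hf hy rfl rfl
  apply h4
  set M := rk x h + rk y f with hM
  set a := h x with ha
  set h' := a⁻¹ • h with hh'
  set f' := a⁻¹ • (f - (f x / a) • h) with hf'
  have e1 : h' x = 1 := by simp [hh', ← ha, hx]
  have e2 : h' y = 0 := by simp [hh', hy]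
  have e3 : f' x = 0 := by simp [hf', ← ha, hx]
  have e4 : f' y = 1 := by simp [hf', hy, ← hab, hx]
  have ehz : ∀ z, h z = a * h' z := by intro z; simp [hh']; field_simp
  have efz : ∀ z, f z = f x * h' z + a * f' z := by
    intro z; simp [hh', hf']; field_simp; ring
  rw [← hab] at h1
  set q0 := f x with hq0'
  set C' := rk y (-(2 * a)⁻¹ • f') + rk x ((2 * a)⁻¹ • h' + q0⁻¹ • f') with hC'
  have hfix : φ C' = C' := by
    apply H.FJ1 (a := -(2 * a)⁻¹) (b := (2 * a)⁻¹) (by simp [hx]) (by simp [hx])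
      (by simp [e3]) (by simp [e4]) (by simp [e1, e3]) (θ := -a / q0)
    simp [e2, e4]
    field_simp
    norm_num
  have hC'x : C' x = (2 * a)⁻¹ • x := by simp [hC', e1, e2, e3, e4]
  have hC'y : C' y = -(2 * a)⁻¹ • y + q0⁻¹ • x := by simp [hC', e1, e2, e3, e4]
  have hR : Rel M C' := by
    apply Rel_of_eq (S := rk x (h' + (a / q0) • f'))
    · ext z
      simp only [_root_.add_apply, _root_.mul_apply_eq_comp, _root_.smul_apply, hM, hC', rk_apply, map_add, map_smul,
        smul_eq_mul, e1, e2, e3, e4, hy, ← ha, ehz z, efz z, ← hab, ← hq0']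
      match_scalars
      · field_simp; ring
      · field_simp; ring
    · ext z; simp [e1, e3]
  rw [H.rel, hfix, Rel_iff] at hR
  have hy2 := hR y
  have hxE : φ M (C' x) + C' (φ M x) = (1 + q / q0) • x := by
    rw [hC'x, map_smul, h2, map_add, map_smul, map_smul, hC'x, hC'y]
    match_scalars
    · field_simp; ring
    · field_simp; ring
  have hyE : φ M (C' y) + C' (φ M y) = (q / q0 - 1) • y + (2 * (a / q0)) • x := by
    rw [hC'y, map_add, map_smul, map_smul, h1, h2, map_smul, hC'y]
    match_scalars
    · field_simp; ring
    · field_simp; ring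
  have hsm : ∀ u v : ℂ, φ M (C' (u • y + v • x)) + C' (φ M (u • y + v • x)) =
      u • (φ M (C' y) + C' (φ M y)) + v • (φ M (C' x) + C' (φ M x)) := by
    intro u v; simp only [map_add, map_smul]; module
  rw [hyE, hsm, hyE, hxE] at hy2
  have := congrArg h' hy2
  simp [e1, e2] at this
  field_simp at this
  have h5 : q + q = q0 + q0 := by linear_combination this
  linear_combination h5 / 2

lemma QP.PL {A B : X →L[ℂ] X} (hQ : QP φ A B) (H : FixHyp φ) {l m : ℂ} (hl : l ≠ 0) (hm : m ≠ 0)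
    (hlm : l + m ≠ 0) {y : X} {h : X →L[ℂ] ℂ} (hy : A y = l • y) (hh : ∀ z, h (A z) = m * h z)
    (hy0 : y ≠ 0) (hh0 : h ≠ 0) (hhy : h y = 0) :
    A * A + (l + m) • A = B * B + (l + m) • B := by
  have key : ∀ (G : X →L[ℂ] X), G y = l • y → (∀ z, h (G z) = m * h z) → ∀ (x : X) (f : X →L[ℂ] ℂ),
      h x = m⁻¹ → f y = l⁻¹ → (Rel G (rk x h + rk y f) ↔
        f (G (G x) + (l + m) • G x + (l * m) • x) = 0) := by
    intro G hG hhG x f hx hf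
    rw [Rel_iff]
    simp only [_root_.add_apply, rk_apply, map_add, map_smul, smul_eq_mul, hG, hhG, hx, hf, hhy, smul_add]
    constructor
    · intro h1
      obtain ⟨w, hw⟩ := exists_one_of_ne hh0
      have h2 := h1 w
      rw [hw] at h2
      have h3 : (f (G (G x)) + (l + m) * f (G x) + l * m * f x) • y = 0 := by
        rw [← sub_eq_zero] at h2
        rw [← h2]
        match_scalars <;> field_simp <;> ring
      exact (smul_eq_zero.mp h3).resolve_right hy0
    · intro h1 z
      rw [← sub_eq_zero]
      have : h z • (f (G (G x)) + (l + m) * f (G x) + l * m * f x) • y = 0 := by rw [h1]; simp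
      rw [← this]
      match_scalars <;> field_simp <;> ring
  have hBy : B y = l • y := hQ.EL H hl hy
  have hhB : ∀ z, h (B z) = m * h z := hQ.EL' H hm hh
  obtain ⟨w, hw⟩ := exists_one_of_ne hh0
  have hl' : l⁻¹ ≠ 0 := inv_ne_zero hl
  have hm' : m⁻¹ ≠ 0 := inv_ne_zero hm
  have main : ∀ x, h x = 1 → (A * A + (l + m) • A) x = (B * B + (l + m) • B) x := by
    intro x0 hx0
    set x := m⁻¹ • x0 with hx
    have hhx : h x = m⁻¹ := by simp [hx, hx0]
    have h1 : A (A x) + (l + m) • A x + (l * m) • x = B (B x) + (l + m) • B x + (l * m) • x := by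
      refine span1 hy0 fun f0 hf0 => ?_
      obtain ⟨f, hf⟩ : ∃ f : X →L[ℂ] ℂ, f = l⁻¹ • f0 := ⟨_, rfl⟩
      have hfy : f y = l⁻¹ := by simp [hf, hf0]
      have hhA' : h (A (A x) + (l + m) • A x + (l * m) • x) = 2 * (l + m) := by
        simp [hh, hhx]; field_simp; ring
      have hhB' : h (B (B x) + (l + m) • B x + (l * m) • x) = 2 * (l + m) := by
        simp [hhB, hhx]; field_simp; ring
      set κ := - f (A (A x) + (l + m) • A x + (l * m) • x) / (2 * (l + m)) with hκ
      have hfk : (f + κ • h) y = l⁻¹ := by simp [hfy, hhy]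
      have a1 := key A hy hh x (f + κ • h) hhx hfk
      have a2 := key B hBy hhB x (f + κ • h) hhx hfk
      have hfix : φ (rk x h + rk y (f + κ • h)) = rk x h + rk y (f + κ • h) :=
        H.FJ (by rw [hhx]; exact hm') (by rw [hfk]; exact hl') hhy
      rw [hQ _ hfix, a2] at a1
      rw [_root_.add_apply, _root_.add_apply, _root_.smul_apply, _root_.smul_apply, hhA', hhB'] at a1
      have a3 := a1.mpr (by rw [hκ, smul_eq_mul]; field_simp; ring)
      have a4 : f (A (A x) + (l + m) • A x + (l * m) • x) = f (B (B x) + (l + m) • B x + (l * m) • x) := by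
        have : κ • (2 * (l + m)) = - f (A (A x) + (l + m) • A x + (l * m) • x) := by
          rw [hκ, smul_eq_mul]; field_simp
        rw [this] at a3
        linear_combination -a3
      rw [hf, _root_.smul_apply, _root_.smul_apply] at a4
      exact mul_left_cancel₀ hl' a4
    have h2 := add_right_cancel h1
    have h3 : m • x = x0 := by rw [hx]; simp [hm]
    have h4 := congrArg (fun v => m • v) h2
    simp only [smul_add] at h4
    rw [smul_comm m (l + m), smul_comm m (l + m)] at h4
    simp only [← map_smul, h3] at h4
    simpa using h4
  exact span1' hw main

lemma two_eqs {A B : X →L[ℂ] X} {s t : ℂ} (hst : s ≠ t) (h1 : A * A + s • A = B * B + s • B)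
    (h2 : A * A + t • A = B * B + t • B) : A = B := by
  have : (s - t) • (A - B) = 0 := by
    have e : (s - t) • (A - B) = ((A * A + s • A) - (B * B + s • B)) - ((A * A + t • A) - (B * B + t • B)) := by
      module
    rw [e, h1, h2]; simp
  exact sub_eq_zero.mp ((smul_eq_zero.mp this).resolve_left (sub_ne_zero.mpr hst))

lemma QP.GL {A B : X →L[ℂ] X} (hQ : QP φ A B) (H : FixHyp φ) (hA : IsIntegral ℂ A)
    {l : ℂ} (hl : l ≠ 0) {y : X} {h : X →L[ℂ] ℂ} (hy : A y = l • y) (hh : ∀ z, h (A z) = l * h z)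
    (hy0 : y ≠ 0) (hh0 : h ≠ 0) (hhy : h y = 0) : A = B := by
  have hll : l + l ≠ 0 := by rw [← two_mul]; exact mul_ne_zero two_ne_zero hl
  have E1 := hQ.PL H hl hl hll hy hh hy0 hh0 hhy
  by_contra hne
  have hBy : B y = l • y := hQ.EL H hl hy
  have hhB : ∀ z, h (B z) = l * h z := hQ.EL' H hl hh
  set D := A - B with hD
  have hD0 : D ≠ 0 := sub_ne_zero.mpr hne
  obtain ⟨μ, r, -, hr0, hr⟩ := ROOT A D hD0 _ (minpoly ℂ A) (minpoly.ne_zero hA) rfl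
    (by rw [minpoly.aeval, mul_zero])
  have hBD : ∀ x, B (D x) = - D (A x) - (2 * l) • D x := by
    intro x
    have := congrArg (fun T : X →L[ℂ] X => T x) E1
    simp only [_root_.add_apply, _root_.smul_apply, _root_.mul_apply_eq_comp] at this
    simp only [hD, _root_.sub_apply, map_sub]
    have e : B (A x) - B (B x) = B (A x) - (B (B x) + (l + l) • B x) + (l + l) • B x := by abel
    rw [e, ← this]; module
  have hcomm : ∀ x, A (aeval A r x) = aeval A r (A x) := by
    intro x
    have h1 : A * aeval A r = aeval A r * A := by
      have h2 : aeval A (Polynomial.X * r) = aeval A (r * Polynomial.X) := by rw [mul_comm]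
      simpa using h2
    exact congrArg (fun T : X →L[ℂ] X => T x) h1
  have hBz : ∀ x, B (D (aeval A r x)) = (-μ - 2 * l) • D (aeval A r x) := by
    intro x
    rw [hBD, hcomm, hr]; module
  obtain ⟨x, hx⟩ : ∃ x, D (aeval A r x) ≠ 0 := by
    by_contra hcon
    push Not at hcon
    exact hr0 (ContinuousLinearMap.ext hcon)
  set z := D (aeval A r x) with hz
  have hBz' : B z = (-μ - 2 * l) • z := hBz x
  set ν := -μ - 2 * l with hν
  have hhz : h z = 0 := by
    rw [hz, hD, _root_.sub_apply, map_sub, hh, hhB, sub_self]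
  obtain ⟨ψ, hψ⟩ := exists_dual hx
  set h' : X →L[ℂ] ℂ := ψ.comp (D * aeval A r) with hh'
  have hh'0 : h' ≠ 0 := by
    intro h0
    have := congrArg (fun T : X →L[ℂ] ℂ => T x) h0
    simp [hh', ← hz, hψ] at this
  have hh'A : ∀ w, h' (A w) = μ * h' w := by
    intro w
    simp [hh', hr]
  have hh'y : h' y = 0 := by
    simp only [hh', ContinuousLinearMap.comp_apply, _root_.mul_apply_eq_comp]
    rw [aeval_eig hy, map_smul, hD, _root_.sub_apply, hy, hBy, sub_self, smul_zero, map_zero]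
  by_cases c1 : ν = l
  · have hμ : μ = -3 * l := by linear_combination -c1 + hν
    have E2 := hQ.PL H hl (m := μ) (by rw [hμ]; simp [hl]) (by
      rw [hμ]; intro h0; apply hl; linear_combination -h0 / 2) hy hh'A hy0 hh'0 hh'y
    refine hne (two_eqs ?_ E1 E2)
    rw [hμ]; intro h0; apply hl; linear_combination h0 / 4
  by_cases c2 : ν = 0
  · have hμ : μ = -2 * l := by linear_combination -c2 + hν
    have E2 := hQ.PL H hl (m := μ) (by rw [hμ]; simp [hl]) (by
      rw [hμ]; intro h0; apply hl; linear_combination -h0) hy hh'A hy0 hh'0 hh'y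
    refine hne (two_eqs ?_ E1 E2)
    rw [hμ]; intro h0; apply hl; linear_combination h0 / 3
  have hAz : A z = ν • z := hQ.symm.EL H c2 hBz'
  by_cases c3 : ν = -l
  · have hμ : μ = - l := by linear_combination -c3 + hν
    have hh'z : h' z = 0 := by
      simp only [hh', ContinuousLinearMap.comp_apply, _root_.mul_apply_eq_comp]
      rw [aeval_eig hAz, map_smul, hD, _root_.sub_apply, hAz, hBz', sub_self, smul_zero, map_zero]
    have E2 := hQ.PL H c2 (m := μ) (by rw [hμ]; simp [hl]) (by
      rw [hμ, c3]; intro h0; apply hl; linear_combination -h0 / 2) hAz hh'A hx hh'0 hh'z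
    refine hne (two_eqs ?_ E1 E2)
    rw [hμ, c3]; intro h0; apply hl; linear_combination h0 / 4
  · have E2 := hQ.PL H c2 hl (by
      intro h0; apply c3; linear_combination h0) hAz hh hx hh0 hhz
    refine hne (two_eqs ?_ E1 E2)
    intro h0; apply c1; linear_combination -h0

end JP


namespace JP

open Polynomial

variable {X : Type*} [NormedAddCommGroup X] [NormedSpace ℂ X]
variable {φ : (X →L[ℂ] X) → (X →L[ℂ] X)}

lemma fd_ker_aeval {A : X →L[ℂ] X}
    (h : ∀ r : ℂ, (LinearMap.ker ((aeval A (Polynomial.X - C r) : X →L[ℂ] X) : X →ₗ[ℂ] X)).FG) (n : ℕ) :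
    ∀ p : ℂ[X], p ≠ 0 → p.natDegree = n →
      (LinearMap.ker ((aeval A p : X →L[ℂ] X) : X →ₗ[ℂ] X)).FG := by
  induction n with
  | zero =>
    intro p hp hn
    rw [natDegree_eq_zero] at hn
    obtain ⟨c, rfl⟩ := hn
    have hc : c ≠ 0 := by rintro rfl; simp at hp
    have : LinearMap.ker ((aeval A (C c) : X →L[ℂ] X) : X →ₗ[ℂ] X) = ⊥ := by
      rw [LinearMap.ker_eq_bot']
      intro m hm
      simpa [Algebra.algebraMap_eq_smul_one, hc] using hm
    rw [this]; exact Submodule.fg_bot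
  | succ n ih =>
    intro q hq hn
    obtain ⟨r, hr⟩ := IsAlgClosed.exists_root q (by
      rw [degree_eq_natDegree hq, hn]; exact_mod_cast Nat.succ_ne_zero n)
    obtain ⟨q', rfl⟩ := dvd_iff_isRoot.mpr hr
    have hq' : q' ≠ 0 := right_ne_zero_of_mul hq
    have hn' : q'.natDegree = n := by
      rw [natDegree_mul (X_sub_C_ne_zero r) hq', natDegree_X_sub_C] at hn; omega
    have sub : ∀ {s t : Submodule ℂ X}, t.FG → s ≤ t → s.FG := by
      intro s t ht hst
      have : FiniteDimensional ℂ t := Module.Finite.iff_fg.mpr ht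
      have := Submodule.finiteDimensional_of_le hst
      exact Module.Finite.iff_fg.mp this
    apply Submodule.fg_of_fg_map_of_fg_inf_ker ((aeval A q' : X →L[ℂ] X) : X →ₗ[ℂ] X)
    · apply sub (h r)
      rintro _ ⟨x, hx, rfl⟩
      have hx : aeval A ((Polynomial.X - C r) * q') x = 0 := hx
      rw [map_mul, _root_.mul_apply_eq_comp] at hx
      exact hx
    · exact sub (ih q' hq' hn') inf_le_right

lemma nil_indep {A : X →L[ℂ] X} {x : X} {k : ℕ} (h1 : (A ^ (k + 1)) x = 0) (h2 : (A ^ k) x ≠ 0)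
    (c : ℕ → ℂ) (hc : ∑ i ∈ Finset.range (k + 1), c i • (A ^ i) x = 0) : ∀ j, j ≤ k → c j = 0 := by
  have hbig : ∀ i, k + 1 ≤ i → (A ^ i) x = 0 := by
    intro i hi
    obtain ⟨d, rfl⟩ := Nat.exists_eq_add_of_le' hi
    rw [pow_add, _root_.mul_apply_eq_comp, h1, map_zero]
  intro j
  induction j using Nat.strong_induction_on with
  | _ j ih =>
    intro hj
    have := congrArg (A ^ (k - j)) hc
    rw [map_sum, map_zero, Finset.sum_eq_single j] at this
    · rw [map_smul, ← _root_.mul_apply_eq_comp, ← pow_add, Nat.sub_add_cancel hj] at this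
      exact (smul_eq_zero.mp this).resolve_right h2
    · intro i hi hij
      rcases lt_or_gt_of_ne hij with hlt | hgt
      · rw [ih i hlt (by omega), zero_smul, map_zero]
      · rw [map_smul, ← _root_.mul_apply_eq_comp, ← pow_add, hbig _ (by omega), smul_zero]
    · intro hj'
      exact absurd (Finset.mem_range.mpr (by omega)) hj'

lemma nil_dual {A : X →L[ℂ] X} {x : X} {k : ℕ} (h1 : (A ^ (k + 1)) x = 0) (h2 : (A ^ k) x ≠ 0) :
    ∃ f : X →L[ℂ] ℂ, f ((A ^ k) x) = 1 ∧ ∀ j, j < k → f ((A ^ j) x) = 0 := by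
  have hfd : FiniteDimensional ℂ (Submodule.span ℂ (Set.image (fun j : ℕ => (A ^ j) x) (Finset.range k : Set ℕ))) :=
    FiniteDimensional.span_of_finite ℂ ((Finset.finite_toSet _).image _)
  have hn : (A ^ k) x ∉ Submodule.span ℂ (Set.image (fun j : ℕ => (A ^ j) x) (Finset.range k : Set ℕ)) := by
    intro hm
    rw [Submodule.mem_span_image_finset_iff_exists_fun] at hm
    obtain ⟨c, hc⟩ := hm
    have := nil_indep h1 h2 (fun i => if h : i < k then c ⟨i, Finset.mem_range.mpr h⟩ else -1) (by
      rw [Finset.sum_range_succ]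
      have : ∑ i ∈ Finset.range k, (if h : i < k then c ⟨i, Finset.mem_range.mpr h⟩ else -1) • (A ^ i) x = (A ^ k) x := by
        rw [← hc, ← Finset.sum_coe_sort]
        refine Finset.sum_congr rfl fun i hi => ?_
        rw [dif_pos (Finset.mem_range.mp i.2)]
      rw [this]; simp) k le_rfl
    simp at this
  obtain ⟨f, hf, hfk⟩ := HBV _ hn
  exact ⟨f, hfk, fun j hj => hf _ (Submodule.subset_span ⟨j, by simpa using hj, rfl⟩)⟩

lemma nil_notMem {A : X →L[ℂ] X} {n : ℕ} {x : X} (hx : (A ^ n) x = 0) (hAx : A x ≠ 0) :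
    ¬ ∃ a b : ℂ, A x = a • x + b • A (A x) := by
  rintro ⟨a, b, hab⟩
  classical
  have hex : ∃ m, (A ^ m) x = 0 := ⟨n, hx⟩
  obtain ⟨k, hk⟩ : ∃ k, Nat.find hex = k + 2 := by
    have h0 : Nat.find hex ≠ 0 := by
      intro h; have := Nat.find_spec hex; rw [h] at this
      apply hAx; rw [pow_zero] at this; simp at this; simp [this]
    have h1 : Nat.find hex ≠ 1 := by
      intro h; have := Nat.find_spec hex; rw [h, pow_one] at this; exact hAx this
    exact ⟨Nat.find hex - 2, by omega⟩
  have hs := Nat.find_spec hex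
  have hmin := Nat.find_min hex (m := k + 1) (by omega)
  rw [hk] at hs
  have e1 := congrArg (A ^ (k + 1)) hab
  have e2 := congrArg (A ^ k) hab
  have p1 : (A ^ (k + 1)) (A x) = 0 := by
    rw [← _root_.mul_apply_eq_comp, ← pow_succ]; exact hs
  have p0 : (A ^ k) (A x) = (A ^ (k + 1)) x := by
    rw [← _root_.mul_apply_eq_comp, ← pow_succ]
  have p2 : (A ^ k) (A (A x)) = 0 := by
    rw [← p1, pow_succ]; rfl
  have p3 : (A ^ (k + 1)) (A (A x)) = 0 := by
    rw [pow_succ', _root_.mul_apply_eq_comp, p2, map_zero]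
  rw [map_add, map_smul, map_smul, p1, p3, smul_zero, add_zero] at e1
  have ha := (smul_eq_zero.mp e1.symm).resolve_right hmin
  rw [ha, zero_smul, zero_add, map_smul, p2, smul_zero, p0] at e2
  exact hmin e2

lemma nil_C {A P : X →L[ℂ] X} {x : X} {k : ℕ} (hP : ∀ z, (A ^ (k + 1)) (P z) = 0)
    (hPA : ∀ z, P (A z) = A (P z)) (hPx : P x = x) (h2 : (A ^ k) x ≠ 0) :
    ∃ C : X →L[ℂ] X, A * C + C * A = 0 ∧ C * C * C = C ∧
      ∀ j, j ≤ k → C ((A ^ j) x) = (-1 : ℂ) ^ j • (A ^ j) x := by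
  have h1 : (A ^ (k + 1)) x = 0 := by rw [← hPx]; exact hP x
  have hbig : ∀ i, k + 1 ≤ i → (A ^ i) x = 0 := by
    intro i hi
    obtain ⟨d, rfl⟩ := Nat.exists_eq_add_of_le' hi
    rw [pow_add, _root_.mul_apply_eq_comp, h1, map_zero]
  have hPA' : ∀ j z, P ((A ^ j) z) = (A ^ j) (P z) := by
    intro j
    induction j with
    | zero => intro z; simp
    | succ j ih => intro z; rw [pow_succ, _root_.mul_apply_eq_comp, _root_.mul_apply_eq_comp, ih, hPA]
  obtain ⟨f1, hf1, hf1'⟩ := nil_dual h1 h2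
  set f := f1.comp P with hf
  have hfj : ∀ j, f ((A ^ j) x) = if j = k then 1 else 0 := by
    intro j
    rw [hf, ContinuousLinearMap.comp_apply, hPA', hPx]
    split_ifs with hj
    · rw [hj, hf1]
    · rcases lt_or_gt_of_ne hj with hj | hj
      · exact hf1' j hj
      · rw [hbig j hj, map_zero]
  have hfA : ∀ z, f ((A ^ (k + 1)) z) = 0 := by
    intro z; rw [hf, ContinuousLinearMap.comp_apply, hPA', hP, map_zero]
  set C := ∑ i ∈ Finset.range (k + 1), (-1 : ℂ) ^ i • rk ((A ^ i) x) (f.comp (A ^ (k - i))) with hC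
  have hCz : ∀ z, C z = ∑ i ∈ Finset.range (k + 1), ((-1 : ℂ) ^ i * f ((A ^ (k - i)) z)) • (A ^ i) x := by
    intro z
    rw [hC, ContinuousLinearMap.sum_apply]
    refine Finset.sum_congr rfl fun i _ => ?_
    rw [_root_.smul_apply, rk_apply, ContinuousLinearMap.comp_apply, smul_smul]
  have hCj : ∀ j, j ≤ k → C ((A ^ j) x) = (-1 : ℂ) ^ j • (A ^ j) x := by
    intro j hj
    rw [hCz, Finset.sum_eq_single j]
    · rw [← _root_.mul_apply_eq_comp, ← pow_add, Nat.sub_add_cancel hj, hfj, if_pos rfl, mul_one]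
    · intro i hi hij
      have := Finset.mem_range.mp hi
      rw [← _root_.mul_apply_eq_comp, ← pow_add, hfj, if_neg (by omega), mul_zero, zero_smul]
    · intro hj'; exact absurd (Finset.mem_range.mpr (by omega)) hj'
  refine ⟨C, ?_, ?_, hCj⟩
  · ext z
    simp only [_root_.add_apply, _root_.mul_apply_eq_comp, _root_.zero_apply]
    rw [hCz (A z), hCz z, map_sum, Finset.sum_range_succ, Finset.sum_range_succ']
    have e1 : A (((-1 : ℂ) ^ k * f ((A ^ (k - k)) z)) • (A ^ k) x) = 0 := by
      rw [map_smul, ← _root_.mul_apply_eq_comp, ← pow_succ', h1, smul_zero]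
    have e2 : ((-1 : ℂ) ^ 0 * f ((A ^ (k - 0)) (A z))) • (A ^ 0) x = 0 := by
      rw [← _root_.mul_apply_eq_comp, ← pow_succ, Nat.sub_zero, hfA]; simp
    rw [e1, e2, add_zero, add_zero, ← Finset.sum_add_distrib]
    apply Finset.sum_eq_zero
    intro i hi
    have hi := Finset.mem_range.mp hi
    have e3 : (A ^ (k - (i + 1))) (A z) = (A ^ (k - i)) z := by
      rw [← _root_.mul_apply_eq_comp, ← pow_succ]; congr 2; omega
    have e4 : A ((A ^ i) x) = (A ^ (i + 1)) x := by
      rw [← _root_.mul_apply_eq_comp, ← pow_succ']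
    rw [e3, map_smul, e4, pow_succ]
    module
  · have hCC : ∀ j, j ≤ k → C (C ((A ^ j) x)) = (A ^ j) x := by
      intro j hj
      rw [hCj j hj, map_smul, hCj j hj, smul_smul, ← mul_pow]; simp
    ext z
    simp only [_root_.mul_apply_eq_comp]
    rw [hCz z, map_sum, map_sum]
    refine Finset.sum_congr rfl fun i hi => ?_
    have hi := Finset.mem_range.mp hi
    rw [map_smul, map_smul, hCC i (by omega)]

lemma QP.NG {A B : X →L[ℂ] X} (hQ : QP φ A B) (H : FixHyp φ) (hA : IsIntegral ℂ A)
    (hng : ∀ (l : ℂ) (y : X) (h : X →L[ℂ] ℂ), l ≠ 0 → A y = l • y → (∀ z, h (A z) = l * h z) →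
      h ≠ 0 → h y = 0 → y = 0) : A = B := by
  by_contra hne
  set D := A - B with hD
  have hD0 : D ≠ 0 := sub_ne_zero.mpr hne
  have hm0 : minpoly ℂ A ≠ 0 := minpoly.ne_zero hA
  obtain ⟨q, hq, hq0⟩ := exists_eq_pow_rootMultiplicity_mul_and_not_dvd (minpoly ℂ A) hm0 0
  obtain ⟨n, hn⟩ : ∃ n, n = rootMultiplicity 0 (minpoly ℂ A) := ⟨_, rfl⟩
  rw [← hn, map_zero, sub_zero] at hq
  rw [dvd_iff_isRoot] at hq0
  have hq0 : q.eval 0 ≠ 0 := hq0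
  have hqne : q ≠ 0 := by rintro rfl; simp at hq0
  -- step a
  have ha : D * A ^ n = 0 := by
    by_contra hc
    obtain ⟨μ, r, hμ, hr0, hr⟩ := ROOT A (D * A ^ n) hc _ q hqne rfl (by
      have : aeval A (Polynomial.X ^ n * q) = 0 := by rw [← hq, minpoly.aeval]
      rw [map_mul, map_pow, aeval_X] at this
      rw [mul_assoc, this, mul_zero])
    have hμ0 : μ ≠ 0 := by rintro rfl; exact hq0 hμ
    obtain ⟨x, hx⟩ : ∃ x, (D * A ^ n) (aeval A r x) ≠ 0 := by
      by_contra hcon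
      push Not at hcon
      exact hr0 (ContinuousLinearMap.ext hcon)
    obtain ⟨ψ, hψ⟩ := exists_dual hx
    obtain ⟨⟨y, hy0, hy⟩, -⟩ := root_both hA (μ := μ) (by rw [hq]; simp [hμ])
    refine hy0 (hng μ y (ψ.comp (D * A ^ n * aeval A r)) hμ0 hy ?_ ?_ ?_)
    · intro z
      simp only [ContinuousLinearMap.comp_apply]
      rw [_root_.mul_apply_eq_comp, hr, map_smul]; rfl
    · intro h0
      have := congrArg (fun T : X →L[ℂ] ℂ => T x) h0
      simp only [ContinuousLinearMap.comp_apply] at this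
      rw [_root_.mul_apply_eq_comp, hψ] at this
      exact one_ne_zero this
    · have e : A ^ n * aeval A r = aeval A (Polynomial.X ^ n * r) := by simp
      rw [ContinuousLinearMap.comp_apply, mul_assoc, e, _root_.mul_apply_eq_comp, aeval_eig hy, map_smul, hD,
        _root_.sub_apply, hQ.EL H hμ0 hy, hy, sub_self, smul_zero, map_zero]
  -- step b
  have hcop : IsCoprime (Polynomial.X ^ n) q := by
    apply IsCoprime.pow_left
    have : IsCoprime (Polynomial.X - C (0:ℂ)) q := by
      rw [(irreducible_X_sub_C (0:ℂ)).coprime_iff_not_dvd, dvd_iff_isRoot]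
      exact hq0
    simpa using this
  obtain ⟨u, v, huv⟩ := hcop
  obtain ⟨P, hPdef⟩ : ∃ P, P = aeval A (v * q) := ⟨_, rfl⟩
  have hone : ∀ x, x = aeval A u ((A ^ n) x) + P x := by
    intro x
    have := congrArg (fun p => aeval A p x) huv
    simp only [map_add, _root_.add_apply, map_one, _root_.one_apply_eq_self] at this
    rw [hPdef]
    conv_lhs => rw [← this]
    rw [map_mul, map_pow, aeval_X, _root_.mul_apply_eq_comp]
  have hAP : ∀ x, (A ^ n) (P x) = 0 := by
    intro x
    have e : A ^ n * P = 0 := by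
      have e1 : A ^ n * P = aeval A (Polynomial.X ^ n * (v * q)) := by rw [map_mul, map_pow, aeval_X, hPdef]
      rw [e1, mul_left_comm, ← hq, map_mul, minpoly.aeval, mul_zero]
    exact congrArg (fun T : X →L[ℂ] X => T x) e
  have hPA : ∀ x, P (A x) = A (P x) := by
    intro x
    have e : P * A = A * P := by
      have e1 : P * A = aeval A ((v * q) * Polynomial.X) := by rw [map_mul, aeval_X, hPdef]
      have e2 : A * P = aeval A (Polynomial.X * (v * q)) := by rw [map_mul, aeval_X, hPdef]
      rw [e1, e2, mul_comm]
    exact congrArg (fun T : X →L[ℂ] X => T x) e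
  have hPx : ∀ x, (A ^ n) x = 0 → P x = x := by
    intro x hx
    have := hone x
    rw [hx, map_zero, zero_add] at this
    exact this.symm
  have hDP : ∀ x, D x = D (P x) := by
    intro x
    conv_lhs => rw [hone x]
    have e : (A ^ n) (aeval A u x) = aeval A u ((A ^ n) x) := by
      have : A ^ n * aeval A u = aeval A u * A ^ n := by
        have h2 : aeval A (Polynomial.X ^ n * u) = aeval A (u * Polynomial.X ^ n) := by rw [mul_comm]
        simpa using h2
      exact congrArg (fun T : X →L[ℂ] X => T x) this
    rw [map_add, ← e, ← _root_.mul_apply_eq_comp D, ha]; simp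
  suffices hmain : ∀ x, (A ^ n) x = 0 → D x = 0 by
    apply hD0
    ext x
    rw [hDP, hmain _ (hAP x)]; rfl
  -- step c
  have hker : ¬ (LinearMap.ker ((aeval A (Polynomial.X - C (0:ℂ)) : X →L[ℂ] X) : X →ₗ[ℂ] X)).FG := by
    intro hfg
    apply H.inf
    have := fd_ker_aeval (A := A) (by
      intro r
      by_cases hr : r = 0
      · rw [hr]; exact hfg
      by_cases hroot : (minpoly ℂ A).eval r = 0
      · obtain ⟨-, ⟨h, hh0, hh⟩⟩ := root_both hA hroot
        have hmem : ∀ y ∈ LinearMap.ker ((aeval A (Polynomial.X - C r) : X →L[ℂ] X) : X →ₗ[ℂ] X), A y = r • y := by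
          intro y hy
          have hy : aeval A (Polynomial.X - C r) y = 0 := hy
          rw [aeval_X_sub, sub_eq_zero] at hy
          exact hy
        have hinj : Function.Injective ((h : X →ₗ[ℂ] ℂ).domRestrict
            (LinearMap.ker ((aeval A (Polynomial.X - C r) : X →L[ℂ] X) : X →ₗ[ℂ] X))) := by
          rw [← LinearMap.ker_eq_bot, LinearMap.ker_eq_bot']
          rintro ⟨y, hy⟩ hy0
          have := hng r y h hr (hmem y hy) hh hh0 hy0
          exact Subtype.ext this
        exact Module.Finite.iff_fg.mp (Module.Finite.of_injective _ hinj)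
      · have : LinearMap.ker ((aeval A (Polynomial.X - C r) : X →L[ℂ] X) : X →ₗ[ℂ] X) = ⊥ := by
          rw [LinearMap.ker_eq_bot']
          intro y hy
          have hy : aeval A (Polynomial.X - C r) y = 0 := hy
          rw [aeval_X_sub, sub_eq_zero] at hy
          by_contra hy0
          exact hroot (minpoly_root hy0 hy)
        rw [this]; exact Submodule.fg_bot) _ (minpoly ℂ A) hm0 rfl
    rw [minpoly.aeval] at this
    have h2 : LinearMap.ker (((0 : X →L[ℂ] X)) : X →ₗ[ℂ] X) = ⊤ := by ext; simp
    rw [h2] at this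
    exact ⟨this⟩
  have hkerex : ∀ V : Submodule ℂ X, V.FG → ∃ w, A w = 0 ∧ w ∉ V := by
    intro V hV
    by_contra hcon
    push Not at hcon
    apply hker
    have : FiniteDimensional ℂ V := Module.Finite.iff_fg.mpr hV
    have hle : LinearMap.ker ((aeval A (Polynomial.X - C (0:ℂ)) : X →L[ℂ] X) : X →ₗ[ℂ] X) ≤ V := by
      intro y hy
      have hy : aeval A (Polynomial.X - C (0:ℂ)) y = 0 := hy
      rw [aeval_X_sub, zero_smul, sub_zero] at hy
      exact hcon y hy
    have := Submodule.finiteDimensional_of_le hle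
    exact Module.Finite.iff_fg.mp this
  obtain ⟨w0, hw0, hw0'⟩ := hkerex ⊥ Submodule.fg_bot
  have hw0' : w0 ≠ 0 := by simpa using hw0'
  obtain ⟨-, ⟨h0, hh00, hh0⟩⟩ := root_both hA (minpoly_root (μ := 0) hw0' (by rw [hw0, zero_smul]))
  -- step d
  have hd : ∀ x, A x = 0 → B x = 0 := by
    intro x hx
    by_cases hx0 : x = 0
    · simp [hx0]
    obtain ⟨w, hw⟩ := exists_one_of_ne hh00
    have h1 := hQ.b1 H (x := x) (f := h0) (by intro z; rw [hx, hh0]; simp) w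
    rw [hw, one_smul] at h1
    have h2 : B x = (-h0 (B w)) • x := by rw [neg_smul]; exact eq_neg_of_add_eq_zero_left h1
    by_cases hρ : -h0 (B w) = 0
    · rw [h2, hρ, zero_smul]
    · have h3 := hQ.symm.EL H hρ h2
      rw [hx] at h3
      exact absurd h3.symm (smul_ne_zero hρ hx0)
  have hd' : ∀ x, A x = 0 → D x = 0 := by
    intro x hx; rw [hD, _root_.sub_apply, hx, hd x hx, sub_zero]
  -- step e
  have he : ∀ x, (A ^ n) x = 0 → ∃ β : ℂ, D x = β • A (A x) := by
    intro x hx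
    by_cases hAx : A x = 0
    · exact ⟨0, by rw [hd' x hAx, zero_smul]⟩
    have hn0 : n ≠ 0 := by
      rintro rfl; rw [pow_zero] at hx; apply hAx; simp at hx; simp [hx]
    obtain ⟨⟨α, β, hαβ⟩, -⟩ := hQ.c' H (nil_notMem hx hAx)
    obtain ⟨w, hw, hwV⟩ := hkerex (Submodule.span ℂ {x, A (A x)}) (Module.Finite.iff_fg.mp inferInstance)
    have hxw : (A ^ n) (x + w) = 0 := by
      obtain ⟨k, rfl⟩ := Nat.exists_eq_succ_of_ne_zero hn0
      rw [map_add, hx, zero_add, Nat.succ_eq_add_one, pow_succ, _root_.mul_apply_eq_comp, hw, map_zero]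
    obtain ⟨⟨α', β', hαβ'⟩, -⟩ := hQ.c' H (nil_notMem hxw (by rw [map_add, hw, add_zero]; exact hAx))
    have e1 : A (x + w) - B (x + w) = A x - B x := by
      rw [map_add, map_add, hw, hd w hw, add_zero, add_zero]
    have e2 : A (A (x + w)) = A (A x) := by rw [map_add, hw, add_zero]
    rw [e1, e2] at hαβ'
    by_cases hα' : α' = 0
    · exact ⟨β', by rw [hD, _root_.sub_apply, hαβ', hα', zero_smul, zero_add]⟩
    · exfalso
      apply hwV
      rw [Submodule.mem_span_pair]
      refine ⟨α'⁻¹ * (α - α'), α'⁻¹ * (β - β'), ?_⟩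
      rw [hαβ] at hαβ'
      have e3 : α' • w = (α - α') • x + (β - β') • A (A x) := by
        have : α' • w = α' • (x + w) + β' • A (A x) - (α' • x + β' • A (A x)) := by module
        rw [this, ← hαβ']; module
      rw [mul_smul, mul_smul, ← smul_add, ← e3, smul_smul, inv_mul_cancel₀ hα', one_smul]
  -- step f
  classical
  have hex : ∃ m, ∀ x, (A ^ n) x = 0 → (A ^ m) x = 0 := ⟨n, fun x hx => hx⟩
  by_cases hm2 : Nat.find hex ≤ 2
  · intro x hx
    obtain ⟨β, hβ⟩ := he x hx
    have h1 := Nat.find_spec hex x hx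
    obtain ⟨d, hd2⟩ := Nat.exists_eq_add_of_le' hm2
    have h2 : A (A x) = 0 := by
      have : (A ^ 2) x = 0 := by rw [hd2, pow_add, _root_.mul_apply_eq_comp, h1, map_zero]
      rw [pow_two] at this; exact this
    rw [hβ, h2, smul_zero]
  obtain ⟨k, hk⟩ : ∃ k, Nat.find hex = k + 1 := ⟨Nat.find hex - 1, by omega⟩
  have hk2 : 2 ≤ k := by omega
  have hspec := Nat.find_spec hex
  rw [hk] at hspec
  have hmin := Nat.find_min hex (m := k) (by omega)
  push Not at hmin
  obtain ⟨x0, hx0, hx0'⟩ := hmin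
  have hf : ∀ x, (A ^ n) x = 0 → (A ^ k) x ≠ 0 → D x = 0 := by
    intro x hx hxk
    obtain ⟨β, hβ⟩ := he x hx
    obtain ⟨C, hC1, hC2, hC3⟩ := nil_C (fun z => hspec _ (hAP z)) hPA (hPx x hx) hxk
    have hCB := hQ.b (C := C) (H.trip hC2) (H.trip (by simp [hC2])) hC1
    have hCD : D * C + C * D = 0 := by
      have : D * C + C * D = (A * C + C * A) - (B * C + C * B) := by rw [hD]; noncomm_ring
      rw [this, hC1, hCB, sub_zero]
    have h1 := congrArg (fun T : X →L[ℂ] X => T x) hCD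
    simp only [_root_.add_apply, _root_.mul_apply_eq_comp, _root_.zero_apply] at h1
    have h2 := hC3 0 (by omega)
    have h3 := hC3 2 hk2
    have e2 : (A ^ 2) x = A (A x) := by rw [pow_two]; rfl
    rw [pow_zero, pow_zero, one_smul, _root_.one_apply_eq_self] at h2
    rw [e2] at h3
    rw [h2, hβ, map_smul, h3] at h1
    norm_num at h1
    rw [hβ]
    have : (2:ℂ) • β • A (A x) = 0 := by rw [two_smul]; exact h1
    exact (smul_eq_zero.mp this).resolve_left two_ne_zero
  intro x hx
  by_cases hxk : (A ^ k) x = 0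
  · have h1 := hf (x0 + x) (by rw [map_add, hx0, hx, add_zero]) (by rw [map_add, hxk, add_zero]; exact hx0')
    rw [map_add, hf x0 hx0 hx0', zero_add] at h1
    exact h1
  · exact hf x hx hxk

theorem FixHyp.fix (H : FixHyp φ) (A : X →L[ℂ] X) : φ A = A := by
  have hQ := H.qp A
  by_cases h1 : ∃ x, LinearIndependent ℂ (fun i : Fin 5 => (A ^ (i : ℕ)) x)
  · obtain ⟨x, hx⟩ := h1
    exact hQ.case1' H hx
  · push Not at h1
    have hA := kaplansky h1
    symm
    by_contra hne
    apply hne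
    apply hQ.NG H hA
    intro l y h hl hy hh hh0 hhy
    by_contra hy0
    exact hne (hQ.GL H hA hl hy hh hy0 hh0 hhy)

end JP


namespace JP

variable {X : Type*} [NormedAddCommGroup X] [NormedSpace ℂ X]
variable {φ : (X →L[ℂ] X) → (X →L[ℂ] X)}

lemma Rel_self (C : X →L[ℂ] X) : Rel C C ↔ C * C * (C * C) = C * C := by
  unfold Rel IsIdempotentElem
  have : (2⁻¹ : ℂ) • (C * C + C * C) = C * C := by
    rw [← two_smul ℂ (C * C), smul_smul]; norm_num
  rw [this]

lemma Rel_of_anti {A C : X →L[ℂ] X} (h : A * C + C * A = 0) : Rel A C :=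
  ((Rel_pm_iff A C).mpr h).1

lemma one_lemma (A : X →L[ℂ] X) (h0 : Rel A A) (h : ∀ C, Rel A C → Rel C C) : A = 1 ∨ A = -1 := by
  have h' : ∀ C, A * C + C * A = 0 → C * C = 0 := by
    intro C hC
    have h1 := (Rel_self C).mp (h C (Rel_of_anti hC))
    have h2 := (Rel_self _).mp (h ((2:ℂ) • C) (Rel_of_anti (by
      rw [mul_smul_comm, smul_mul_assoc, ← smul_add, hC, smul_zero])))
    simp only [smul_mul_smul_comm] at h2
    rw [h1, ← sub_eq_zero, ← sub_smul] at h2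
    exact (smul_eq_zero.mp h2).resolve_left (by norm_num)
  rw [Rel_self] at h0
  have hQ : A * A = 1 := by
    by_contra hne
    have hQ0 : (1 - A * A) ≠ 0 := fun h => hne (sub_eq_zero.mp h).symm
    have hQQ : (1 - A * A) * (1 - A * A) = 1 - A * A := by
      have : (1 - A * A) * (1 - A * A) = 1 - A * A - (A * A - A * A * (A * A)) := by noncomm_ring
      rw [this, h0]; simp
    have hAAQ : A * A * (1 - A * A) = 0 := by
      rw [mul_sub, h0]; simp
    have hcomm : (1 - A * A) * A = A * (1 - A * A) := by noncomm_ring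
    by_cases hAQ : A * (1 - A * A) = 0
    · apply hQ0
      rw [← hQQ]
      apply h'
      rw [hcomm, hAQ, add_zero]
    · obtain ⟨x', hx'⟩ : ∃ x', (A * (1 - A * A)) x' ≠ 0 := by
        by_contra hcon
        push Not at hcon
        exact hAQ (by ext z; exact hcon z)
      obtain ⟨Q, hQd⟩ : ∃ Q, Q = 1 - A * A := ⟨_, rfl⟩
      rw [← hQd] at hQ0 hQQ hAAQ hcomm hAQ hx'
      obtain ⟨f1, hf1⟩ := exists_dual hx'
      rw [_root_.mul_apply_eq_comp] at hf1 hx'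
      have e1 : ∀ z, A (A (Q z)) = 0 := fun z => by
        have := congrArg (fun T : X →L[ℂ] X => T z) hAAQ
        simpa using this
      have e2 : ∀ z, Q (A z) = A (Q z) := fun z => by
        have := congrArg (fun T : X →L[ℂ] X => T z) hcomm
        simpa using this
      have e3 : ∀ z, Q (Q z) = Q z := fun z => by
        have := congrArg (fun T : X →L[ℂ] X => T z) hQQ
        simpa using this
      have hC := h' (rk (Q x') ((f1.comp Q).comp A) - rk (A (Q x')) (f1.comp Q)) (by
        ext z
        simp [e1, e2])
      have := congrArg (fun T : X →L[ℂ] X => T (Q x')) hC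
      simp [e1, e2, e3, hf1] at this
      apply hx'
      rw [this, map_zero]
  by_contra hcon
  push Not at hcon
  obtain ⟨hA1, hA2⟩ := hcon
  have hAA : ∀ z, A (A z) = z := fun z => by
    have := congrArg (fun T : X →L[ℂ] X => T z) hQ
    simpa using this
  obtain ⟨y', hy'⟩ : ∃ x, x - A x ≠ 0 := by
    by_contra hcon
    push Not at hcon
    exact hA1 (by ext z; exact (sub_eq_zero.mp (hcon z)).symm)
  obtain ⟨x', hx'⟩ : ∃ x, x + A x ≠ 0 := by
    by_contra hcon
    push Not at hcon
    exact hA2 (by ext z; have := hcon z; simp; rw [← add_eq_zero_iff_eq_neg, add_comm]; exact this)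
  obtain ⟨x, hx⟩ : ∃ x, x = x' + A x' := ⟨_, rfl⟩
  obtain ⟨y, hy⟩ : ∃ y, y = y' - A y' := ⟨_, rfl⟩
  rw [← hx] at hx'
  rw [← hy] at hy'
  have hAx : A x = x := by rw [hx, map_add, hAA, add_comm]
  have hAy : A y = - y := by rw [hy, map_sub, hAA]; abel
  obtain ⟨f, hf⟩ := exists_dual hx'
  obtain ⟨g, hg⟩ := exists_dual hy'
  have hC := h' (rk x (g - g.comp A) + rk y (f + f.comp A)) (by
        ext z
        simp [hAx, hAy, hAA]
        module)
  have := congrArg (fun T : X →L[ℂ] X => T x) hC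
  simp [hAx, hAy, hf, hg] at this
  norm_num at this
  exact hx' this

/-- orthogonality of operators -/
def Orth (P Q : X →L[ℂ] X) : Prop := P * Q = 0 ∧ Q * P = 0

lemma Rel_neg_iff {P Q : X →L[ℂ] X} (hP : P * P = P) (hQ : Q * Q = Q) : Rel P (-Q) ↔ Orth P Q := by
  constructor
  · intro h
    obtain ⟨S, hS⟩ : ∃ S, S = P * Q + Q * P := ⟨_, rfl⟩
    have hSS : S * S = (-2:ℂ) • S := by
      unfold Rel IsIdempotentElem at h
      have e : P * -Q + -Q * P = - S := by rw [hS]; noncomm_ring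
      rw [e, smul_mul_smul_comm, neg_mul_neg] at h
      have := congrArg (fun T => (4:ℂ) • T) h
      simp only [smul_smul, smul_neg] at this
      norm_num at this
      rw [this, neg_smul]
    have hPSP : P * S * P = (2:ℂ) • (P * Q * P) := by
      have : P * S * P = (P * P) * Q * P + P * Q * (P * P) := by rw [hS]; noncomm_ring
      rw [this, hP, two_smul]
    have hS2 : S * S = P * Q * P * Q + P * Q * P + Q * P * Q + Q * P * Q * P := by
      have : S * S = P * Q * P * Q + P * (Q * Q) * P + Q * (P * P) * Q + Q * P * Q * P := by
        rw [hS]; noncomm_ring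
      rw [this, hP, hQ]
    obtain ⟨a, ha⟩ : ∃ a, a = P * Q * P := ⟨_, rfl⟩
    have haa : a * a = P * Q * P * Q * P := by
      have : a * a = P * Q * (P * P) * Q * P := by rw [ha]; noncomm_ring
      rw [this, hP]
    have h1 : P * (S * S) * P = a + (3:ℂ) • (a * a) := by
      have : P * (S * S) * P = (P * P) * Q * P * Q * P + P * P * Q * (P * P) + P * Q * P * Q * P
          + P * Q * P * Q * (P * P) := by rw [hS2]; noncomm_ring
      rw [this, hP, haa, ha]; module
    have h2 : (3:ℂ) • (a * a) = (-5:ℂ) • a := by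
      have e : P * (S * S) * P = (-4:ℂ) • a := by
        rw [hSS, mul_smul_comm, smul_mul_assoc, hPSP, smul_smul, ha]; norm_num
      rw [h1] at e
      have : (3:ℂ) • (a * a) = (-4:ℂ) • a - a := by rw [← e]; abel
      rw [this]; module
    have h3 : (1 - P) * (S * S) * (1 - P) = 0 := by
      have : (1 - P) * S * (1 - P) = 0 := by
        have : (1 - P) * S * (1 - P) = (P - P * P) * Q * (1 - P) + (1 - P) * Q * (P - P * P) := by
          rw [hS]; noncomm_ring
        rw [this, hP]; simp
      rw [hSS, mul_smul_comm, smul_mul_assoc, this, smul_zero]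
    have hcb : (1 - P) * Q * P * Q * (1 - P) = 0 := by
      rw [← h3, hS2]
      have : (1 - P) * (P * Q * P * Q + P * Q * P + Q * P * Q + Q * P * Q * P) * (1 - P) =
        (P - P * P) * Q * P * Q * (1 - P) + (P - P * P) * Q * P * (1 - P) + (1 - P) * Q * P * Q * (1 - P)
        + (1 - P) * Q * P * Q * (P - P * P) := by noncomm_ring
      rw [this, hP]; simp
    have hbc : P * Q * (1 - P) * (1 - P) * Q * P = a - a * a := by
      have : P * Q * (1 - P) * (1 - P) * Q * P = P * (Q * Q) * P - P * Q * P * Q * P - P * Q * P * Q * P + P * Q * (P * P) * Q * P := by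
        noncomm_ring
      rw [this, hP, hQ, haa, ← ha]; abel
    have h4 : (a - a * a) * (a - a * a) = 0 := by
      have e : (a - a * a) * (a - a * a) =
        P * Q * (1 - P) * ((1 - P) * Q * (P * P) * Q * (1 - P)) * (1 - P) * Q * P := by
        rw [← hbc]; noncomm_ring
      rw [e, hP, hcb]; simp
    have h5 : a * a = (-5/3:ℂ) • a := by
      have := congrArg (fun T => (3⁻¹:ℂ) • T) h2
      simp only [smul_smul] at this
      norm_num at this
      rw [this]; norm_num
    have h6 : a = 0 := by
      have e : a - a * a = (8/3:ℂ) • a := by rw [h5]; module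
      rw [e, smul_mul_smul_comm, h5, smul_smul] at h4
      exact (smul_eq_zero.mp h4).resolve_left (by norm_num)
    have h7 : P * Q * P = 0 := by rw [← ha, h6]
    have hS3 : S * S = Q * P * Q := by
      have e : Q * P * Q * P = Q * (P * Q * P) := by noncomm_ring
      rw [hS2, e, h7, zero_mul, mul_zero]; simp
    rw [hS3] at hSS
    have h8 : P * Q = 0 := by
      have := congrArg (fun T => P * T) hSS
      simp only [mul_smul_comm] at this
      rw [hS, ← mul_assoc, ← mul_assoc, h7, zero_mul, mul_add, ← mul_assoc, ← mul_assoc, hP, h7, add_zero] at this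
      exact (smul_eq_zero.mp this.symm).resolve_left (by norm_num)
    have h9 : Q * P = 0 := by
      have := hSS
      rw [mul_assoc, h8, mul_zero, hS, h8, zero_add] at this
      exact (smul_eq_zero.mp this.symm).resolve_left (by norm_num)
    exact ⟨h8, h9⟩
  · rintro ⟨h1, h2⟩
    apply Rel_of_anti
    simp [h1, h2]

lemma Rel_of_orth {P Q : X →L[ℂ] X} (h : Orth P Q) : Rel P Q := Rel_of_anti (by rw [h.1, h.2, add_zero])

lemma Orth.symm {P Q : X →L[ℂ] X} (h : Orth P Q) : Orth Q P := ⟨h.2, h.1⟩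

lemma orth_zero (P : X →L[ℂ] X) : Orth 0 P := ⟨by simp, by simp⟩

/-- minimal idempotents -/
def Atom (P : X →L[ℂ] X) : Prop := P * P = P ∧ P ≠ 0 ∧ ∀ Q, Q * Q = Q → Q ≠ 0 →
  (∀ R, R * R = R → Orth R P → Orth R Q) → (∀ R, R * R = R → Orth R Q → Orth R P)

lemma idem_compl {P : X →L[ℂ] X} (hP : P * P = P) : (1 - P) * (1 - P) = 1 - P := by
  have : (1 - P) * (1 - P) = 1 - P - (P - P * P) := by noncomm_ring
  rw [this, hP]; simp

lemma orth_compl {P : X →L[ℂ] X} (hP : P * P = P) : Orth (1 - P) P :=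
  ⟨by rw [sub_mul, hP]; simp, by rw [mul_sub, hP]; simp⟩

lemma rk_ne_zero {x : X} {f : X →L[ℂ] ℂ} (h : f x = 1) : rk x f ≠ 0 := by
  intro h0
  have := congrArg (fun T : X →L[ℂ] X => f (T x)) h0
  simp [h] at this

lemma atom_rk {x : X} {f : X →L[ℂ] ℂ} (h : f x = 1) : Atom (rk x f) := by
  refine ⟨rk_idem h, rk_ne_zero h, ?_⟩
  intro Q hQ hQ0 hle
  obtain ⟨h1, h2⟩ := hle _ (idem_compl (rk_idem h)) (orth_compl (rk_idem h))
  have e1 : ∀ z, Q z = f (Q z) • x := fun z => by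
    have := congrArg (fun T : X →L[ℂ] X => T z) h1
    simpa [sub_eq_zero] using this
  have e2 : ∀ z, Q z = f z • Q x := fun z => by
    have := congrArg (fun T : X →L[ℂ] X => T z) h2
    simpa [sub_eq_zero] using this
  have e3 : ∀ z, Q z = (f z * f (Q x)) • x := fun z => by
    rw [e2 z]; conv_lhs => rw [e1 x]
    rw [smul_smul]
  have hc0 : f (Q x) ≠ 0 := by
    intro hc; apply hQ0; ext z; rw [e3 z, hc]; simp
  have hc1 : f (Q x) = 1 := by
    have := congrArg (fun T : X →L[ℂ] X => f (T x)) hQ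
    simp only [_root_.mul_apply_eq_comp] at this
    rw [e3 (Q x), map_smul, h] at this
    exact mul_right_cancel₀ hc0 (by simpa using this)
  have : Q = rk x f := by ext z; rw [e3 z, hc1]; simp
  rw [this]
  exact fun R _ h => h

lemma atom_exists {P : X →L[ℂ] X} (h : Atom P) : ∃ x f, f x = 1 ∧ P = rk x f := by
  obtain ⟨hP, hP0, hmin⟩ := h
  obtain ⟨x', hx'⟩ : ∃ x', P x' ≠ 0 := by
    by_contra hcon
    push Not at hcon
    exact hP0 (by ext z; exact hcon z)
  have hPP : ∀ z, P (P z) = P z := fun z => congrArg (fun T : X →L[ℂ] X => T z) hP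
  obtain ⟨f1, hf1⟩ := exists_dual hx'
  have hfx : (f1.comp P) (P x') = 1 := by simp [hPP, hf1]
  refine ⟨P x', f1.comp P, hfx, ?_⟩
  have := hmin (rk (P x') (f1.comp P)) (rk_idem hfx) (rk_ne_zero hfx) (by
    rintro R hR ⟨h1, h2⟩
    have e1 : ∀ z, R (P z) = 0 := fun z => congrArg (fun T : X →L[ℂ] X => T z) h1
    have e2 : ∀ z, P (R z) = 0 := fun z => congrArg (fun T : X →L[ℂ] X => T z) h2
    constructor <;> ext z <;> simp [e1, e2]) _ (idem_compl (rk_idem hfx)) (orth_compl (rk_idem hfx))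
  have e := this.2
  rw [mul_sub, mul_one, sub_eq_zero] at e
  rw [e]
  ext z
  simp [hPP, hf1]

/-- The standing hypotheses after normalisation. -/
structure NHyp (φ : (X →L[ℂ] X) → (X →L[ℂ] X)) : Prop where
  inf : ¬ FiniteDimensional ℂ X
  rel : ∀ A C, Rel A C ↔ Rel (φ A) (φ C)
  sp : ∀ P, P * P = P → P ≠ 0 → ∃ A, φ A = P
  sm : ∀ P, P * P = P → P ≠ 0 → ∃ A, φ (-A) = -P
  one : φ 1 = 1
  mone : φ (-1) = -1

lemma normalize (hinf : ¬ FiniteDimensional ℂ X)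
    (hrange : ∀ P : X →L[ℂ] X,
      ((P * P = P ∧ P ≠ 0) ∨ (P * P = -P ∧ P ≠ 0)) → ∃ A, φ A = P)
    (hpres : ∀ A B : X →L[ℂ] X, Rel A B ↔ Rel (φ A) (φ B)) :
    NHyp φ ∨ NHyp (fun A => - φ A) := by
  have hsp : ∀ P, P * P = P → P ≠ 0 → ∃ A, φ A = P := fun P h1 h2 => hrange P (Or.inl ⟨h1, h2⟩)
  have hsm : ∀ P, P * P = P → P ≠ 0 → ∃ A, φ (-A) = -P := fun P h1 h2 => by
    obtain ⟨A, hA⟩ := hrange (-P) (Or.inr ⟨by simp [h1], by simpa using h2⟩)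
    exact ⟨-A, by simpa using hA⟩
  have hne : (1 : X →L[ℂ] X) ≠ 0 := by
    intro h
    obtain ⟨x, -, f, -, hf, -⟩ := exists_biorth hinf
    have := congrArg (fun T : X →L[ℂ] X => f (T x)) h
    simp [hf] at this
  have hn1 : ∀ C : X →L[ℂ] X, C * C = C → Rel C C := fun C h => (Rel_self C).mpr (by rw [h, h])
  have key : ∀ A0, (φ A0 = 1 ∨ φ A0 = -1) → A0 = 1 ∨ A0 = -1 := by
    intro A0 hA0
    apply one_lemma
    · rw [hpres]
      rcases hA0 with h | h <;> rw [h, Rel_self] <;> simp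
    · intro C hC
      rw [hpres] at hC ⊢
      rcases hA0 with h | h
      · rw [h, Rel_one] at hC; exact hn1 _ hC
      · rw [h, Rel_neg_left, Rel_one] at hC
        rw [← Rel_neg_neg]
        exact hn1 _ hC
  obtain ⟨A0, h0⟩ := hsp 1 (by simp) hne
  obtain ⟨A1, h1⟩ := hsm 1 (by simp) hne
  have hne2 : (1 : X →L[ℂ] X) ≠ -1 := by
    intro h
    apply hne
    have : (2:ℂ) • (1 : X →L[ℂ] X) = 0 := by rw [two_smul]; nth_rewrite 2 [h]; simp
    exact (smul_eq_zero.mp this).resolve_left (by norm_num)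
  have hd : A0 ≠ -A1 := by
    rintro rfl
    rw [h0] at h1
    exact hne2 h1
  have k0 := key A0 (Or.inl h0)
  have k1 := key (-A1) (Or.inr h1)
  rcases k0 with e0 | e0 <;> rcases k1 with e1 | e1
  · exact absurd (e0.trans e1.symm) hd
  · left
    exact ⟨hinf, hpres, hsp, hsm, by rw [e0] at h0; exact h0, by rw [e1] at h1; exact h1⟩
  · right
    refine ⟨hinf, fun A C => by rw [hpres, Rel_neg_neg], ?_, ?_, ?_, ?_⟩
    · intro P h1 h2
      obtain ⟨A, hA⟩ := hsm P h1 h2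
      exact ⟨-A, by simp [hA]⟩
    · intro P h1 h2
      obtain ⟨A, hA⟩ := hsp P h1 h2
      exact ⟨-A, by simp [hA]⟩
    · show - φ 1 = 1
      rw [← e1, h1, e1]; simp
    · show - φ (-1) = -1
      rw [← e0, h0, e0]
  · exact absurd (e0.trans e1.symm) hd

namespace NHyp

lemma flip (H : NHyp φ) : NHyp (fun A => - φ (-A)) := by
  refine ⟨H.inf, fun A C => ?_, ?_, ?_, ?_, ?_⟩
  · rw [Rel_neg_neg, ← H.rel, Rel_neg_neg]
  · intro P h1 h2
    obtain ⟨A, hA⟩ := H.sm P h1 h2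
    exact ⟨A, by simp [hA]⟩
  · intro P h1 h2
    obtain ⟨A, hA⟩ := H.sp P h1 h2
    exact ⟨A, by simp [hA]⟩
  · simp [H.mone]
  · simp [H.one]

lemma idem (H : NHyp φ) (P) : P * P = P ↔ φ P * φ P = φ P := by
  rw [← Rel_one, H.rel, H.one, Rel_one]

lemma idem' (H : NHyp φ) (P) : P * P = P ↔ (- φ (-P)) * (- φ (-P)) = - φ (-P) := H.flip.idem P

lemma zero (H : NHyp φ) (A) : φ A = 0 ↔ A = 0 := by
  have key : ∀ A : X →L[ℂ] X, A = 0 ↔ (A * A = A ∧ (-A) * (-A) = -A) := by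
    intro A
    constructor
    · rintro rfl; simp
    · rintro ⟨h1, h2⟩
      rw [neg_mul_neg, h1] at h2
      have : (2:ℂ) • A = 0 := by rw [two_smul]; nth_rewrite 2 [h2]; simp
      exact (smul_eq_zero.mp this).resolve_left (by norm_num)
  rw [key, key A, ← H.idem, H.idem' (-A), neg_neg]

lemma orth (H : NHyp φ) {P R} (hP : P * P = P) (hR : R * R = R) :
    Orth P R ↔ Orth (φ P) (- φ (-R)) := by
  rw [← Rel_neg_iff hP hR, ← Rel_neg_iff ((H.idem P).mp hP) ((H.idem' R).mp hR), neg_neg, H.rel]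

lemma exP (H : NHyp φ) {Q} (hQ : Q * Q = Q) (hQ0 : Q ≠ 0) : ∃ P, P * P = P ∧ P ≠ 0 ∧ φ P = Q := by
  obtain ⟨A, hA⟩ := H.sp Q hQ hQ0
  refine ⟨A, (H.idem A).mpr (by rw [hA, hQ]), ?_, hA⟩
  rw [← hA, Ne, H.zero] at hQ0; exact hQ0

lemma exM (H : NHyp φ) {Q} (hQ : Q * Q = Q) (hQ0 : Q ≠ 0) : ∃ P, P * P = P ∧ P ≠ 0 ∧ - φ (-P) = Q :=
  H.flip.exP hQ hQ0

lemma exM' (H : NHyp φ) {Q} (hQ : Q * Q = Q) : ∃ P, P * P = P ∧ - φ (-P) = Q := by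
  by_cases h : Q = 0
  · refine ⟨0, by simp, ?_⟩
    rw [h, neg_zero, neg_eq_zero, H.zero]
  · obtain ⟨P, h1, -, h2⟩ := H.exM hQ h
    exact ⟨P, h1, h2⟩

lemma atom (H : NHyp φ) {P} (hP : Atom P) : Atom (φ P) := by
  obtain ⟨h1, h2, h3⟩ := hP
  refine ⟨(H.idem P).mp h1, by rwa [Ne, H.zero], ?_⟩
  intro Q' hQ' hQ0' hle
  obtain ⟨Q, hQ, hQ0, rfl⟩ := H.exP hQ' hQ0'
  have := h3 Q hQ hQ0 (by
    intro R hR hRP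
    have := hle _ ((H.idem' R).mp hR) ((H.orth h1 hR).mp hRP.symm).symm
    exact ((H.orth hQ hR).mpr this.symm).symm)
  intro R' hR' hRQ'
  obtain ⟨R, hR, rfl⟩ := H.exM' hR'
  have h5 := this R hR ((H.orth hQ hR).mpr hRQ'.symm).symm
  exact ((H.orth h1 hR).mp h5.symm).symm

lemma atom' (H : NHyp φ) {P} (hP : Atom (φ P)) : Atom P := by
  obtain ⟨h1, h2, h3⟩ := hP
  rw [← H.idem] at h1
  rw [Ne, H.zero] at h2
  refine ⟨h1, h2, ?_⟩
  intro Q hQ hQ0 hle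
  have := h3 (φ Q) ((H.idem Q).mp hQ) (by rwa [Ne, H.zero]) (by
    intro R' hR' hRP'
    obtain ⟨R, hR, rfl⟩ := H.exM' hR'
    have h5 := hle R hR ((H.orth h1 hR).mpr hRP'.symm).symm
    exact ((H.orth hQ hR).mp h5.symm).symm)
  intro R hR hRQ
  have := this _ ((H.idem' R).mp hR) ((H.orth hQ hR).mp hRQ.symm).symm
  exact ((H.orth h1 hR).mpr this.symm).symm

lemma neg_rk (H : NHyp φ) {x : X} {f : X →L[ℂ] ℂ} (h : f x = 1) : φ (- rk x f) = - φ (rk x f) := by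
  obtain ⟨x1, f1, hfx1, e1⟩ := atom_exists (H.atom (atom_rk h))
  obtain ⟨x2, f2, hfx2, e2⟩ := atom_exists (H.flip.atom (atom_rk h))
  have key : ∀ (z : X) (k : X →L[ℂ] ℂ), k z = 1 → f2 z = 0 → k x2 = 0 →
      (k x1 * f1 z = 1) ∨ (f1 z = 0 ∧ k x1 = 0) := by
    intro z k hkz hfz hkx
    obtain ⟨R, hR, hR0, hRe⟩ := H.exP (rk_idem hkz) (rk_ne_zero hkz)
    have o1 : Orth (φ R) (-φ (-rk x f)) := by
      rw [hRe, e2]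
      constructor <;> ext w <;> simp [hfz, hkx]
    rw [← H.orth hR (rk_idem h)] at o1
    have r := (H.rel _ _).mp (Rel_of_orth o1.symm)
    rw [hRe, e1, RL _ hkz] at r
    have hx1 : x1 ≠ 0 := by rintro rfl; simp at hfx1
    rcases r with ⟨r, -⟩ | ⟨r1, r2⟩
    · left; simpa [mul_comm] using r
    · right
      simp [hx1] at r1
      refine ⟨r1, ?_⟩
      have := r2 x1
      simpa [hfx1] using this
  have hx2 : x2 ≠ 0 := by rintro rfl; simp at hfx2
  have hf : ∀ z, f2 z = 0 → f1 z = 0 := by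
    intro z hz
    by_contra hz1
    have hmem : ∀ z, f2 z = 0 → f1 z = 1 → ∃ c : ℂ, x1 - z = c • x2 := by
      intro z hz hz1
      have hz0 : z ∉ Submodule.span ℂ {x2} := by
        intro hm
        obtain ⟨c, rfl⟩ := Submodule.mem_span_singleton.mp hm
        simp [hfx2] at hz
        rw [hz] at hz1; simp at hz1
      obtain ⟨k0, hk0, hk0z⟩ := HBV _ hz0
      have hk02 := hk0 _ (Submodule.mem_span_singleton_self x2)
      have k1 : ∀ k : X →L[ℂ] ℂ, k z = 1 → k x2 = 0 → k x1 = 1 := by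
        intro k a b
        rcases key z k a hz b with h | h
        · rwa [hz1, mul_one] at h
        · rw [hz1] at h; simp at h
      refine mem_span_singleton_of_dual fun k hk => ?_
      have a := k1 k0 hk0z hk02
      have b := k1 (k0 + k - (k z) • k0) (by simp [hk0z]) (by simp [hk02, hk])
      simp [a] at b
      rw [map_sub]
      linear_combination b
    have hz3 : ∃ w, f2 w = 0 ∧ w ∉ Submodule.span ℂ {z} := exists_ker_notMem H.inf f2 _
    obtain ⟨w0, hw0, hw0z⟩ := hz3
    obtain ⟨w, hw2, hw1, hwne⟩ : ∃ w, f2 w = 0 ∧ f1 w = 0 ∧ w ≠ 0 := by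
      refine ⟨w0 - (f1 w0 * (f1 z)⁻¹) • z, by simp [hw0, hz], by simp [hz1], ?_⟩
      intro h0
      exact hw0z (Submodule.mem_span_singleton.mpr ⟨_, (sub_eq_zero.mp h0).symm⟩)
    obtain ⟨c, hc⟩ := hmem ((f1 z)⁻¹ • z) (by simp [hz]) (by simp [hz1])
    obtain ⟨d, hd⟩ := hmem ((f1 z)⁻¹ • z + w) (by simp [hz, hw2]) (by simp [hz1, hw1])
    have e : w = (c - d) • x2 := by
      rw [sub_smul, ← hc, ← hd]; abel
    have := congrArg f2 e
    rw [hw2, map_smul, hfx2, smul_eq_mul, mul_one] at this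
    rw [← this, zero_smul] at e
    exact hwne e
  have hx : ∃ c : ℂ, x1 = c • x2 := by
    refine mem_span_singleton_of_dual fun k hk => ?_
    by_cases hk0 : k = 0
    · simp [hk0]
    obtain ⟨z, hz⟩ := exists_one_of_ne hk0
    have hf2 : f2 (z - f2 z • x2) = 0 := by simp [hfx2]
    rcases key (z - f2 z • x2) k (by simp [hz, hk]) hf2 hk with h | h
    · rw [hf _ hf2] at h; simp at h
    · exact h.2
  obtain ⟨c, rfl⟩ := hx
  rw [map_smul, smul_eq_mul] at hfx1
  have hf' : ∀ z, f1 z = f2 z * f1 x2 := by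
    intro z
    have := hf (z - f2 z • x2) (by simp [hfx2])
    simpa [sub_eq_zero] using this
  have : φ (rk x f) = - φ (- rk x f) := by
    rw [e1, e2]
    ext z
    simp only [rk_apply, hf' z, smul_smul]
    congr 1
    linear_combination f2 z * hfx1
  rw [this, neg_neg]

end NHyp

end JP


namespace JP

variable {X : Type*} [NormedAddCommGroup X] [NormedSpace ℂ X]
variable {φ : (X →L[ℂ] X) → (X →L[ℂ] X)}

/-- parallel vectors -/
def Par {E : Type*} [AddCommGroup E] [Module ℂ E] (u v : E) : Prop := ∃ c : ℂ, c ≠ 0 ∧ u = c • v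

section
variable {E : Type*} [AddCommGroup E] [Module ℂ E]
lemma Par.refl (u : E) : Par u u := ⟨1, one_ne_zero, by simp⟩
lemma Par.symm {u v : E} (h : Par u v) : Par v u := by
  obtain ⟨c, hc, rfl⟩ := h
  exact ⟨c⁻¹, inv_ne_zero hc, by rw [smul_smul, inv_mul_cancel₀ hc, one_smul]⟩
lemma Par.trans {u v w : E} (h : Par u v) (h' : Par v w) : Par u w := by
  obtain ⟨c, hc, rfl⟩ := h
  obtain ⟨d, hd, rfl⟩ := h'
  exact ⟨c * d, mul_ne_zero hc hd, by rw [smul_smul]⟩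
end

/-- abstract type dichotomy -/
lemma dichotomy {D : Type*} (rx rf ra rb : D → D → Prop)
    (ex : Equivalence rx) (ef : Equivalence rf) (ea : Equivalence ra) (eb : Equivalence rb)
    (hadj : ∀ p q, (rx p q ∨ rf p q) ↔ (ra p q ∨ rb p q))
    (hconn : ∀ p q, ∃ p' q', rx p p' ∧ rf p' q' ∧ rx q' q)
    (hnd : ∀ p, ∃ q r, rf p q ∧ rx p r ∧ ¬ (rx q r ∨ rf q r)) :
    ((∀ p q, rx p q → ra p q) ∧ (∀ p q, rf p q → rb p q)) ∨
    ((∀ p q, rx p q → rb p q) ∧ (∀ p q, rf p q → ra p q)) := by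
  have clique : ∀ (r a b : D → D → Prop), Equivalence r → Equivalence a → Equivalence b →
      (∀ p q, r p q → a p q ∨ b p q) → ∀ p, (∀ q, r p q → a p q) ∨ (∀ q, r p q → b p q) := by
    intro r a b er ea eb h p
    by_contra hcon
    push Not at hcon
    obtain ⟨⟨q, hq, hqa⟩, ⟨q', hq', hqb⟩⟩ := hcon
    have b1 := (h _ _ hq).resolve_left hqa
    have a1 := (h _ _ hq').resolve_right hqb
    rcases h q q' (er.trans (er.symm hq) hq') with h1 | h1
    · exact hqa (ea.trans a1 (ea.symm h1))
    · exact hqb (eb.trans b1 h1)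
  have cx := clique rx ra rb ex ea eb (fun p q h => (hadj p q).mp (Or.inl h))
  have cf := clique rf ra rb ef ea eb (fun p q h => (hadj p q).mp (Or.inr h))
  -- same-type exclusion
  have noA : ∀ p, (∀ q, rx p q → ra p q) → ¬ (∀ q, rf p q → ra p q) := by
    intro p h1 h2
    obtain ⟨q, r, hq, hr, hn⟩ := hnd p
    exact hn ((hadj q r).mpr (Or.inl (ea.trans (ea.symm (h2 q hq)) (h1 r hr))))
  have noB : ∀ p, (∀ q, rx p q → rb p q) → ¬ (∀ q, rf p q → rb p q) := by
    intro p h1 h2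
    obtain ⟨q, r, hq, hr, hn⟩ := hnd p
    exact hn ((hadj q r).mpr (Or.inr (eb.trans (eb.symm (h2 q hq)) (h1 r hr))))
  have trx : ∀ (a : D → D → Prop), Equivalence a → ∀ p p', rx p p' → (∀ q, rx p q → a p q) → ∀ q, rx p' q → a p' q :=
    fun a ea p p' h h1 q hq => ea.trans (ea.symm (h1 p' h)) (h1 q (ex.trans h hq))
  have trf : ∀ (a : D → D → Prop), Equivalence a → ∀ p p', rf p p' → (∀ q, rf p q → a p q) → ∀ q, rf p' q → a p' q :=
    fun a ea p p' h h1 q hq => ea.trans (ea.symm (h1 p' h)) (h1 q (ef.trans h hq))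
  have propA : ∀ p, (∀ q, rx p q → ra p q) → ∀ p', (∀ q, rx p' q → ra p' q) := by
    intro p hp q
    obtain ⟨p', q', h1, h2, h3⟩ := hconn p q
    have a1 := trx ra ea _ _ h1 hp
    have a2 := (cf p').resolve_left (noA p' a1)
    have a3 := trf rb eb _ _ h2 a2
    have a4 := (cx q').resolve_right (fun h => noB q' h a3)
    exact trx ra ea _ _ h3 a4
  by_cases hA : ∃ p, ∀ q, rx p q → ra p q
  · obtain ⟨p, hp⟩ := hA
    left
    refine ⟨fun p' q h => propA p hp p' q h, fun p' => (cf p').resolve_left (noA p' (propA p hp p'))⟩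
  · push Not at hA
    right
    have hB : ∀ p, ∀ q, rx p q → rb p q := fun p => (cx p).resolve_left (fun h => by
      obtain ⟨q, h1, h2⟩ := hA p; exact h2 (h q h1))
    exact ⟨hB, fun p => (cf p).resolve_right (noB p (hB p))⟩

/-- pairs with `f x = 1` -/
abbrev Dp (X : Type*) [NormedAddCommGroup X] [NormedSpace ℂ X] := {p : X × (X →L[ℂ] ℂ) // p.2 p.1 = 1}

lemma Dp.x_ne (p : Dp X) : p.1.1 ≠ 0 := by
  intro h
  have := p.2
  rw [h, map_zero] at this
  exact zero_ne_one this

lemma Dp.f_ne (p : Dp X) : p.1.2 ≠ 0 := by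
  intro h
  have := p.2
  rw [h] at this
  simp at this

/-- the rank one projection of a pair -/
noncomputable def pj (p : Dp X) : X →L[ℂ] X := rk p.1.1 p.1.2

lemma pj_orth (p q : Dp X) : Orth (pj p) (pj q) ↔ p.1.2 q.1.1 = 0 ∧ q.1.2 p.1.1 = 0 := by
  constructor
  · rintro ⟨h1, h2⟩
    constructor
    · have := congrArg (fun T : X →L[ℂ] X => p.1.2 (T q.1.1)) h1
      simpa [pj, p.2, q.2] using this
    · have := congrArg (fun T : X →L[ℂ] X => q.1.2 (T p.1.1)) h2
      simpa [pj, p.2, q.2] using this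
  · rintro ⟨h1, h2⟩
    constructor <;> ext z <;> simp [pj, h1, h2]

lemma pj_adj (p q : Dp X) : (Rel (pj p) (pj q) ∧ ¬ Orth (pj p) (pj q)) ↔
    (Par p.1.1 q.1.1 ∨ Par p.1.2 q.1.2) := by
  obtain ⟨⟨x, f⟩, hfx⟩ := p
  obtain ⟨⟨y, g⟩, hgy⟩ := q
  rw [pj_orth]
  simp only [pj] at *
  rw [RL _ hgy]
  constructor
  · rintro ⟨h1, h2⟩
    rcases h1 with ⟨h1, h3⟩ | ⟨h1, h3⟩
    · simp only [rk_apply, map_smul, smul_eq_mul] at h1 h3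
      have hf : f y ≠ 0 := left_ne_zero_of_mul_eq_one h1
      have hg : g x ≠ 0 := right_ne_zero_of_mul_eq_one h1
      rcases h3 with h3 | h3
      · left; exact Par.symm ⟨_, hf, h3.symm⟩
      · right
        refine Par.symm ⟨_, hg, ?_⟩
        ext z
        rw [← h3 z]; simp [mul_comm]
    · exfalso
      apply h2
      constructor
      · have := congrArg f h1
        simpa [hfx] using this
      · have := h3 x
        simpa [hfx] using this
  · rintro (⟨c, hc, rfl⟩ | ⟨c, hc, rfl⟩)
    · rw [map_smul, smul_eq_mul] at hfx
      have hfy : f y ≠ 0 := right_ne_zero_of_mul_eq_one hfx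
      refine ⟨Or.inl ⟨?_, Or.inl ?_⟩, fun h => hfy h.1⟩
      · simp [hgy]; linear_combination hfx
      · simp [smul_smul]; rw [mul_comm, hfx, one_smul]
    · have hfx : c * g x = 1 := hfx
      have hfy : g x ≠ 0 := right_ne_zero_of_mul_eq_one hfx
      refine ⟨Or.inl ⟨?_, Or.inr ?_⟩, fun h => hfy h.2⟩
      · simp [hgy]; exact hfx
      · intro z; simp; linear_combination g z * hfx

lemma pj_eq {p q : Dp X} (h : pj p = pj q) : Par p.1.1 q.1.1 ∧ Par p.1.2 q.1.2 := by
  have h1 : ∀ z, p.1.2 z • p.1.1 = q.1.2 z • q.1.1 := fun z => by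
    have := congrArg (fun T : X →L[ℂ] X => T z) h
    simpa [pj] using this
  have h2 := h1 p.1.1
  rw [p.2, one_smul] at h2
  have hc : q.1.2 p.1.1 ≠ 0 := by
    intro h0; rw [h0, zero_smul] at h2; exact p.x_ne h2
  refine ⟨⟨_, hc, h2⟩, Par.symm ⟨_, hc, ?_⟩⟩
  ext z
  have := congrArg q.1.2 (h1 z)
  simp only [map_smul, smul_eq_mul, q.2, mul_one] at this
  rw [← this]
  simp [mul_comm]

/-- Result of the combinatorial part: a map on pairs. -/
structure MHyp (φ : (X →L[ℂ] X) → (X →L[ℂ] X)) (M : Dp X → Dp X) : Prop where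
  eq : ∀ p, φ (pj p) = pj (M p)
  eqm : ∀ p, φ (- pj p) = - pj (M p)
  surj : ∀ q : Dp X, ∃ p, Par q.1.1 (M p).1.1 ∧ Par q.1.2 (M p).1.2
  orth : ∀ p q : Dp X, (p.1.2 q.1.1 = 0 ∧ q.1.2 p.1.1 = 0) → (M p).1.2 (M q).1.1 = 0
  typ : ((∀ p q : Dp X, Par p.1.1 q.1.1 → Par (M p).1.1 (M q).1.1) ∧
          (∀ p q : Dp X, Par p.1.2 q.1.2 → Par (M p).1.2 (M q).1.2)) ∨
        ((∀ p q : Dp X, Par p.1.1 q.1.1 → Par (M p).1.2 (M q).1.2) ∧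
          (∀ p q : Dp X, Par p.1.2 q.1.2 → Par (M p).1.1 (M q).1.1))

lemma par_equiv {D E : Type*} [AddCommGroup E] [Module ℂ E] (g : D → E) : Equivalence (fun p q => Par (g p) (g q)) :=
  ⟨fun p => Par.refl _, fun h => h.symm, fun h h' => h.trans h'⟩

lemma NHyp.exM_map (H : NHyp φ) : ∃ M, MHyp φ M := by
  have : ∀ p : Dp X, ∃ q : Dp X, φ (pj p) = pj q := by
    intro p
    obtain ⟨x, f, h, e⟩ := atom_exists (H.atom (atom_rk p.2))
    exact ⟨⟨⟨x, f⟩, h⟩, e⟩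
  choose M hM using this
  have hMm : ∀ p, φ (- pj p) = - pj (M p) := fun p => by rw [pj, H.neg_rk p.2, ← hM]; rfl
  have horth : ∀ p q, Orth (pj p) (pj q) ↔ Orth (pj (M p)) (pj (M q)) := by
    intro p q
    rw [H.orth (P := pj p) (R := pj q) (rk_idem p.2) (rk_idem q.2), hM, hMm, neg_neg]
  have hadj : ∀ p q : Dp X, (Par p.1.1 q.1.1 ∨ Par p.1.2 q.1.2) ↔
      (Par (M p).1.1 (M q).1.1 ∨ Par (M p).1.2 (M q).1.2) := by
    intro p q
    rw [← pj_adj, ← pj_adj, ← horth, H.rel, hM, hM]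
  refine ⟨M, hM, hMm, ?_, ?_, ?_⟩
  · intro q
    obtain ⟨P, hP, hP0, e⟩ := H.exP (rk_idem q.2) (rk_ne_zero q.2)
    have hat : Atom P := H.atom' (by rw [e]; exact atom_rk q.2)
    obtain ⟨x, f, h, rfl⟩ := atom_exists hat
    refine ⟨⟨⟨x, f⟩, h⟩, pj_eq ?_⟩
    rw [← hM]
    exact e.symm
  · intro p q h
    exact ((pj_orth _ _).mp ((horth p q).mp ((pj_orth _ _).mpr h))).1
  · refine dichotomy (fun p q : Dp X => Par p.1.1 q.1.1) (fun p q => Par p.1.2 q.1.2)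
      (fun p q => Par (M p).1.1 (M q).1.1) (fun p q => Par (M p).1.2 (M q).1.2)
      (par_equiv _) (par_equiv _) (par_equiv _) (par_equiv _) hadj ?_ ?_
    · intro p q
      obtain ⟨h, h1, h2⟩ := exists_common p.x_ne q.x_ne
      refine ⟨⟨⟨p.1.1, h⟩, h1⟩, ⟨⟨(h q.1.1)⁻¹ • q.1.1, h⟩, by simp [h2]⟩, Par.refl _, Par.refl _, ?_⟩
      exact ⟨_, inv_ne_zero h2, rfl⟩
    · rintro ⟨⟨x, f⟩, hfx⟩
      have hfx : f x = 1 := hfx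
      obtain ⟨v, hv, hvx⟩ := exists_ker_notMem H.inf f (Submodule.span ℂ {x})
      obtain ⟨k, hk, hkv⟩ := HBV _ hvx
      have hkx := hk x (Submodule.mem_span_singleton_self x)
      refine ⟨⟨⟨x + v, f⟩, by simp [hfx, hv]⟩, ⟨⟨x, f + k⟩, by simp [hfx, hkx]⟩, Par.refl _, Par.refl _, ?_⟩
      rintro (⟨c, hc, h⟩ | ⟨c, hc, h⟩)
      · have := congrArg k h
        simp [hkx, hkv] at this
      · have := congrArg (fun T : X →L[ℂ] ℂ => T v) h
        simp [hv, hkv] at this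
        exact hc this.symm

end JP


namespace JP

variable {X : Type*} [NormedAddCommGroup X] [NormedSpace ℂ X]
variable {E : Type*} [NormedAddCommGroup E] [NormedSpace ℂ E]

/-- A projective duality datum. -/
structure PHyp (W : Submodule ℂ (E →L[ℂ] ℂ)) (t : E → X) (s : (E →L[ℂ] ℂ) → (X →L[ℂ] ℂ)) : Prop where
  inf : ¬ FiniteDimensional ℂ E
  HB : ∀ V : Submodule ℂ E, V.FG → ∀ e, e ∉ V → ∃ f ∈ W, (∀ v ∈ V, f v = 0) ∧ f e = 1
  t0 : ∀ e, e ≠ 0 → t e ≠ 0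
  s0 : ∀ f ∈ W, f ≠ 0 → s f ≠ 0
  hz : ∀ e, e ≠ 0 → ∀ f ∈ W, f ≠ 0 → (f e = 0 ↔ s f (t e) = 0)
  tsurj : ∀ y, y ≠ 0 → ∃ e, e ≠ 0 ∧ Par y (t e)
  ssurj : ∀ g, g ≠ 0 → ∃ f ∈ W, f ≠ 0 ∧ Par g (s f)

namespace PHyp

variable {W : Submodule ℂ (E →L[ℂ] ℂ)} {t : E → X} {s : (E →L[ℂ] ℂ) → (X →L[ℂ] ℂ)}

lemma fg_pair {E : Type*} [AddCommGroup E] [Module ℂ E] (u v : E) : (Submodule.span ℂ ({u, v} : Set E)).FG :=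
  Submodule.fg_span (by simp)

lemma ne_of {f : E →L[ℂ] ℂ} {e : E} (h : f e = 1) : f ≠ 0 := by
  rintro rfl; simp at h

lemma ne_of' {f : E →L[ℂ] ℂ} {e : E} (h : f e = 1) : e ≠ 0 := by
  rintro rfl; simp at h

lemma S (H : PHyp W t s) {e u v : E} (he : e ≠ 0) (hu : u ≠ 0) (hv : v ≠ 0)
    (h : ∃ a b : ℂ, e = a • u + b • v) : ∃ a b : ℂ, t e = a • t u + b • t v := by
  refine mem_span_pair_of_dual fun k hku hkv => ?_
  by_cases hk : k = 0
  · simp [hk]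
  obtain ⟨f, hf, hf0, c, hc, rfl⟩ := H.ssurj k hk
  simp [hc] at hku hkv ⊢
  rw [← H.hz _ hu f hf hf0] at hku
  rw [← H.hz _ hv f hf hf0] at hkv
  rw [← H.hz _ he f hf hf0]
  obtain ⟨a, b, rfl⟩ := h
  simp [hku, hkv]

lemma I2 (H : PHyp W t s) {e u v : E} (he : e ≠ 0) (hu : u ≠ 0) (hv : v ≠ 0)
    (h : ∃ a b : ℂ, t e = a • t u + b • t v) : ∃ a b : ℂ, e = a • u + b • v := by
  by_contra hcon
  have hn : e ∉ Submodule.span ℂ ({u, v} : Set E) := by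
    intro hm
    rw [Submodule.mem_span_pair] at hm
    obtain ⟨a, b, h⟩ := hm
    exact hcon ⟨a, b, h.symm⟩
  obtain ⟨f, hf, hfV, hfe⟩ := H.HB _ (fg_pair u v) e hn
  have hu' := (H.hz _ hu f hf (ne_of hfe)).mp (hfV _ (Submodule.subset_span (by simp)))
  have hv' := (H.hz _ hv f hf (ne_of hfe)).mp (hfV _ (Submodule.subset_span (by simp)))
  obtain ⟨a, b, h⟩ := h
  have : f e = 0 := by
    rw [H.hz _ he f hf (ne_of hfe), h]; simp [hu', hv']
  rw [hfe] at this
  exact one_ne_zero this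

lemma S1 (H : PHyp W t s) {e : E} {c : ℂ} (he : e ≠ 0) (hc : c ≠ 0) : Par (t (c • e)) (t e) := by
  have hce : c • e ≠ 0 := smul_ne_zero hc he
  obtain ⟨a, b, h⟩ := H.S hce he he ⟨c, 0, by simp⟩
  rw [← add_smul] at h
  refine ⟨_, ?_, h⟩
  intro h0
  rw [h0, zero_smul] at h
  exact H.t0 _ hce h

lemma I1 (H : PHyp W t s) {e u : E} (he : e ≠ 0) (hu : u ≠ 0)
    (h : ∃ a : ℂ, t e = a • t u) : ∃ a : ℂ, e = a • u := by
  obtain ⟨a, h⟩ := h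
  obtain ⟨a, b, h⟩ := H.I2 he hu hu ⟨a, 0, by simp [h]⟩
  exact ⟨a + b, by rw [add_smul, h]⟩

lemma notMem_ker (H : PHyp W t s) (f : E →L[ℂ] ℂ) (u v : E) : ∃ z, f z = 0 ∧ ¬ ∃ a b : ℂ, z = a • u + b • v := by
  have : FiniteDimensional ℂ (Submodule.span ℂ ({u, v} : Set E)) := FiniteDimensional.span_of_finite ℂ (by simp)
  obtain ⟨z, h1, h2⟩ := exists_ker_notMem H.inf f (Submodule.span ℂ ({u, v} : Set E))
  refine ⟨z, h1, ?_⟩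
  rintro ⟨a, b, h⟩
  exact h2 (Submodule.mem_span_pair.mpr ⟨a, b, h.symm⟩)

/-- the normalised map -/
noncomputable def Tn (t : E → X) (g : X →L[ℂ] ℂ) (e : E) : X := (g (t e))⁻¹ • t e

/-- the additive part -/
noncomputable def L (t : E → X) (g : X →L[ℂ] ℂ) (x0 v : E) : X := Tn t g (x0 + v) - Tn t g x0

section

lemma Tn_one (H : PHyp W t s) {f0 : E →L[ℂ] ℂ} (hf0 : f0 ∈ W) {e : E} (he : f0 e ≠ 0) : s f0 (Tn t (s f0) e) = 1 := by
  have he0 : e ≠ 0 := by rintro rfl; simp at he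
  have hf : f0 ≠ 0 := by rintro rfl; simp at he
  have : s f0 (t e) ≠ 0 := fun h => he ((H.hz _ he0 f0 hf0 hf).mpr h)
  simp [Tn, this]

lemma Tn_par (H : PHyp W t s) {f0 : E →L[ℂ] ℂ} (hf0 : f0 ∈ W) {e : E} (he : f0 e ≠ 0) : Par (Tn t (s f0) e) (t e) := by
  have he0 : e ≠ 0 := by rintro rfl; simp at he
  have hf : f0 ≠ 0 := by rintro rfl; simp at he
  have : s f0 (t e) ≠ 0 := fun h => he ((H.hz _ he0 f0 hf0 hf).mpr h)
  exact ⟨_, inv_ne_zero this, rfl⟩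

/-- key affine relation -/
lemma Tn_rel (H : PHyp W t s) {f0 : E →L[ℂ] ℂ} (hf0 : f0 ∈ W) {e u v : E} (he : f0 e = 1) (hu : f0 u = 1) (hv : f0 v = 0) (hv0 : v ≠ 0)
    (h : ∃ a b : ℂ, e = a • u + b • v) : ∃ β : ℂ, Tn t (s f0) e = Tn t (s f0) u + β • t v := by
  have hf : f0 ≠ 0 := ne_of he
  obtain ⟨a, b, h⟩ := H.S (ne_of' he) (ne_of' hu) hv0 h
  obtain ⟨c, hc, h1⟩ := H.Tn_par hf0 (e := e) (by rw [he]; exact one_ne_zero)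
  obtain ⟨d, hd, h2⟩ := (H.Tn_par hf0 (e := u) (by rw [hu]; exact one_ne_zero)).symm
  have o1 := H.Tn_one hf0 (e := e) (by rw [he]; exact one_ne_zero)
  have o2 := H.Tn_one hf0 (e := u) (by rw [hu]; exact one_ne_zero)
  have o3 := (H.hz _ hv0 f0 hf0 hf).mp hv
  have e1 : Tn t (s f0) e = (c * a * d) • Tn t (s f0) u + (c * b) • t v := by
    rw [h1, h, h2]; module
  have := congrArg (s f0) e1
  simp [o1, o2, o3] at this
  refine ⟨c * b, ?_⟩
  rw [← this, one_smul] at e1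
  exact e1


lemma L_par (H : PHyp W t s) {x0 : E} {f0 : E →L[ℂ] ℂ} (hf0 : f0 ∈ W) (h01 : f0 x0 = 1)
    {v : E} (hv : f0 v = 0) (hv0 : v ≠ 0) : Par (L t (s f0) x0 v) (t v) := by
  have h1 : f0 (x0 + v) = 1 := by simp [h01, hv]
  obtain ⟨β, hβ⟩ := H.Tn_rel hf0 h1 h01 hv hv0 ⟨1, 1, by simp⟩
  refine ⟨β, ?_, ?_⟩
  · rintro rfl
    rw [zero_smul, add_zero] at hβ
    have p1 := (H.Tn_par hf0 (e := x0 + v) (by rw [h1]; exact one_ne_zero))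
    have p2 := (H.Tn_par hf0 (e := x0) (by rw [h01]; exact one_ne_zero))
    rw [hβ] at p1
    obtain ⟨c, -, hc⟩ := p1.symm.trans p2
    obtain ⟨a, ha⟩ := H.I1 (ne_of' h1) (ne_of' h01) ⟨c, hc⟩
    have := congrArg f0 ha
    rw [h1, map_smul, h01, smul_eq_mul, mul_one] at this
    rw [← this, one_smul] at ha
    exact hv0 (by simpa using ha)
  · rw [L, hβ]; simp

lemma L_zero (H : PHyp W t s) {x0 : E} {f0 : E →L[ℂ] ℂ} (hf0 : f0 ∈ W) (h01 : f0 x0 = 1)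
    : L t (s f0) x0 0 = 0 := by simp [L]

lemma L_indep (H : PHyp W t s) {x0 : E} {f0 : E →L[ℂ] ℂ} (hf0 : f0 ∈ W) (h01 : f0 x0 = 1)
    {v w : E} (hv : f0 v = 0) (hv0 : v ≠ 0) (hw : f0 w = 0) (hw0 : w ≠ 0)
    (hi : ¬ ∃ a : ℂ, w = a • v) {α β : ℂ} (h : α • L t (s f0) x0 v + β • L t (s f0) x0 w = 0) :
    α = 0 ∧ β = 0 := by
  obtain ⟨c, hc, h1⟩ := H.L_par hf0 h01 hv hv0
  obtain ⟨d, hd, h2⟩ := H.L_par hf0 h01 hw hw0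
  rw [h1, h2, smul_smul, smul_smul] at h
  have hβ : β = 0 := by
    by_contra hβ
    apply hi
    apply H.I1 hw0 hv0
    have hb : β * d ≠ 0 := mul_ne_zero hβ hd
    refine ⟨-((β * d)⁻¹ * (α * c)), ?_⟩
    have := congrArg (fun z => (β * d)⁻¹ • z) h
    simp only [smul_add, smul_smul, smul_zero, inv_mul_cancel₀ hb, one_smul] at this
    rw [neg_smul, ← add_eq_zero_iff_eq_neg, add_comm]; exact this
  refine ⟨?_, hβ⟩
  rw [hβ, zero_mul, zero_smul, add_zero] at h
  have := (smul_eq_zero.mp h).resolve_right (H.t0 _ hv0)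
  exact (mul_eq_zero.mp this).resolve_right hc

lemma L_add_indep (H : PHyp W t s) {x0 : E} {f0 : E →L[ℂ] ℂ} (hf0 : f0 ∈ W) (h01 : f0 x0 = 1)
    {v w : E} (hv : f0 v = 0) (hv0 : v ≠ 0) (hw : f0 w = 0) (hw0 : w ≠ 0)
    (hi : ¬ ∃ a : ℂ, w = a • v) : L t (s f0) x0 (v + w) = L t (s f0) x0 v + L t (s f0) x0 w := by
  have h1 : f0 (x0 + v) = 1 := by simp [h01, hv]
  have h2 : f0 (x0 + w) = 1 := by simp [h01, hw]
  have h3 : f0 (x0 + (v + w)) = 1 := by simp [h01, hv, hw]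
  obtain ⟨β, hβ⟩ := H.Tn_rel hf0 h3 h1 hw hw0 ⟨1, 1, by simp; abel⟩
  obtain ⟨γ, hγ⟩ := H.Tn_rel hf0 h3 h2 hv hv0 ⟨1, 1, by simp; abel⟩
  obtain ⟨c, hc, e1⟩ := (H.L_par hf0 h01 hv hv0).symm
  obtain ⟨d, hd, e2⟩ := (H.L_par hf0 h01 hw hw0).symm
  have a1 : L t (s f0) x0 (v + w) = L t (s f0) x0 v + (β * d) • L t (s f0) x0 w := by
    conv_lhs => rw [L, hβ, e2]
    rw [smul_smul]
    conv_rhs => rw [L]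
    abel
  have a2 : L t (s f0) x0 (v + w) = L t (s f0) x0 w + (γ * c) • L t (s f0) x0 v := by
    conv_lhs => rw [L, hγ, e1]
    rw [smul_smul]
    conv_rhs => rw [L]
    abel
  have := (H.L_indep hf0 h01 hv hv0 hw hw0 hi (α := 1 - γ * c) (β := β * d - 1) (by
    have : L t (s f0) x0 v + (β * d) • L t (s f0) x0 w - (L t (s f0) x0 w + (γ * c) • L t (s f0) x0 v) = 0 := by
      rw [← a1, ← a2, sub_self]
    rw [← this]; module)).2
  rw [a1, sub_eq_zero.mp this, one_smul]

lemma L_add (H : PHyp W t s) {x0 : E} {f0 : E →L[ℂ] ℂ} (hf0 : f0 ∈ W) (h01 : f0 x0 = 1)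
    {v w : E} (hv : f0 v = 0) (hw : f0 w = 0) :
    L t (s f0) x0 (v + w) = L t (s f0) x0 v + L t (s f0) x0 w := by
  by_cases hv0 : v = 0
  · simp [hv0, H.L_zero hf0 h01]
  by_cases hw0 : w = 0
  · simp [hw0, H.L_zero hf0 h01]
  by_cases hi : ∃ a : ℂ, w = a • v
  swap
  · exact H.L_add_indep hf0 h01 hv hv0 hw hw0 hi
  obtain ⟨u, hu, hun⟩ := H.notMem_ker f0 v v
  have hu1 : ∀ a : ℂ, u ≠ a • v := fun a h => hun ⟨a, 0, by simp [h]⟩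
  have hu0 : u ≠ 0 := fun h => hu1 0 (by simp [h])
  obtain ⟨c, rfl⟩ := hi
  have hc : c ≠ 0 := by rintro rfl; simp at hw0
  have b1 : L t (s f0) x0 (c • v + u) = L t (s f0) x0 (c • v) + L t (s f0) x0 u := by
    refine H.L_add_indep hf0 h01 hw hw0 hu hu0 ?_
    rintro ⟨a, h⟩
    exact hu1 (a * c) (by rw [h, smul_smul])
  have b2 : L t (s f0) x0 (v + (c • v + u)) = L t (s f0) x0 v + L t (s f0) x0 (c • v + u) := by
    refine H.L_add_indep hf0 h01 hv hv0 (by simp [hv, hu]) ?_ ?_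
    · intro h
      exact hu1 (-c) (by rw [neg_smul, ← add_eq_zero_iff_eq_neg, add_comm]; exact h)
    · rintro ⟨a, h⟩
      exact hu1 (a - c) (by rw [sub_smul, ← h]; abel)
  have b3 : L t (s f0) x0 ((v + c • v) + u) = L t (s f0) x0 (v + c • v) + L t (s f0) x0 u := by
    by_cases h0 : v + c • v = 0
    · rw [h0, zero_add, H.L_zero hf0 h01, zero_add]
    refine H.L_add_indep hf0 h01 (by simp [hv]) h0 hu hu0 ?_
    rintro ⟨a, h⟩
    exact hu1 (a * (1 + c)) (by rw [h]; module)
  rw [add_assoc, b2, b1, ← add_assoc] at b3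
  exact (add_right_cancel b3).symm

lemma L_smul_ex (H : PHyp W t s) {x0 : E} {f0 : E →L[ℂ] ℂ} (hf0 : f0 ∈ W) (h01 : f0 x0 = 1)
    {v : E} (hv : f0 v = 0) (hv0 : v ≠ 0) (c : ℂ) : ∃ d : ℂ, L t (s f0) x0 (c • v) = d • L t (s f0) x0 v := by
  by_cases hc : c = 0
  · exact ⟨0, by simp [hc, H.L_zero hf0 h01]⟩
  have p1 := H.L_par hf0 h01 (v := c • v) (by simp [hv]) (smul_ne_zero hc hv0)
  have p2 := H.L_par hf0 h01 hv hv0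
  obtain ⟨d, -, h⟩ := (p1.trans (H.S1 hv0 hc)).trans p2.symm
  exact ⟨d, h⟩

lemma L_smul_indep (H : PHyp W t s) {x0 : E} {f0 : E →L[ℂ] ℂ} (hf0 : f0 ∈ W) (h01 : f0 x0 = 1)
    {v w : E} (hv : f0 v = 0) (hv0 : v ≠ 0) (hw : f0 w = 0) (hw0 : w ≠ 0)
    (hi : ¬ ∃ a : ℂ, w = a • v) {c d d' : ℂ} (h1 : L t (s f0) x0 (c • v) = d • L t (s f0) x0 v)
    (h2 : L t (s f0) x0 (c • w) = d' • L t (s f0) x0 w) : d = d' := by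
  have hvw : v + w ≠ 0 := by
    intro h; apply hi; exact ⟨-1, by simp; rw [← add_eq_zero_iff_eq_neg, add_comm]; exact h⟩
  obtain ⟨d'', h3⟩ := H.L_smul_ex hf0 h01 (v := v + w) (by simp [hv, hw]) hvw c
  rw [smul_add, H.L_add hf0 h01 (by simp [hv]) (by simp [hw]), H.L_add hf0 h01 hv hw, h1, h2] at h3
  obtain ⟨a, b⟩ := H.L_indep hf0 h01 hv hv0 hw hw0 hi (α := d - d'') (β := d' - d'') (by
    have := sub_eq_zero.mpr h3
    rw [← this]; module)
  linear_combination a - b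

lemma L_ne (H : PHyp W t s) {x0 : E} {f0 : E →L[ℂ] ℂ} (hf0 : f0 ∈ W) (h01 : f0 x0 = 1)
    {v : E} (hv : f0 v = 0) (hv0 : v ≠ 0) : L t (s f0) x0 v ≠ 0 := by
  obtain ⟨c, hc, h⟩ := H.L_par hf0 h01 hv hv0
  rw [h]
  exact smul_ne_zero hc (H.t0 _ hv0)

lemma exists_tau (H : PHyp W t s) {x0 : E} {f0 : E →L[ℂ] ℂ} (hf0 : f0 ∈ W) (h01 : f0 x0 = 1)
    : ∃ τ : ℂ →+* ℂ, ∀ c v, f0 v = 0 → L t (s f0) x0 (c • v) = τ c • L t (s f0) x0 v := by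
  obtain ⟨v0, hv, hv00⟩ := H.notMem_ker f0 x0 x0
  have hv0 : v0 ≠ 0 := fun h => hv00 ⟨0, 0, by simp [h]⟩
  choose τ hτ using H.L_smul_ex hf0 h01 hv hv0
  have hall : ∀ c v, f0 v = 0 → L t (s f0) x0 (c • v) = τ c • L t (s f0) x0 v := by
    intro c v hfv
    by_cases hv0' : v = 0
    · simp [hv0', H.L_zero hf0 h01]
    obtain ⟨d, hd⟩ := H.L_smul_ex hf0 h01 hfv hv0' c
    obtain ⟨u, hu, hun⟩ := H.notMem_ker f0 v v0
    have hu0 : u ≠ 0 := fun h => hun ⟨0, 0, by simp [h]⟩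
    obtain ⟨d', hd'⟩ := H.L_smul_ex hf0 h01 hu hu0 c
    have a1 := H.L_smul_indep hf0 h01 hfv hv0' hu hu0 (fun ⟨a, h⟩ => hun ⟨a, 0, by simp [h]⟩) hd hd'
    have a2 := H.L_smul_indep hf0 h01 hv hv0 hu hu0 (fun ⟨a, h⟩ => hun ⟨0, a, by simp [h]⟩) (hτ c) hd'
    rw [hd, a1, a2]
  have hL := H.L_ne hf0 h01 hv hv0
  refine ⟨{ toFun := τ, map_one' := ?_, map_mul' := ?_, map_zero' := ?_, map_add' := ?_ }, hall⟩
  · apply smul_left_injective ℂ hL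
    simp only
    rw [← hτ, one_smul, one_smul]
  · intro a b
    apply smul_left_injective ℂ hL
    simp only
    rw [← hτ, mul_smul, mul_smul, hall a (b • v0) (by simp [hv]), hτ]
  · apply smul_left_injective ℂ hL
    simp only
    rw [← hτ, zero_smul, zero_smul, H.L_zero hf0 h01]
  · intro a b
    apply smul_left_injective ℂ hL
    simp only
    rw [← hτ, add_smul, add_smul, H.L_add hf0 h01 (by simp [hv]) (by simp [hv]), hτ, hτ]

end

lemma exists_ne (H : PHyp W t s) (V : Submodule ℂ E) (hV : V.FG) : ∃ e, e ∉ V := by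
  by_contra hcon
  push Not at hcon
  apply H.inf
  have : V = ⊤ := by ext e; simp [hcon e]
  rw [this] at hV
  exact ⟨hV⟩

theorem exists_T (H : PHyp W t s) : ∃ (τ : ℂ →+* ℂ) (T : E →ₛₗ[τ] X),
    (∀ e, e ≠ 0 → Par (T e) (t e)) ∧
    (∀ f ∈ W, f ≠ 0 → ∃ c : ℂ, c ≠ 0 ∧ ∀ e, c * s f (T e) = τ (f e)) := by
  obtain ⟨x0, hx0⟩ := H.exists_ne ⊥ Submodule.fg_bot
  obtain ⟨f0, hf0, -, h01⟩ := H.HB ⊥ Submodule.fg_bot x0 hx0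
  obtain ⟨τ, hτ⟩ := H.exists_tau hf0 h01
  have hk : ∀ e, f0 (e - f0 e • x0) = 0 := fun e => by simp [h01]
  let T : E →ₛₗ[τ] X :=
    { toFun := fun e => L t (s f0) x0 (e - f0 e • x0) + τ (f0 e) • Tn t (s f0) x0
      map_add' := by
        intro u v
        have : u + v - f0 (u + v) • x0 = (u - f0 u • x0) + (v - f0 v • x0) := by
          rw [map_add]; module
        rw [this, H.L_add hf0 h01 (hk u) (hk v), map_add, map_add]
        module
      map_smul' := by
        intro c u
        have : c • u - f0 (c • u) • x0 = c • (u - f0 u • x0) := by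
          rw [map_smul, smul_eq_mul]; module
        rw [this, hτ c _ (hk u), map_smul, smul_eq_mul, map_mul]
        module }
  have hTd : ∀ e, T e = L t (s f0) x0 (e - f0 e • x0) + τ (f0 e) • Tn t (s f0) x0 := fun e => rfl
  have hpar : ∀ e, e ≠ 0 → Par (T e) (t e) := by
    intro e he
    by_cases h0 : f0 e = 0
    · rw [hTd, h0]
      simp only [zero_smul, sub_zero, map_zero, add_zero]
      exact H.L_par hf0 h01 h0 he
    · have h1 : f0 ((f0 e)⁻¹ • e) = 1 := by simp [h0]
      have e1 : T ((f0 e)⁻¹ • e) = Tn t (s f0) ((f0 e)⁻¹ • e) := by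
        rw [hTd, h1, L]; simp
      have p1 : Par (T ((f0 e)⁻¹ • e)) (t e) := by
        rw [e1]
        exact (H.Tn_par hf0 (by rw [h1]; exact one_ne_zero)).trans (H.S1 he (inv_ne_zero h0))
      rw [map_smulₛₗ] at p1
      refine Par.trans ?_ p1
      have : τ ((f0 e)⁻¹) ≠ 0 := by simpa using h0
      exact Par.symm ⟨_, this, rfl⟩
  refine ⟨τ, T, hpar, ?_⟩
  intro f hf hfne
  have hz : ∀ e, f e = 0 → s f (T e) = 0 := by
    intro e he
    by_cases he0 : e = 0
    · simp [he0]
    obtain ⟨c, hc, h⟩ := hpar e he0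
    rw [h, map_smul, (H.hz _ he0 f hf hfne).mp he, smul_zero]
  obtain ⟨e1, he1⟩ := exists_one_of_ne hfne
  have hs1 : s f (T e1) ≠ 0 := by
    obtain ⟨c, hc, h⟩ := hpar e1 (ne_of' he1)
    rw [h, map_smul]
    refine smul_ne_zero hc fun h => ?_
    rw [← H.hz _ (ne_of' he1) f hf hfne, he1] at h
    exact one_ne_zero h
  refine ⟨_, inv_ne_zero hs1, fun e => ?_⟩
  have := hz (e - f e • e1) (by simp [he1])
  rw [map_sub, map_smulₛₗ, map_sub, sub_eq_zero, map_smul] at this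
  rw [this, smul_eq_mul]
  field_simp

end PHyp
end JP


namespace JP

variable {X : Type*} [NormedAddCommGroup X] [NormedSpace ℂ X]
variable {E : Type*} [NormedAddCommGroup E] [NormedSpace ℂ E]

lemma exists_iInf_ker_notMem (hinf : ¬ FiniteDimensional ℂ E) (F : Finset (E →L[ℂ] ℂ)) (V : Submodule ℂ E)
    (hV : V.FG) : ∃ z, (∀ f ∈ F, f z = 0) ∧ z ∉ V := by
  by_contra hcon
  push Not at hcon
  apply hinf
  have hVf : FiniteDimensional ℂ V := Module.Finite.iff_fg.mpr hV
  let Φ : E →ₗ[ℂ] (F → ℂ) := LinearMap.pi (fun f => ((f : E →L[ℂ] ℂ) : E →ₗ[ℂ] ℂ))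
  have hle : (⊤ ⊓ LinearMap.ker Φ) ≤ V := by
    rintro z ⟨-, hz⟩
    apply hcon
    intro f hf
    have hz : Φ z = 0 := hz
    exact congrFun hz ⟨f, hf⟩
  have h1 : (⊤ ⊓ LinearMap.ker Φ).FG := by
    have := Submodule.finiteDimensional_of_le hle
    exact Module.Finite.iff_fg.mp this
  have h2 : (Submodule.map Φ ⊤).FG := Module.Finite.iff_fg.mp inferInstance
  exact ⟨Submodule.fg_of_fg_map_of_fg_inf_ker Φ h2 h1⟩

lemma mkCLE {σ : ℂ →+* ℂ} [RingHomInvPair σ σ] [RingHomIsometric σ] [CompleteSpace E] [CompleteSpace X]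
    (T : E →ₛₗ[σ] X) (hc : Continuous T) (hi : Function.Injective T) (hs : Function.Surjective T) :
    ∃ T' : E ≃SL[σ] X, ∀ e, T' e = T e := by
  let T1 : E →SL[σ] X := ⟨T, hc⟩
  refine ⟨ContinuousLinearEquiv.ofBijective T1 (LinearMap.ker_eq_bot.mpr hi) (LinearMap.range_eq_top.mpr hs), fun e => ?_⟩
  rw [ContinuousLinearEquiv.coeFn_ofBijective]; rfl

namespace PHyp

variable {W : Submodule ℂ (E →L[ℂ] ℂ)} {t : E → X} {s : (E →L[ℂ] ℂ) → (X →L[ℂ] ℂ)}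

lemma biorth_seq (H : PHyp W t s) : ∃ p : ℕ → E × (E →L[ℂ] ℂ),
    (∀ n, (p n).2 ∈ W ∧ (p n).2 (p n).1 = 1) ∧ ∀ m n, m ≠ n → (p m).2 (p n).1 = 0 := by
  classical
  obtain ⟨p, h1, h2⟩ := exists_seq_of_forall_finset_exists
    (fun p : E × (E →L[ℂ] ℂ) => p.2 ∈ W ∧ p.2 p.1 = 1) (fun p q => p.2 q.1 = 0 ∧ q.2 p.1 = 0) (by
    intro S hS
    obtain ⟨V, hVd⟩ : ∃ V, V = Submodule.span ℂ ((S.image Prod.fst : Finset E) : Set E) := ⟨_, rfl⟩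
    have hV : V.FG := ⟨_, hVd.symm⟩
    obtain ⟨z, hz1, hz2⟩ := exists_iInf_ker_notMem H.inf (S.image Prod.snd) V hV
    obtain ⟨f, hf, hfV, hfz⟩ := H.HB V hV z hz2
    refine ⟨(z, f), ⟨hf, hfz⟩, fun q hq => ⟨hz1 _ (Finset.mem_image_of_mem _ hq), hfV _ ?_⟩⟩
    rw [hVd]
    exact Submodule.subset_span (Finset.mem_coe.mpr (Finset.mem_image_of_mem _ hq)))
  refine ⟨p, h1, fun m n hmn => ?_⟩
  rcases lt_or_gt_of_ne hmn with h | h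
  · exact (h2 m n h).1
  · exact (h2 n m h).2

lemma tau_cont (H : PHyp W t s) [CompleteSpace E] {τ : ℂ →+* ℂ} (T : E → X)
    (hT : ∀ f ∈ W, f ≠ 0 → ∃ c : ℂ, c ≠ 0 ∧ ∀ e, c * s f (T e) = τ (f e)) : Continuous τ := by
  by_cases hb : ∃ δ > 0, ∃ C, ∀ l : ℂ, ‖l‖ ≤ δ → ‖τ l‖ ≤ C
  · obtain ⟨δ, hδ, C, hC⟩ := hb
    refine AddMonoidHom.continuous_of_isBounded_nhds_zero (s := Metric.closedBall 0 δ) (τ : ℂ →+ ℂ)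
      (Metric.closedBall_mem_nhds _ hδ) ?_
    rw [isBounded_iff_forall_norm_le]
    refine ⟨C, ?_⟩
    rintro _ ⟨l, hl, rfl⟩
    exact hC l (by simpa using hl)
  exfalso
  push Not at hb
  obtain ⟨p, hp, hpo⟩ := H.biorth_seq
  have hK : ∀ n, ∃ K : ℝ, 0 ≤ K ∧ ∀ e, ‖τ ((p n).2 e)‖ ≤ K * ‖T e‖ := by
    intro n
    obtain ⟨c, hc, h⟩ := hT (p n).2 (hp n).1 (ne_of (hp n).2)
    refine ⟨‖c‖ * ‖s (p n).2‖, by positivity, fun e => ?_⟩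
    rw [← h, norm_mul, mul_assoc]
    gcongr
    exact ContinuousLinearMap.le_opNorm _ _
  choose K hK0 hK using hK
  have hl : ∀ n : ℕ, ∃ l : ℂ, ‖l‖ ≤ (1/2)^n / (‖(p n).1‖ + 1) ∧ n * K n < ‖τ l‖ := fun n =>
    hb _ (by positivity) _
  choose l hl1 hl2 using hl
  have hsum : Summable (fun n => l n • (p n).1) := by
    refine Summable.of_norm_bounded (g := fun n : ℕ => (1/2 : ℝ)^n) summable_geometric_two fun n => ?_
    rw [norm_smul]
    have h := hl1 n
    rw [le_div_iff₀ (by positivity)] at h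
    refine le_trans ?_ h
    gcongr
    linarith
  have hfx : ∀ n, (p n).2 (∑' m, l m • (p m).1) = l n := by
    intro n
    rw [ContinuousLinearMap.map_tsum _ hsum, tsum_eq_single n]
    · rw [map_smul, (hp n).2]; simp
    · intro m hm
      rw [map_smul, hpo n m hm.symm, smul_zero]
  obtain ⟨n, hn⟩ := exists_nat_ge ‖T (∑' m, l m • (p m).1)‖
  have h1 := hK n (∑' m, l m • (p m).1)
  rw [hfx] at h1
  have h2 := hl2 n
  have : K n * ‖T (∑' m, l m • (p m).1)‖ ≤ K n * n := by gcongr; exact hK0 n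
  linarith

lemma T_cont (H : PHyp W t s) [CompleteSpace E] [CompleteSpace X] {τ : ℂ →+* ℂ} (hτ : Continuous τ) (T : E →ₛₗ[τ] X)
    (hT : ∀ f ∈ W, f ≠ 0 → ∃ c : ℂ, c ≠ 0 ∧ ∀ e, c * s f (T e) = τ (f e)) : Continuous T := by
  have hr : ∀ r : ℝ, τ r = r := by
    intro r
    rcases Complex.ringHom_eq_id_or_conj_of_continuous hτ with h | h <;> simp [h]
  let Tr : E →ₗ[ℝ] X :=
    { toFun := T
      map_add' := fun u v => map_add T u v
      map_smul' := fun r e => by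
        have : r • e = (r : ℂ) • e := by simp
        rw [this, map_smulₛₗ, hr]; simp }
  have : Continuous Tr := by
    apply LinearMap.continuous_of_seq_closed_graph
    intro u x y hu hy
    apply ext_dual
    intro g
    by_cases hg : g = 0
    · simp [hg]
    obtain ⟨f, hf, hf0, d, hd, rfl⟩ := H.ssurj g hg
    obtain ⟨c, hc, h⟩ := hT f hf hf0
    have l1 : Filter.Tendsto (fun n => c * s f (T (u n))) Filter.atTop (nhds (c * s f y)) :=
      (((s f).continuous.tendsto y).comp hy).const_mul c
    have l2 : Filter.Tendsto (fun n => c * s f (T (u n))) Filter.atTop (nhds (c * s f (T x))) := by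
      simp only [h]
      exact ((hτ.comp f.continuous).tendsto x).comp hu
    have := mul_left_cancel₀ hc (tendsto_nhds_unique l1 l2)
    show d * s f y = d * s f (T x)
    rw [this]
  exact this

/-- good equivalences -/
def Good (W : Submodule ℂ (E →L[ℂ] ℂ)) (t : E → X) (s : (E →L[ℂ] ℂ) → (X →L[ℂ] ℂ)) (σ : ℂ →+* ℂ)
    (T : E → X) : Prop :=
  (∀ e, e ≠ 0 → Par (T e) (t e)) ∧
    (∀ f ∈ W, f ≠ 0 → ∃ c : ℂ, c ≠ 0 ∧ ∀ e, c * s f (T e) = σ (f e))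

theorem main (H : PHyp W t s) [CompleteSpace E] [CompleteSpace X] :
    (∃ T : E ≃L[ℂ] X, Good W t s (RingHom.id ℂ) T) ∨
    (∃ T : E ≃SL[starRingEnd ℂ] X, Good W t s (starRingEnd ℂ) T) := by
  obtain ⟨τ, T, h1, h2⟩ := H.exists_T
  have hτ : Continuous τ := H.tau_cont T h2
  have hT := H.T_cont hτ T h2
  have hinj : Function.Injective T := by
    rw [injective_iff_map_eq_zero]
    intro e he
    by_contra h0
    obtain ⟨c, hc, h⟩ := h1 e h0
    rw [he] at h
    exact smul_ne_zero hc (H.t0 _ h0) h.symm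
  have hτs : Function.Surjective τ := by
    rcases Complex.ringHom_eq_id_or_conj_of_continuous hτ with h | h
    · rw [h]; exact fun c => ⟨c, rfl⟩
    · rw [h]; exact fun c => ⟨starRingEnd ℂ c, by simp⟩
  have hsurj : Function.Surjective T := by
    intro y
    by_cases hy : y = 0
    · exact ⟨0, by simp [hy]⟩
    obtain ⟨e, he, h⟩ := H.tsurj y hy
    obtain ⟨c, hc, h'⟩ := h.trans (h1 e he).symm
    obtain ⟨d, hd⟩ := hτs c
    exact ⟨d • e, by rw [map_smulₛₗ, hd, h']⟩
  rcases Complex.ringHom_eq_id_or_conj_of_continuous hτ with h | h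
  · left
    subst h
    obtain ⟨T', hT'⟩ := mkCLE T hT hinj hsurj
    have : (T' : E → X) = T := funext hT'
    exact ⟨T', by rw [this]; exact ⟨h1, h2⟩⟩
  · right
    subst h
    obtain ⟨T', hT'⟩ := mkCLE T hT hinj hsurj
    have : (T' : E → X) = T := funext hT'
    exact ⟨T', by rw [this]; exact ⟨h1, h2⟩⟩

end PHyp
end JP


namespace JP

variable {X : Type*} [NormedAddCommGroup X] [NormedSpace ℂ X]
variable {E : Type*} [NormedAddCommGroup E] [NormedSpace ℂ E]

lemma Par.zero_iff {a a' : X} {b b' : X →L[ℂ] ℂ} (h : Par a a') (h' : Par b b') :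
    b a = 0 ↔ b' a' = 0 := by
  obtain ⟨c, hc, rfl⟩ := h
  obtain ⟨d, hd, rfl⟩ := h'
  simp [hc, hd]

lemma helpA {e : X} {f : X →L[ℂ] ℂ} (he : e ≠ 0) (hf : f ≠ 0) (h : f e = 0) :
    ∃ p q : Dp X, p.1.1 = e ∧ q.1.2 = f ∧ p.1.2 q.1.1 = 0 ∧ q.1.2 p.1.1 = 0 := by
  obtain ⟨g, hg⟩ := exists_dual he
  obtain ⟨w, hw⟩ := exists_one_of_ne hf
  refine ⟨⟨(e, g), hg⟩, ⟨(w - g w • e, f), ?_⟩, rfl, rfl, ?_, h⟩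
  · simp [h, hw]
  · simp [hg]

lemma helpB {e : X} {f : X →L[ℂ] ℂ} (h : f e ≠ 0) :
    ∃ p : Dp X, Par p.1.1 e ∧ p.1.2 = f := by
  refine ⟨⟨((f e)⁻¹ • e, f), ?_⟩, ⟨(f e)⁻¹, inv_ne_zero h, rfl⟩, rfl⟩
  simp [h]

lemma exXF (hinf : ¬ FiniteDimensional ℂ X) :
    (∃ P : X → Dp X, ∀ e, e ≠ 0 → (P e).1.1 = e) ∧
    (∃ Q : (X →L[ℂ] ℂ) → Dp X, ∀ f, f ≠ 0 → (Q f).1.2 = f) := by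
  obtain ⟨x, y, f, g, h1, -⟩ := exists_biorth hinf
  constructor
  · have : ∀ e : X, ∃ p : Dp X, e ≠ 0 → p.1.1 = e := by
      intro e
      by_cases he : e = 0
      · exact ⟨⟨(x, f), h1⟩, fun h => absurd he h⟩
      · obtain ⟨g, hg⟩ := exists_dual he
        exact ⟨⟨(e, g), hg⟩, fun _ => rfl⟩
    choose P hP using this
    exact ⟨P, hP⟩
  · have : ∀ e : X →L[ℂ] ℂ, ∃ p : Dp X, e ≠ 0 → p.1.2 = e := by
      intro e
      by_cases he : e = 0
      · exact ⟨⟨(x, f), h1⟩, fun h => absurd he h⟩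
      · obtain ⟨w, hw⟩ := exists_one_of_ne he
        exact ⟨⟨(w, e), hw⟩, fun _ => rfl⟩
    choose P hP using this
    exact ⟨P, hP⟩

lemma Par.of_eq {F : Type*} [AddCommGroup F] [Module ℂ F] {u v : F} (h : u = v) : Par u v := h ▸ Par.refl u

/-- the preserving type -/
lemma pres_PHyp (hinf : ¬ FiniteDimensional ℂ X) {φ : (X →L[ℂ] X) → (X →L[ℂ] X)} {M : Dp X → Dp X}
    (H : MHyp φ M)
    (h1 : ∀ p q : Dp X, Par p.1.1 q.1.1 → Par (M p).1.1 (M q).1.1)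
    (h2 : ∀ p q : Dp X, Par p.1.2 q.1.2 → Par (M p).1.2 (M q).1.2) :
    ∃ (t : X → X) (s : (X →L[ℂ] ℂ) → (X →L[ℂ] ℂ)), PHyp ⊤ t s ∧
      (∀ p : Dp X, Par (t p.1.1) (M p).1.1) ∧ (∀ p : Dp X, Par (s p.1.2) (M p).1.2) := by
  obtain ⟨⟨P, hP⟩, ⟨Q, hQ⟩⟩ := exXF hinf
  have ht : ∀ p : Dp X, Par (M (P p.1.1)).1.1 (M p).1.1 := fun p =>
    h1 _ _ (Par.of_eq (hP _ p.x_ne))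
  have hs : ∀ p : Dp X, Par (M (Q p.1.2)).1.2 (M p).1.2 := fun p =>
    h2 _ _ (Par.of_eq (hQ _ p.f_ne))
  refine ⟨fun e => (M (P e)).1.1, fun f => (M (Q f)).1.2, ⟨hinf, ?_, ?_, ?_, ?_, ?_, ?_⟩, ht, hs⟩
  · intro V hV e he
    haveI : FiniteDimensional ℂ V := Module.Finite.iff_fg.mpr hV
    obtain ⟨f, hf⟩ := HBV V he
    exact ⟨f, trivial, hf⟩
  · intro e _; exact (M (P e)).x_ne
  · intro f _ _; exact (M (Q f)).f_ne
  · intro e he f _ hf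
    constructor
    · intro h
      obtain ⟨p, q, rfl, rfl, h3, h4⟩ := helpA he hf h
      exact (Par.zero_iff (ht p) (hs q)).2 (H.orth q p ⟨h4, h3⟩)
    · intro h
      by_contra hne
      obtain ⟨p, hp, rfl⟩ := helpB hne
      have := (Par.zero_iff (h1 (P e) p (by rw [hP e he]; exact hp.symm)) (hs p)).1 h
      rw [(M p).2] at this
      exact one_ne_zero this
  · intro y hy
    obtain ⟨f, hf⟩ := exists_dual hy
    obtain ⟨p, hp, -⟩ := H.surj ⟨(y, f), hf⟩
    exact ⟨p.1.1, p.x_ne, hp.trans (ht p).symm⟩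
  · intro y hy
    obtain ⟨f, hf⟩ := exists_one_of_ne hy
    obtain ⟨p, -, hp⟩ := H.surj ⟨(f, y), hf⟩
    exact ⟨p.1.2, trivial, p.f_ne, hp.trans (hs p).symm⟩

noncomputable abbrev iota (X : Type*) [NormedAddCommGroup X] [NormedSpace ℂ X] :
    X →L[ℂ] ((X →L[ℂ] ℂ) →L[ℂ] ℂ) := NormedSpace.inclusionInDoubleDual ℂ X

lemma iota_apply (x : X) (f : X →L[ℂ] ℂ) : iota X x f = f x := rfl

lemma iota_inj : Function.Injective (iota X) := by
  intro x y h
  refine ext_dual fun f => ?_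
  rw [← iota_apply, h, iota_apply]

lemma dual_inf (hinf : ¬ FiniteDimensional ℂ X) : ¬ FiniteDimensional ℂ (X →L[ℂ] ℂ) := by
  intro h
  let L : X →ₗ[ℂ] ((X →L[ℂ] ℂ) →ₗ[ℂ] ℂ) :=
    { toFun := fun x => (iota X x).toLinearMap
      map_add' := by intro x y; ext f; simp
      map_smul' := by intro c x; ext f; simp }
  have hi : Function.Injective L := by
    intro x y hxy
    refine ext_dual fun f => ?_
    exact congrArg (fun l : (X →L[ℂ] ℂ) →ₗ[ℂ] ℂ => l f) hxy
  exact hinf (FiniteDimensional.of_injective L hi)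

lemma dual_HB (V : Submodule ℂ (X →L[ℂ] ℂ)) (hV : V.FG) (e : X →L[ℂ] ℂ) (he : e ∉ V) :
    ∃ x : X, (∀ v ∈ V, v x = 0) ∧ e x = 1 := by
  by_contra hcon
  push Not at hcon
  apply he
  obtain ⟨S, rfl⟩ := hV
  have hk : ∀ x : X, (∀ v ∈ S, v x = 0) → e x = 0 := by
    intro x hx
    by_contra hne
    refine hcon ((e x)⁻¹ • x) (fun v hv => ?_) (by simp [hne])
    induction hv using Submodule.span_induction with
    | mem v hv => simp [hx v hv]
    | zero => simp
    | add a b _ _ ha hb => rw [_root_.add_apply, ha, hb, add_zero]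
    | smul c a _ ha => rw [_root_.smul_apply, ha, smul_zero]
  have := mem_span_of_iInf_ker_le_ker (𝕜 := ℂ) (L := fun i : S => (i.1 : X →L[ℂ] ℂ).toLinearMap)
    (K := e.toLinearMap) (by
      intro x hx
      simp only [Submodule.mem_iInf, LinearMap.mem_ker] at hx ⊢
      exact hk x fun v hv => hx ⟨v, hv⟩)
  have h2 : Submodule.span ℂ (Set.range fun i : S => (i.1 : X →L[ℂ] ℂ).toLinearMap)
      = (Submodule.span ℂ (S : Set (X →L[ℂ] ℂ))).map (ContinuousLinearMap.coeLM ℂ) := by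
    rw [Submodule.map_span]
    congr 1
    ext; simp
  rw [h2] at this
  obtain ⟨v, hv, hve⟩ := this
  have : v = e := by
    ext x; exact congrArg (fun l : X →ₗ[ℂ] ℂ => l x) hve
  exact this ▸ hv

lemma swap_PHyp (hinf : ¬ FiniteDimensional ℂ X) {φ : (X →L[ℂ] X) → (X →L[ℂ] X)} {M : Dp X → Dp X}
    (H : MHyp φ M)
    (h1 : ∀ p q : Dp X, Par p.1.1 q.1.1 → Par (M p).1.2 (M q).1.2)
    (h2 : ∀ p q : Dp X, Par p.1.2 q.1.2 → Par (M p).1.1 (M q).1.1) :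
    ∃ (t : (X →L[ℂ] ℂ) → X) (s : ((X →L[ℂ] ℂ) →L[ℂ] ℂ) → (X →L[ℂ] ℂ)),
      PHyp (LinearMap.range (iota X).toLinearMap) t s ∧
      (∀ p : Dp X, Par (t p.1.2) (M p).1.1) ∧ (∀ p : Dp X, Par (s (iota X p.1.1)) (M p).1.2) := by
  obtain ⟨⟨P, hP⟩, ⟨Q, hQ⟩⟩ := exXF hinf
  have ht : ∀ p : Dp X, Par (M (Q p.1.2)).1.1 (M p).1.1 := fun p =>
    h2 _ _ (Par.of_eq (hQ _ p.f_ne))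
  let r : ((X →L[ℂ] ℂ) →L[ℂ] ℂ) → X := Function.invFun (iota X)
  have hr : ∀ x, r (iota X x) = x := Function.leftInverse_invFun iota_inj
  have hs : ∀ p : Dp X, Par (M (P (r (iota X p.1.1)))).1.2 (M p).1.2 := fun p => by
    rw [hr]; exact h1 _ _ (Par.of_eq (hP _ p.x_ne))
  refine ⟨fun f => (M (Q f)).1.1, fun ξ => (M (P (r ξ))).1.2,
    ⟨dual_inf hinf, ?_, ?_, ?_, ?_, ?_, ?_⟩, ht, hs⟩
  · intro V hV e he
    obtain ⟨x, hx, hx'⟩ := dual_HB V hV e he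
    exact ⟨iota X x, ⟨x, rfl⟩, hx, hx'⟩
  · intro e _; exact (M (Q e)).x_ne
  · intro f _ _; exact (M (P (r f))).f_ne
  · rintro f hf _ ⟨x, rfl⟩ hx
    have hx0 : x ≠ 0 := by
      rintro rfl; simp at hx
    change f x = 0 ↔ (M (P (r (iota X x)))).1.2 (M (Q f)).1.1 = 0
    constructor
    · intro h
      obtain ⟨p, q, rfl, rfl, h3, h4⟩ := helpA hx0 hf h
      exact (Par.zero_iff (ht q) (hs p)).2 (H.orth p q ⟨h3, h4⟩)
    · intro h
      by_contra hne
      obtain ⟨p, hp, rfl⟩ := helpB hne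
      have := (Par.zero_iff (ht p) (h1 (P (r (iota X x))) p
        (by rw [hr, hP x hx0]; exact hp.symm))).1 h
      rw [(M p).2] at this
      exact one_ne_zero this
  · intro y hy
    obtain ⟨f, hf⟩ := exists_dual hy
    obtain ⟨p, hp, -⟩ := H.surj ⟨(y, f), hf⟩
    exact ⟨p.1.2, p.f_ne, hp.trans (ht p).symm⟩
  · intro y hy
    obtain ⟨f, hf⟩ := exists_one_of_ne hy
    obtain ⟨p, -, hp⟩ := H.surj ⟨(f, y), hf⟩
    refine ⟨iota X p.1.1, ⟨_, rfl⟩, ?_, hp.trans (hs p).symm⟩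
    intro h0
    exact p.x_ne (iota_inj (by rw [h0, map_zero]))

section semi
variable {σ : ℂ →+* ℂ} [RingHomInvPair σ σ]

lemma W_top {W : Submodule ℂ (E →L[ℂ] ℂ)} {t : E → X} {s : (E →L[ℂ] ℂ) → (X →L[ℂ] ℂ)}
    (H : PHyp W t s) (hσ : Continuous σ) (T : E ≃SL[σ] X)
    (hG : PHyp.Good W t s σ T) (η : E →L[ℂ] ℂ) : η ∈ W := by
  by_cases hη : η = 0
  · rw [hη]; exact W.zero_mem
  have hσσ : ∀ a, σ (σ a) = a := fun a => RingHomInvPair.comp_apply_eq (σ := σ) (σ' := σ)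
  let g : X →L[ℂ] ℂ :=
    { toFun := fun y => σ (η (T.symm y))
      map_add' := by intro a b; simp
      map_smul' := by intro c a; simp [hσσ]
      cont := hσ.comp (η.continuous.comp T.symm.continuous) }
  have hg : ∀ y, g y = σ (η (T.symm y)) := fun _ => rfl
  have hg0 : g ≠ 0 := by
    intro h
    apply hη
    ext e
    have := hg (T e)
    rw [h] at this
    simp at this
    have h3 := congrArg σ this.symm
    rw [hσσ] at h3
    simpa using h3
  obtain ⟨ξ, hξ, hξ0, d, hd, hgd⟩ := H.ssurj g hg0
  obtain ⟨c, hc, hce⟩ := hG.2 ξ hξ hξ0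
  have : η = σ (d / c) • ξ := by
    ext e
    have h1 := hg (T e)
    rw [hgd] at h1
    simp at h1
    have h2 := hce e
    rw [← hσσ (η e), ← h1, _root_.smul_apply, smul_eq_mul, ← hσσ (ξ e), ← h2, ← map_mul]
    congr 1
    field_simp
  rw [this]
  exact W.smul_mem _ hξ

lemma inter {W : Submodule ℂ (E →L[ℂ] ℂ)} {t : E → X} {s : (E →L[ℂ] ℂ) → (X →L[ℂ] ℂ)}
    (T : E ≃SL[σ] X) (hG : PHyp.Good W t s σ T) {e : E} {f : E →L[ℂ] ℂ} (hf : f ∈ W) (hfe : f e = 1)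
    {a : X} {b : X →L[ℂ] ℂ} (hab : b a = 1) (ha : Par (t e) a) (hb : Par (s f) b) (z : E) :
    b (T z) • a = T (f z • e) := by
  obtain ⟨α, hα, hTe⟩ := (hG.1 e (PHyp.ne_of' hfe)).trans ha
  obtain ⟨c, hc, hce⟩ := hG.2 f hf (PHyp.ne_of hfe)
  obtain ⟨d, hd, hsd⟩ := hb
  rw [hsd] at hce
  simp only [_root_.smul_apply, smul_eq_mul] at hce
  have h1 := hce e
  rw [hfe, hTe, map_smul, hab, map_one] at h1
  simp only [smul_eq_mul, mul_one] at h1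
  rw [map_smulₛₗ, hTe, ← hce, smul_smul]
  congr 1
  linear_combination (-b (T z)) * h1

/-- conjugate of an operator -/
noncomputable def cj (T : E ≃SL[σ] X) (A : X →L[ℂ] X) : E →L[ℂ] E :=
  (T.symm : X →SL[σ] E).comp (A.comp (T : E →SL[σ] X))

lemma cj_apply (T : E ≃SL[σ] X) (A : X →L[ℂ] X) (z : E) : cj T A z = T.symm (A (T z)) := rfl

lemma cj_rel (T : E ≃SL[σ] X) (A C : X →L[ℂ] X) : Rel (cj T A) (cj T C) ↔ Rel A C := by
  rw [Rel_iff, Rel_iff]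
  simp only [cj_apply, map_add, ContinuousLinearEquiv.apply_symm_apply]
  have h2 : σ 2 = 2 := map_ofNat σ 2
  constructor
  · intro h z
    have := congrArg T (h (T.symm z))
    simpa [map_add, map_smulₛₗ, h2] using this
  · intro h z
    have := congrArg T.symm (h (T z))
    simpa [map_add, map_smulₛₗ, h2] using this

lemma pres_final (hinf : ¬ FiniteDimensional ℂ X) {φ : (X →L[ℂ] X) → (X →L[ℂ] X)}
    (hrel : ∀ A C, Rel A C ↔ Rel (φ A) (φ C)) {M : Dp X → Dp X} (H : MHyp φ M)
    {t : X → X} {s : (X →L[ℂ] ℂ) → (X →L[ℂ] ℂ)}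
    (ht : ∀ p : Dp X, Par (t p.1.1) (M p).1.1) (hs : ∀ p : Dp X, Par (s p.1.2) (M p).1.2)
    (T : X ≃SL[σ] X) (hG : PHyp.Good ⊤ t s σ T) : ∀ A x, φ A x = T (A (T.symm x)) := by
  have hi : ∀ (p : Dp X) z, pj (M p) (T z) = T (pj p z) := by
    intro p z
    simp only [pj, rk_apply]
    exact inter T hG trivial p.2 (M p).2 (ht p) (hs p) z
  have F : FixHyp (fun A => cj T (φ A)) := by
    refine ⟨hinf, fun A C => (hrel A C).trans (cj_rel T _ _).symm, ?_, ?_⟩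
    · intro x f h
      ext z
      have h1 := H.eq ⟨(x, f), h⟩
      have h2 := hi ⟨(x, f), h⟩ z
      rw [← h1] at h2
      rw [cj_apply]
      change T.symm ((φ (pj ⟨(x, f), h⟩)) (T z)) = _
      rw [h2]; simp [pj]
    · intro x f h
      ext z
      have h1 := H.eqm ⟨(x, f), h⟩
      have h2 := hi ⟨(x, f), h⟩ z
      rw [cj_apply]
      change T.symm ((φ (-pj ⟨(x, f), h⟩)) (T z)) = _
      rw [h1, _root_.neg_apply, h2]; simp [pj]
  intro A x
  have := congrArg (fun S : X →L[ℂ] X => T (S (T.symm x))) (F.fix A)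
  simpa [cj_apply] using this

lemma swap_final (hinf : ¬ FiniteDimensional ℂ X) {φ : (X →L[ℂ] X) → (X →L[ℂ] X)}
    (hrel : ∀ A C, Rel A C ↔ Rel (φ A) (φ C)) {M : Dp X → Dp X} (H : MHyp φ M)
    {t : (X →L[ℂ] ℂ) → X} {s : ((X →L[ℂ] ℂ) →L[ℂ] ℂ) → (X →L[ℂ] ℂ)}
    (ht : ∀ p : Dp X, Par (t p.1.2) (M p).1.1) (hs : ∀ p : Dp X, Par (s (iota X p.1.1)) (M p).1.2)
    (hsurj : Function.Surjective (iota X))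
    (T : (X →L[ℂ] ℂ) ≃SL[σ] X)
    (hG : PHyp.Good (LinearMap.range (iota X).toLinearMap) t s σ T) :
    ∀ A x, φ A x = T ((T.symm x).comp A) := by
  have hi : ∀ (p : Dp X) z, pj (M p) (T z) = T (z.comp (pj p)) := by
    intro p z
    have e : z.comp (pj p) = (iota X p.1.1) z • p.1.2 := by
      ext w; simp [pj, iota_apply, mul_comm]
    rw [e]
    simp only [pj, rk_apply]
    exact inter T hG ⟨_, rfl⟩ p.2 (M p).2 (ht p) (hs p) z
  let J : X ≃ₗᵢ[ℂ] ((X →L[ℂ] ℂ) →L[ℂ] ℂ) :=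
    LinearIsometryEquiv.ofSurjective (NormedSpace.inclusionInDoubleDualLi ℂ) hsurj
  have hJ : ∀ x f, J x f = f x := fun _ _ => rfl
  have hTh : ∀ B : (X →L[ℂ] ℂ) →L[ℂ] (X →L[ℂ] ℂ), ∃ S : X →L[ℂ] X, ∀ (ξ : X →L[ℂ] ℂ) z,
      ξ (S z) = (B ξ) z := by
    intro B
    refine ⟨(J.symm.toContinuousLinearEquiv.toContinuousLinearMap).comp
      ((ContinuousLinearMap.precomp ℂ B).comp J.toContinuousLinearEquiv.toContinuousLinearMap), ?_⟩
    intro ξ z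
    have e : J (J.symm ((J z).comp B)) = (J z).comp B := J.apply_symm_apply _
    exact congrArg (fun k : (X →L[ℂ] ℂ) →L[ℂ] ℂ => k ξ) e
  choose Θ hΘ using hTh
  have hΘrel : ∀ B D, Rel (Θ B) (Θ D) ↔ Rel B D := by
    intro B D
    rw [Rel_iff, Rel_iff]
    constructor
    · intro h ξ
      ext z
      have := congrArg ξ (h z)
      simp only [map_add, map_smul, hΘ] at this
      simp only [map_add, _root_.add_apply, _root_.smul_apply]
      linear_combination this
    · intro h z
      refine ext_dual fun ξ => ?_
      have := congrArg (fun k : X →L[ℂ] ℂ => k z) (h ξ)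
      simp only [map_add, _root_.add_apply, _root_.smul_apply] at this
      simp only [map_add, map_smul, hΘ]
      linear_combination this
  have F : FixHyp (fun A => Θ (cj T (φ A))) := by
    refine ⟨hinf, fun A C => (hrel A C).trans ((cj_rel T _ _).symm.trans (hΘrel _ _).symm), ?_, ?_⟩
    · intro x f h
      ext z
      refine ext_dual fun ξ => ?_
      have h1 := H.eq ⟨(x, f), h⟩
      have h2 := hi ⟨(x, f), h⟩ ξ
      rw [hΘ, cj_apply]
      change (T.symm ((φ (pj ⟨(x, f), h⟩)) (T ξ))) z = _
      rw [h1, h2]; simp [pj]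
    · intro x f h
      ext z
      refine ext_dual fun ξ => ?_
      have h1 := H.eqm ⟨(x, f), h⟩
      have h2 := hi ⟨(x, f), h⟩ ξ
      rw [hΘ, cj_apply]
      change (T.symm ((φ (-pj ⟨(x, f), h⟩)) (T ξ))) z = _
      rw [h1, _root_.neg_apply, h2]; simp [pj]
  intro A x
  have h3 : cj T (φ A) (T.symm x) = (T.symm x).comp A := by
    ext z
    rw [← hΘ]
    exact congrArg (fun S : X →L[ℂ] X => T.symm x (S z)) (F.fix A)
  rw [← h3, cj_apply]; simp

end semi

lemma final [CompleteSpace X] {φ : (X →L[ℂ] X) → (X →L[ℂ] X)} (N : NHyp φ) :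
    ((∃ T : X ≃L[ℂ] X, ∀ A x, φ A x = T (A (T.symm x))) ∨
       (∃ T : X ≃SL[starRingEnd ℂ] X, ∀ A x, φ A x = T (A (T.symm x)))) ∨
    (Function.Surjective (NormedSpace.inclusionInDoubleDual ℂ X) ∧
        ((∃ T : (X →L[ℂ] ℂ) ≃L[ℂ] X, ∀ A x, φ A x = T ((T.symm x).comp A)) ∨
         (∃ T : (X →L[ℂ] ℂ) ≃SL[starRingEnd ℂ] X, ∀ A x, φ A x = T ((T.symm x).comp A)))) := by
  obtain ⟨M, H⟩ := N.exM_map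
  rcases H.typ with ⟨h1, h2⟩ | ⟨h1, h2⟩
  · left
    obtain ⟨t, s, HP, ht, hs⟩ := pres_PHyp N.inf H h1 h2
    rcases HP.main with ⟨T, hG⟩ | ⟨T, hG⟩
    · exact Or.inl ⟨T, pres_final N.inf N.rel H ht hs T hG⟩
    · exact Or.inr ⟨T, pres_final N.inf N.rel H ht hs T hG⟩
  · right
    obtain ⟨t, s, HP, ht, hs⟩ := swap_PHyp N.inf H h1 h2
    rcases HP.main with ⟨T, hG⟩ | ⟨T, hG⟩
    · have hsur : Function.Surjective (iota X) := fun η => W_top HP continuous_id T hG η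
      exact ⟨hsur, Or.inl ⟨T, swap_final N.inf N.rel H ht hs hsur T hG⟩⟩
    · have hsur : Function.Surjective (iota X) := fun η => W_top HP Complex.continuous_conj T hG η
      exact ⟨hsur, Or.inr ⟨T, swap_final N.inf N.rel H ht hs hsur T hG⟩⟩

end JP

theorem stmt_0 {X : Type*} [NormedAddCommGroup X] [NormedSpace ℂ X] [CompleteSpace X]
    (hinf : ¬ FiniteDimensional ℂ X)
    (φ : (X →L[ℂ] X) → (X →L[ℂ] X))
    (hrange : ∀ P : X →L[ℂ] X,
      ((P * P = P ∧ P ≠ 0) ∨ (P * P = -P ∧ P ≠ 0)) → ∃ A, φ A = P)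
    (hpres : ∀ A B : X →L[ℂ] X,
      IsIdempotentElem ((2⁻¹ : ℂ) • (A * B + B * A)) ↔
        IsIdempotentElem ((2⁻¹ : ℂ) • (φ A * φ B + φ B * φ A))) :
    (∃ lam : ℂ, (lam = 1 ∨ lam = -1) ∧
      ((∃ T : X ≃L[ℂ] X, ∀ A x, φ A x = lam • T (A (T.symm x))) ∨
       (∃ T : X ≃SL[starRingEnd ℂ] X, ∀ A x, φ A x = lam • T (A (T.symm x))))) ∨
    (Function.Surjective (NormedSpace.inclusionInDoubleDual ℂ X) ∧
      ∃ lam : ℂ, (lam = 1 ∨ lam = -1) ∧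
        ((∃ T : (X →L[ℂ] ℂ) ≃L[ℂ] X, ∀ A x, φ A x = lam • T ((T.symm x).comp A)) ∨
         (∃ T : (X →L[ℂ] ℂ) ≃SL[starRingEnd ℂ] X, ∀ A x, φ A x = lam • T ((T.symm x).comp A)))) := by
  have key : ∃ lam : ℂ, (lam = 1 ∨ lam = -1) ∧ ∃ ψ : (X →L[ℂ] X) → (X →L[ℂ] X),
      (∀ A x, φ A x = lam • ψ A x) ∧ JP.NHyp ψ := by
    rcases JP.normalize hinf hrange hpres with h | h
    · exact ⟨1, Or.inl rfl, φ, fun A x => (one_smul ℂ _).symm, h⟩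
    · exact ⟨-1, Or.inr rfl, _, fun A x => by simp, h⟩
  obtain ⟨lam, hl, ψ, hψ, N⟩ := key
  simp only [hψ]
  rcases JP.final N with (⟨T, h⟩ | ⟨T, h⟩) | ⟨hs, (⟨T, h⟩ | ⟨T, h⟩)⟩
  · exact Or.inl ⟨lam, hl, Or.inl ⟨T, fun A x => by rw [h]⟩⟩
  · exact Or.inl ⟨lam, hl, Or.inr ⟨T, fun A x => by rw [h]⟩⟩
  · exact Or.inr ⟨hs, lam, hl, Or.inl ⟨T, fun A x => by rw [h]⟩⟩
  · exact Or.inr ⟨hs, lam, hl, Or.inr ⟨T, fun A x => by rw [h]⟩⟩
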